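/- Let k be a ring, G a group, and H a normal subgroup of G of finite index. Let M be a kG-module and f a proper complexity function. Assume that for every subgroup E with H ≤ E ≤ G such that E/H is elementary abelian, cds_{kE}(M) ≤ f. Then cds_{kG}(M) ≤ f. -/

import Mathlib

open CategoryTheory

noncomputable section

/-- `f : ℕ → ℝ≥0` is a proper complexity function. -/
def IsProperComplexityFunction (f : ℕ → NNReal) : Prop :=
  ∀ n : ℤ, ∃ c : NNReal, ∀ m : ℕ, 0 ≤ (m : ℤ) + n → f ((m : ℤ) + n).toNat < c * f m

/-- The module `P` can be generated by at most `b` elements over `R`. -/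
def RankLE (R : Type) [Ring R] (P : Type) [AddCommGroup P] [Module R P] (b : NNReal) : Prop :=
  ∃ s : Finset P, Submodule.span R (s : Set P) = ⊤ ∧ (s.card : NNReal) ≤ b

/-- `c_R(M) ≤ f` : `M` has a projective resolution whose `n`-th term has rank at most
`d * f n` for some constant `d`. -/
def ComplexityLE (R : Type) [Ring R] (M : ModuleCat.{0} R) (f : ℕ → NNReal) : Prop :=
  ∃ (P : ProjectiveResolution M) (d : NNReal),
    ∀ n : ℕ, RankLE R (P.complex.X n) (d * f n)

/-- `cds_R(M) ≤ f` : complexity at most `f` up to a direct summand. -/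
def CdsLE (R : Type) [Ring R] (M : ModuleCat.{0} R) (f : ℕ → NNReal) : Prop :=
  ∃ N : ModuleCat.{0} R, ComplexityLE R (ModuleCat.of R (M × N)) f

/-- The ring homomorphism `k[H] →+* k[G]` induced by the inclusion of a subgroup `H ≤ G`. -/
def subgroupRingHom (k : Type) [Ring k] {G : Type} [Group G] (H : Subgroup G) :
    MonoidAlgebra k H →+* MonoidAlgebra k G :=
  MonoidAlgebra.mapDomainRingHom k H.subtype

/-- Restriction of a `k[G]`-module to a `k[H]`-module, `H ≤ G`. -/
def resMod (k : Type) [Ring k] {G : Type} [Group G] (H : Subgroup G)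
    (M : ModuleCat.{0} (MonoidAlgebra k G)) : ModuleCat.{0} (MonoidAlgebra k H) :=
  (ModuleCat.restrictScalars (subgroupRingHom k H)).obj M

/-- A group is elementary abelian if it is isomorphic to `(ℤ/p)^r` for a prime `p`. -/
def IsElementaryAbelian (Q : Type) [Group Q] : Prop :=
  ∃ (p r : ℕ), p.Prime ∧ Nonempty (Q ≃* Multiplicative (Fin r → ZMod p))

/-- A group is `p`-elementary abelian if it is isomorphic to `(ℤ/p)^r`. -/
def IsPElementaryAbelian (p : ℕ) (Q : Type) [Group Q] : Prop :=
  ∃ r : ℕ,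
  Nonempty (Q ≃* Multiplicative (Fin r → ZMod p))

/-! ### Short exact sequences of modules -/

section ShortExact

variable (R : Type) [Ring R]

/-- There is a short exact sequence `0 → A → B → C → 0` of `R`-modules. -/
def SES (A B C : Type) [AddCommGroup A] [Module R A] [AddCommGroup B] [Module R B]
    [AddCommGroup C] [Module R C] : Prop :=
  ∃ (i : A →ₗ[R] B) (q : B →ₗ[R] C),
    Function.Injective i ∧ Function.Exact i q ∧ Function.Surjective q

variable {R}
variable {A B C D K P A' B' C' : Type}
  [AddCommGroup A] [Module R A] [AddCommGroup B] [Module R B] [AddCommGroup C] [Module R C]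
  [AddCommGroup D] [Module R D] [AddCommGroup K] [Module R K] [AddCommGroup P] [Module R P]
  [AddCommGroup A'] [Module R A'] [AddCommGroup B'] [Module R B'] [AddCommGroup C'] [Module R C']

theorem SES.of_ker (q : B →ₗ[R] C) (hq : Function.Surjective q) : SES R (LinearMap.ker q) B C :=
  ⟨(LinearMap.ker q).subtype, q, Subtype.val_injective, fun x => by simp, hq⟩

theorem SES.congr (h : SES R A B C) (a : A ≃ₗ[R] A') (b : B ≃ₗ[R] B') (c : C ≃ₗ[R] C') :
    SES R A' B' C' := by
  obtain ⟨i, q, hi, he, hq⟩ := h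
  refine ⟨b.toLinearMap ∘ₗ i ∘ₗ a.symm.toLinearMap, c.toLinearMap ∘ₗ q ∘ₗ b.symm.toLinearMap,
    by simpa using hi, fun x => ?_, by simpa using hq⟩
  have := he (b.symm x)
  simp only [LinearMap.comp_apply, LinearEquiv.coe_coe, LinearEquiv.map_eq_zero_iff, this,
    Set.mem_range]
  constructor
  · rintro ⟨y, hy⟩
    exact ⟨a y, by simp [hy]⟩
  · rintro ⟨y, rfl⟩
    exact ⟨a.symm y, by simp⟩

theorem SES.prod (h : SES R A B C) (h' : SES R A' B' C') :
    SES R (A × A') (B × B') (C × C') := by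
  obtain ⟨i, q, hi, he, hq⟩ := h
  obtain ⟨i', q', hi', he', hq'⟩ := h'
  refine ⟨i.prodMap i', q.prodMap q', hi.prodMap hi', ?_, hq.prodMap hq'⟩
  rintro ⟨x, y⟩
  have h1 := he x
  have h2 := he' y
  simp only [Set.mem_range] at h1 h2
  simp only [LinearMap.prodMap_apply, Prod.mk_eq_zero, h1, h2, Set.mem_range, Prod.exists,
    Prod.mk.injEq]
  exact ⟨fun ⟨⟨a, ha⟩, b, hb⟩ => ⟨a, b, ha, hb⟩, fun ⟨a, b, ha, hb⟩ => ⟨⟨a, ha⟩, b, hb⟩⟩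

theorem SES.left_split (A B : Type) [AddCommGroup A] [Module R A] [AddCommGroup B] [Module R B] :
    SES R A (A × B) B :=
  ⟨LinearMap.inl R A B, LinearMap.snd R A B, LinearMap.inl_injective,
    Function.Exact.inl_snd, Prod.snd_surjective⟩

theorem SES.prod_left (h : SES R A B C) (D : Type) [AddCommGroup D] [Module R D] :
    SES R A (D × B) (D × C) := by
  obtain ⟨i, q, hi, he, hq⟩ := h
  refine ⟨LinearMap.inr R D B ∘ₗ i, LinearMap.id.prodMap q,
    LinearMap.inr_injective.comp hi, ?_, Function.surjective_id.prodMap hq⟩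
  rintro ⟨x, y⟩
  have h2 := he y
  simp only [Set.mem_range] at h2
  simp only [LinearMap.prodMap_apply, Prod.mk_eq_zero, h2, Set.mem_range, Prod.mk.injEq,
    LinearMap.comp_apply, LinearMap.inr_apply, LinearMap.id_apply]
  exact ⟨fun ⟨ha, b, hb⟩ => ⟨b, ha.symm, hb⟩, fun ⟨b, ha, hb⟩ => ⟨ha.symm, b, hb⟩⟩

/-- The kernel of the composite of two surjections. -/
theorem SES.comp (h : SES R A B C) (h' : SES R K P B) :
    ∃ L : ModuleCat.{0} R, SES R L P C ∧ SES R K L A := by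
  obtain ⟨i, q, hi, he, hq⟩ := h
  obtain ⟨j, r, hj, he', hr⟩ := h'
  refine ⟨ModuleCat.of R (LinearMap.ker (q ∘ₗ r)), SES.of_ker _ (hq.comp hr), ?_⟩
  let e := LinearEquiv.ofInjective i hi
  have hmem : ∀ x : LinearMap.ker (q ∘ₗ r), r x ∈ LinearMap.range i := fun x => (he _).1 x.2
  refine ⟨j.codRestrict _ fun x => ?_,
    e.symm.toLinearMap ∘ₗ (r ∘ₗ Submodule.subtype _).codRestrict _ hmem, ?_, ?_, ?_⟩
  · simp [he'.apply_apply_eq_zero]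
  · intro x y hxy
    exact hj (congrArg Subtype.val hxy)
  · intro x
    simp only [LinearMap.comp_apply, LinearEquiv.coe_coe, LinearEquiv.map_eq_zero_iff]
    rw [← Subtype.coe_inj]
    refine (he' x.1).trans (exists_congr fun y => ?_)
    rw [← Subtype.coe_inj]
    rfl
  · refine e.symm.surjective.comp ?_
    rintro ⟨y, hy⟩
    obtain ⟨x, rfl⟩ := hr y
    exact ⟨⟨x, (he _).2 hy⟩, rfl⟩

/-- The pullback of two surjections. -/
theorem SES.pullback (h : SES R A B C) (h' : SES R K P C) :
    ∃ E : ModuleCat.{0} R, SES R A E P ∧ SES R K E B := by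
  obtain ⟨i, q, hi, he, hq⟩ := h
  obtain ⟨j, r, hj, he', hr⟩ := h'
  let E := LinearMap.eqLocus (q ∘ₗ LinearMap.fst R B P) (r ∘ₗ LinearMap.snd R B P)
  have hE : ∀ x : B × P, x ∈ E ↔ q x.1 = r x.2 := fun x => Iff.rfl
  refine ⟨ModuleCat.of R E, ⟨(LinearMap.inl R B P ∘ₗ i).codRestrict E fun x => ?_,
    LinearMap.snd R B P ∘ₗ E.subtype, ?_, ?_, ?_⟩,
    ⟨(LinearMap.inr R B P ∘ₗ j).codRestrict E fun x => ?_,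
    LinearMap.fst R B P ∘ₗ E.subtype, ?_, ?_, ?_⟩⟩
  · simp [hE, he.apply_apply_eq_zero]
  · exact fun x y hxy => hi (congrArg (fun z => z.1.1) hxy)
  · rintro ⟨⟨x, y⟩, hx⟩
    rw [hE] at hx
    simp only [LinearMap.comp_apply, Submodule.subtype_apply, LinearMap.snd_apply, Set.mem_range]
    constructor
    · rintro rfl
      obtain ⟨a, rfl⟩ := (he x).1 (by simpa using hx)
      exact ⟨a, rfl⟩
    · rintro ⟨a, ha⟩
      exact (congrArg (fun z => z.1.2) ha).symm
  · intro y
    obtain ⟨x, hx⟩ := hq (r y)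
    exact ⟨⟨(x, y), hx⟩, rfl⟩
  · simp [hE, he'.apply_apply_eq_zero]
  · exact fun x y hxy => hj (congrArg (fun z => z.1.2) hxy)
  · rintro ⟨⟨x, y⟩, hx⟩
    rw [hE] at hx
    simp only [LinearMap.comp_apply, Submodule.subtype_apply, LinearMap.fst_apply, Set.mem_range]
    constructor
    · rintro rfl
      obtain ⟨a, rfl⟩ := (he' y).1 (by simpa using hx.symm)
      exact ⟨a, rfl⟩
    · rintro ⟨a, ha⟩
      exact (congrArg (fun z => z.1.1) ha).symm
  · intro x
    obtain ⟨y, hy⟩ := hr (q x)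
    exact ⟨⟨(x, y), hy.symm⟩, rfl⟩

theorem SES.equiv_prod [Module.Projective R C] (h : SES R A B C) : Nonempty (B ≃ₗ[R] A × C) := by
  obtain ⟨i, q, hi, he, hq⟩ := h
  obtain ⟨l, hl⟩ := Module.projective_lifting_property q LinearMap.id hq
  exact ⟨(he.splitSurjectiveEquiv hi ⟨l, hl⟩).1⟩

/-- One step of the horseshoe lemma. -/
theorem SES.horseshoe {KA PA KC PC : Type} [AddCommGroup KA] [Module R KA]
    [AddCommGroup PA] [Module R PA] [AddCommGroup KC] [Module R KC]
    [AddCommGroup PC] [Module R PC] [Module.Projective R PC] (h : SES R A B C)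
    (hA : SES R KA PA A) (hC : SES R KC PC C) :
    ∃ K : ModuleCat.{0} R, SES R K (PA × PC) B ∧ SES R KA K KC := by
  obtain ⟨E, h1, h2⟩ := h.pullback hC
  obtain ⟨e⟩ := h1.equiv_prod
  refine SES.comp h2 (P := PA × PC) ?_
  exact (hA.prod_left PC).congr (.refl _ _) (.prodComm _ _ _)
    ((LinearEquiv.prodComm R PC A).trans e.symm)

end ShortExact

section Rank

variable {R : Type} [Ring R] {P P' : Type} [AddCommGroup P] [Module R P] [AddCommGroup P']
  [Module R P']

theorem RankLE.mono {b b' : NNReal} (h : RankLE R P b) (hb : b ≤ b') : RankLE R P b' := by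
  obtain ⟨s, hs, hc⟩ := h
  exact ⟨s, hs, hc.trans hb⟩

theorem RankLE.finite {b : NNReal} (h : RankLE R P b) : Module.Finite R P := by
  obtain ⟨s, hs, -⟩ := h
  exact ⟨⟨s, hs⟩⟩

theorem RankLE.of_surjective {b : NNReal} (h : RankLE R P b) (q : P →ₗ[R] P')
    (hq : Function.Surjective q) : RankLE R P' b := by
  classical
  obtain ⟨s, hs, hc⟩ := h
  refine ⟨s.image q, ?_, le_trans (by exact_mod_cast Finset.card_image_le) hc⟩
  rw [Finset.coe_image, ← Submodule.map_span, hs, Submodule.map_top, LinearMap.range_eq_top.2 hq]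

theorem RankLE.prod {b b' : NNReal} (h : RankLE R P b) (h' : RankLE R P' b') :
    RankLE R (P × P') (b + b') := by
  classical
  obtain ⟨s, hs, hc⟩ := h
  obtain ⟨s', hs', hc'⟩ := h'
  refine ⟨s.image (LinearMap.inl R P P') ∪ s'.image (LinearMap.inr R P P'), ?_, ?_⟩
  · rw [Finset.coe_union, Finset.coe_image, Finset.coe_image, LinearMap.span_inl_union_inr, hs, hs',
      Submodule.prod_top]
  · refine le_trans ?_ (add_le_add hc hc')
    exact_mod_cast (Finset.card_union_le _ _).trans
      (add_le_add Finset.card_image_le Finset.card_image_le)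

theorem RankLE.of_subsingleton [Subsingleton P] (b : NNReal) : RankLE R P b :=
  ⟨∅, Subsingleton.elim _ _, by simp⟩

end Rank

/-! ### Modules with resolutions of bounded rank -/

section Bounded

variable (R : Type) [Ring R]

/-- `K` is the kernel of a surjection onto `M` from a projective module of rank at most `r`. -/
def IsSyzygy (r : NNReal) (M K : Type) [AddCommGroup M] [Module R M] [AddCommGroup K]
    [Module R K] : Prop :=
  ∃ P : ModuleCat.{0} R, Module.Projective R P ∧ RankLE R P r ∧ SES R K P M

/-- `M` has a projective resolution whose `n`-th term has rank at most `b n`, phrased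
coinductively. -/
def Bounded (b : ℕ → NNReal) (M : Type) [AddCommGroup M] [Module R M] : Prop :=
  ∃ S : ℕ → ModuleCat.{0} R → Prop, S 0 (ModuleCat.of R M) ∧
    ∀ n X, S n X → ∃ K : ModuleCat.{0} R, IsSyzygy R (b n) X K ∧ S (n + 1) K

variable {R}
variable {M M' K A B C N : Type} [AddCommGroup M] [Module R M] [AddCommGroup M'] [Module R M']
  [AddCommGroup K] [Module R K] [AddCommGroup A] [Module R A] [AddCommGroup B] [Module R B]
  [AddCommGroup C] [Module R C] [AddCommGroup N] [Module R N]
variable {b b' : ℕ → NNReal}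

theorem IsSyzygy.congr {r : NNReal} (h : IsSyzygy R r M K) (e : M ≃ₗ[R] M') :
    IsSyzygy R r M' K := by
  obtain ⟨P, h1, h2, h3⟩ := h
  exact ⟨P, h1, h2, h3.congr (.refl _ _) (.refl _ _) e⟩

theorem IsSyzygy.mono {r r' : NNReal} (h : IsSyzygy R r M K) (hr : r ≤ r') :
    IsSyzygy R r' M K := by
  obtain ⟨P, h1, h2, h3⟩ := h
  exact ⟨P, h1, h2.mono hr, h3⟩

theorem Bounded.uncons (h : Bounded R b M) :
    ∃ K : ModuleCat.{0} R, IsSyzygy R (b 0) M K ∧ Bounded R (fun n => b (n + 1)) K := by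
  obtain ⟨S, h0, hS⟩ := h
  obtain ⟨K, hK, hK'⟩ := hS 0 _ h0
  exact ⟨K, hK, fun n => S (n + 1), hK', fun n X hX => hS (n + 1) X hX⟩

theorem Bounded.cons (h : IsSyzygy R (b 0) M K) (hK : Bounded R (fun n => b (n + 1)) K) :
    Bounded R b M := by
  obtain ⟨S, h0, hS⟩ := hK
  refine ⟨fun n X => n.casesOn (Nonempty (M ≃ₗ[R] X)) (fun m => S m X),
    (⟨.refl _ _⟩ : Nonempty (M ≃ₗ[R] M)), ?_⟩
  rintro (_ | n) X hX
  · obtain ⟨e⟩ := hX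
    exact ⟨ModuleCat.of R K, h.congr e, h0⟩
  · exact hS n X hX

theorem Bounded.congr (h : Bounded R b M) (e : M ≃ₗ[R] M') : Bounded R b M' := by
  obtain ⟨K, hK, hK'⟩ := h.uncons
  exact Bounded.cons (hK.congr e) hK'

theorem Bounded.mono (h : Bounded R b M) (hb : ∀ n, b n ≤ b' n) : Bounded R b' M := by
  obtain ⟨S, h0, hS⟩ := h
  refine ⟨S, h0, fun n X hX => ?_⟩
  obtain ⟨K, hK, hK'⟩ := hS n X hX
  exact ⟨K, hK.mono (hb n), hK'⟩

theorem Bounded.of_subsingleton [Subsingleton M] : Bounded R b M := by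
  refine ⟨fun _ X => Subsingleton X, ‹_›, fun n X hX => ?_⟩
  have : Module.Projective R X := .of_free
  exact ⟨X, ⟨X, this, .of_subsingleton _, 0, 0, Function.injective_of_subsingleton _,
    fun x => by simp [Subsingleton.elim x 0], Function.surjective_to_subsingleton _⟩, hX⟩

theorem Bounded.extension (h : SES R A B C) (hA : Bounded R b A) (hC : Bounded R b' C) :
    Bounded R (fun n => b n + b' n) B := by
  obtain ⟨S, h0, hS⟩ := hA
  obtain ⟨S', h0', hS'⟩ := hC
  refine ⟨fun n X => ∃ A C : ModuleCat.{0} R, SES R A X C ∧ S n A ∧ S' n C,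
    ⟨_, _, h, h0, h0'⟩, ?_⟩
  rintro n X ⟨A, C, h, hA, hC⟩
  obtain ⟨KA, ⟨PA, p1, r1, s1⟩, hKA⟩ := hS n A hA
  obtain ⟨KC, ⟨PC, p2, r2, s2⟩, hKC⟩ := hS' n C hC
  obtain ⟨K, h1, h2⟩ := h.horseshoe s1 s2
  exact ⟨K, ⟨ModuleCat.of R (PA × PC), inferInstanceAs (Module.Projective R (PA × PC)),
    r1.prod r2, h1⟩, KA, KC, h2, hKA, hKC⟩

end Bounded

section Complexity

variable {f : ℕ → NNReal}

theorem IsProperComplexityFunction.pos (hf : IsProperComplexityFunction f) (n : ℕ) : 0 < f n := by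
  obtain ⟨c, hc⟩ := hf 0
  have := hc n (by simp)
  simp only [add_zero, Int.toNat_natCast] at this
  refine pos_iff_ne_zero.2 fun h => ?_
  simp [h] at this

theorem IsProperComplexityFunction.succ_le (hf : IsProperComplexityFunction f) :
    ∃ c : NNReal, ∀ n, f (n + 1) ≤ c * f n := by
  obtain ⟨c, hc⟩ := hf 1
  exact ⟨c, fun n => by simpa using (hc n (by omega)).le⟩

theorem IsProperComplexityFunction.le_succ (hf : IsProperComplexityFunction f) :
    ∃ c : NNReal, ∀ n, f n ≤ c * f (n + 1) := by
  obtain ⟨c, hc⟩ := hf (-1)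
  exact ⟨c, fun n => by simpa using (hc (n + 1) (by omega)).le⟩

variable (R : Type) [Ring R]

/-- `M` has complexity at most `f`. -/
def Cpx (f : ℕ → NNReal) (M : Type) [AddCommGroup M] [Module R M] : Prop :=
  ∃ d : NNReal, Bounded R (fun n => d * f n) M

/-- `M` is a direct summand of a module of complexity at most `f`. -/
def Cds (f : ℕ → NNReal) (M : Type) [AddCommGroup M] [Module R M] : Prop :=
  ∃ N : ModuleCat.{0} R, Cpx R f (M × N)

variable {R}
variable {M M' K A B C N P : Type} [AddCommGroup M] [Module R M] [AddCommGroup M'] [Module R M']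
  [AddCommGroup K] [Module R K] [AddCommGroup A] [Module R A] [AddCommGroup B] [Module R B]
  [AddCommGroup C] [Module R C] [AddCommGroup N] [Module R N] [AddCommGroup P] [Module R P]

theorem Cpx.congr (h : Cpx R f M) (e : M ≃ₗ[R] M') : Cpx R f M' := by
  obtain ⟨d, hd⟩ := h
  exact ⟨d, hd.congr e⟩

theorem Cpx.uncons (hf : IsProperComplexityFunction f) (h : Cpx R f M) :
    ∃ K P : ModuleCat.{0} R, Module.Projective R P ∧ Module.Finite R P ∧ SES R K P M ∧
      Cpx R f K := by
  obtain ⟨d, hd⟩ := h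
  obtain ⟨c, hc⟩ := hf.succ_le
  obtain ⟨K, ⟨P, h1, h2, h3⟩, hK'⟩ := hd.uncons
  refine ⟨K, P, h1, h2.finite, h3, d * c, hK'.mono fun n => ?_⟩
  rw [mul_assoc]
  exact mul_le_mul_right (hc n) d

theorem Cpx.cons (hf : IsProperComplexityFunction f) [Module.Projective R P] [Module.Finite R P]
    (h : SES R K P M) (hK : Cpx R f K) : Cpx R f M := by
  obtain ⟨s, hs⟩ := Module.Finite.fg_top (R := R) (M := P)
  obtain ⟨d, hd⟩ := hK
  obtain ⟨c, hc⟩ := hf.le_succ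
  refine ⟨s.card / f 0 + d * c, Bounded.cons (K := K)
    ⟨ModuleCat.of R P, ‹_›, ⟨s, hs, ?_⟩, h⟩ (hd.mono fun n => ?_)⟩
  · rw [add_mul, div_mul_cancel₀ _ (hf.pos 0).ne']
    exact le_self_add
  · rw [add_mul, mul_assoc]
    exact (mul_le_mul_right (hc n) d).trans le_add_self

theorem Cpx.of_finite_projective (hf : IsProperComplexityFunction f) [Module.Projective R P]
    [Module.Finite R P] : Cpx R f P := by
  refine Cpx.cons hf (P := P) (K := PUnit)
    ((SES.left_split PUnit P).congr (.refl _ _) ?_ (.refl _ _)) ⟨0, Bounded.of_subsingleton⟩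
  exact LinearEquiv.uniqueProd

theorem Cpx.extension (h : SES R A B C) (hA : Cpx R f A) (hC : Cpx R f C) : Cpx R f B := by
  obtain ⟨d, hd⟩ := hA
  obtain ⟨d', hd'⟩ := hC
  exact ⟨d + d', (Bounded.extension h hd hd').mono fun n => by rw [add_mul]⟩

theorem Cpx.quotient (hf : IsProperComplexityFunction f) (h : SES R A B C) (hA : Cpx R f A)
    (hB : Cpx R f B) : Cpx R f C := by
  obtain ⟨K, P, h1, h2, h3, h4⟩ := hB.uncons hf
  obtain ⟨L, hL, hL'⟩ := h.comp h3
  exact Cpx.cons hf hL (Cpx.extension hL' h4 hA)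

theorem Cpx.cancel (hf : IsProperComplexityFunction f) [Module.Projective R P]
    [Module.Finite R P] (h : Cpx R f (P × M)) : Cpx R f M :=
  Cpx.quotient hf (SES.left_split P M) (.of_finite_projective hf) h

/-- A direct summand of a module of complexity at most `f` is complemented by any of its
syzygies. -/
theorem Cds.cpx_prod_syzygy (hf : IsProperComplexityFunction f) (h : Cds R f A)
    [Module.Projective R P] [Module.Finite R P] (hK : SES R K P A) : Cpx R f (A × K) := by
  obtain ⟨N, hN⟩ := h
  obtain ⟨W, Q, h1, h2, h3, h4⟩ := hN.uncons hf
  obtain ⟨L, hL, hL'⟩ := ((SES.left_split N A).congr (.refl _ _) (.prodComm _ _ _)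
    (.refl _ _)).comp h3
  have h5 : Cpx R f (A × L) := Cpx.extension (hL'.prod_left A) h4 hN
  obtain ⟨E, hE, hE'⟩ := hK.pullback hL
  obtain ⟨e⟩ := hE.equiv_prod
  obtain ⟨e'⟩ := hE'.equiv_prod
  have h6 : Cpx R f (P × (A × L)) := Cpx.extension (SES.left_split P _)
    (.of_finite_projective hf) h5
  refine Cpx.cancel hf (P := Q) (h6.congr ?_)
  exact (LinearEquiv.prodComm _ _ _).trans <| (LinearEquiv.prodAssoc _ _ _ _).trans <|
    (LinearEquiv.prodCongr (.refl _ _) (e'.symm.trans e)).trans <|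
    (LinearEquiv.prodAssoc _ _ _ _).symm.trans <| .prodComm _ _ _

theorem Cds.exists_syzygy (hf : IsProperComplexityFunction f) (h : Cds R f A) :
    ∃ K P : ModuleCat.{0} R, Module.Projective R P ∧ Module.Finite R P ∧ SES R K P A := by
  obtain ⟨N, hN⟩ := h
  obtain ⟨W, Q, h1, h2, h3, h4⟩ := hN.uncons hf
  obtain ⟨L, hL, hL'⟩ := ((SES.left_split N A).congr (.refl _ _) (.prodComm _ _ _)
    (.refl _ _)).comp h3
  exact ⟨L, Q, h1, h2, hL⟩

theorem Cds.congr (h : Cds R f M) (e : M ≃ₗ[R] M') : Cds R f M' := by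
  obtain ⟨N, hN⟩ := h
  exact ⟨N, hN.congr (.prodCongr e (.refl _ _))⟩

theorem Cds.of_cpx (h : Cpx R f M) : Cds R f M :=
  ⟨ModuleCat.of R PUnit, h.congr LinearEquiv.prodUnique.symm⟩

theorem Cds.fst (h : Cds R f (M × M')) : Cds R f M := by
  obtain ⟨N, hN⟩ := h
  exact ⟨ModuleCat.of R (M' × N), hN.congr (.prodAssoc _ _ _ _)⟩

theorem Cds.retract (h : Cds R f B) (i : A →ₗ[R] B) (r : B →ₗ[R] A)
    (hr : ∀ a, r (i a) = a) : Cds R f A := by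
  refine Cds.fst (M' := LinearMap.ker r) (h.congr ?_)
  have hker : ∀ x, (LinearMap.id - i ∘ₗ r : B →ₗ[R] B) x ∈ LinearMap.ker r := fun x => by simp [hr]
  refine LinearEquiv.ofLinearMap
    (r.prod ((LinearMap.id - i ∘ₗ r).codRestrict _ hker)) (i.coprod (LinearMap.ker r).subtype)
    (LinearMap.ext ?_) (LinearMap.ext fun x => by simp)
  rintro ⟨a, x, hx⟩
  rw [LinearMap.mem_ker] at hx
  refine Prod.ext ?_ (Subtype.ext ?_) <;> simp [hr, hx]

theorem Cds.extension (hf : IsProperComplexityFunction f) (h : SES R A B C) (hA : Cds R f A)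
    (hC : Cds R f C) : Cds R f B := by
  obtain ⟨KA, PA, a1, a2, a3⟩ := hA.exists_syzygy hf
  obtain ⟨KC, PC, c1, c2, c3⟩ := hC.exists_syzygy hf
  obtain ⟨K, hK, hK'⟩ := h.horseshoe a3 c3
  exact ⟨K, Cpx.extension (h.prod hK') (hA.cpx_prod_syzygy hf a3) (hC.cpx_prod_syzygy hf c3)⟩

theorem Cds.syzygy (hf : IsProperComplexityFunction f) (h : Cds R f A)
    [Module.Projective R P] [Module.Finite R P] (hK : SES R K P A) : Cds R f K :=
  ⟨ModuleCat.of R A, (h.cpx_prod_syzygy hf hK).congr (.prodComm _ _ _)⟩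

theorem Cds.quotient (hf : IsProperComplexityFunction f) (h : SES R A B C) (hA : Cds R f A)
    (hB : Cds R f B) : Cds R f C := by
  obtain ⟨K, P, h1, h2, h3⟩ := hB.exists_syzygy hf
  obtain ⟨L, hL, hL'⟩ := h.comp h3
  have hLc : Cds R f L := .extension hf hL' (hB.syzygy hf h3) hA
  obtain ⟨K', P', h1', h2', h3'⟩ := hLc.exists_syzygy hf
  exact ⟨L, Cpx.cons hf (hL.prod h3') (hLc.cpx_prod_syzygy hf h3')⟩

theorem Cds.kernel (hf : IsProperComplexityFunction f) (h : SES R A B C) (hB : Cds R f B)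
    (hC : Cds R f C) : Cds R f A := by
  obtain ⟨K, P, h1, h2, h3⟩ := hC.exists_syzygy hf
  obtain ⟨E, hE, hE'⟩ := h.pullback h3
  obtain ⟨e⟩ := hE.equiv_prod
  exact ((Cds.extension hf hE' (hC.syzygy hf h3) hB).congr e).fst

theorem Cds.prod (hf : IsProperComplexityFunction f) (hA : Cds R f A) (hB : Cds R f B) :
    Cds R f (A × B) :=
  .extension hf (SES.left_split A B) hA hB

theorem Cds.of_subsingleton [Subsingleton M] : Cds R f M :=
  .of_cpx ⟨0, .of_subsingleton⟩

theorem Cds.pi (hf : IsProperComplexityFunction f) {ι : Type} [Finite ι] (V : ι → Type)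
    [∀ i, AddCommGroup (V i)] [∀ i, Module R (V i)] (h : ∀ i, Cds R f (V i)) :
    Cds R f (∀ i, V i) := by
  have key : ∀ (n : ℕ) (W : Fin n → ModuleCat.{0} R), (∀ i, Cds R f (W i)) →
      Cds R f (∀ i, W i) := by
    intro n
    induction n with
    | zero => exact fun W _ => .of_subsingleton
    | succ n ih =>
      intro W hW
      exact ((hW 0).prod hf (ih (fun i => W i.succ) fun i => hW _)).congr
        (Fin.consLinearEquiv R (fun i => (W i : Type)))
  obtain ⟨n, ⟨e⟩⟩ := Finite.exists_equiv_fin ι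
  refine (key n (fun i => ModuleCat.of R (V (e.symm i))) fun i => h _).congr ?_
  exact LinearEquiv.piCongrLeft R V e.symm

end Complexity

section Resolution

variable {R : Type} [Ring R]

theorem SES.of_exact {X Y Z : ModuleCat.{0} R} (g : X ⟶ Y) (h : Y ⟶ Z) (w : g ≫ h = 0)
    (he : (ShortComplex.mk g h w).Exact) :
    SES R (LinearMap.ker g.hom) X (LinearMap.ker h.hom) := by
  have hw : ∀ x, h.hom (g.hom x) = 0 := fun x => by
    simpa using congrArg (fun k => ModuleCat.Hom.hom k x) w
  refine (SES.of_ker (g.hom.codRestrict (LinearMap.ker h.hom) hw) ?_).congr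
    (LinearEquiv.ofEq _ _ (LinearMap.ker_codRestrict _ _ _)) (.refl _ _) (.refl _ _)
  rintro ⟨y, hy⟩
  obtain ⟨x, hx⟩ := (ShortComplex.moduleCat_exact_iff _).1 he y hy
  exact ⟨x, Subtype.ext hx⟩

/-- The syzygies of a projective resolution. -/
def resolutionSyzygy {M : ModuleCat.{0} R} (P : ProjectiveResolution M) :
    ℕ → ModuleCat.{0} R
  | 0 => M
  | 1 => ModuleCat.of R (LinearMap.ker (P.π.f 0).hom)
  | n + 2 => ModuleCat.of R (LinearMap.ker (P.complex.d (n + 1) n).hom)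

theorem resolutionSyzygy_ses {M : ModuleCat.{0} R} (P : ProjectiveResolution M) (n : ℕ) :
    SES R (resolutionSyzygy P (n + 1)) (P.complex.X n) (resolutionSyzygy P n) := by
  match n with
  | 0 => exact SES.of_ker (P.π.f 0).hom ((ModuleCat.epi_iff_surjective _).1 inferInstance)
  | 1 =>
    exact SES.of_exact _ _ P.complex_d_comp_π_f_zero
      (ShortComplex.exact_of_g_is_cokernel _ P.isColimitCokernelCofork)
  | n + 2 => exact SES.of_exact _ _ _ (P.exact_succ n)

theorem Bounded.of_resolution {M : ModuleCat.{0} R} (P : ProjectiveResolution M)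
    {b : ℕ → NNReal} (h : ∀ n, RankLE R (P.complex.X n) (b n)) : Bounded R b M := by
  refine ⟨fun n X => Nonempty (resolutionSyzygy P n ≃ₗ[R] X),
    (⟨.refl R M⟩ : Nonempty (M ≃ₗ[R] M)), ?_⟩
  rintro n X ⟨e⟩
  have hP : Module.Projective R (P.complex.X n) :=
    ModuleCat.projective_of_module_projective _
  exact ⟨resolutionSyzygy P (n + 1), ⟨P.complex.X n, hP, h n,
    (resolutionSyzygy_ses P n).congr (.refl _ _) (.refl _ _) e⟩, ⟨.refl _ _⟩⟩

/-- A sequence of syzygies glues to a projective resolution. -/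
theorem exists_resolution_of_syzygies (K P : ℕ → ModuleCat.{0} R)
    (hP : ∀ n, Module.Projective R (P n)) (i : ∀ n, K (n + 1) →ₗ[R] P n)
    (q : ∀ n, P n →ₗ[R] K n) (hi : ∀ n, Function.Injective (i n))
    (he : ∀ n, Function.Exact (i n) (q n)) (hq : ∀ n, Function.Surjective (q n)) :
    ∃ Q : ProjectiveResolution (K 0), ∀ n, Q.complex.X n = P n := by
  let d : ∀ n, P (n + 1) ⟶ P n := fun n => ModuleCat.ofHom (i n ∘ₗ q (n + 1))
  have hd : ∀ n, d (n + 1) ≫ d n = 0 := fun n => by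
    refine ModuleCat.hom_ext (LinearMap.ext fun x => ?_)
    simp [d, (he (n + 1)).apply_apply_eq_zero]
  have hd0 : d 0 ≫ ModuleCat.ofHom (q 0) = 0 := by
    refine ModuleCat.hom_ext (LinearMap.ext fun x => ?_)
    simp [d, (he 0).apply_apply_eq_zero]
  let c := ChainComplex.of (fun n => P n) d hd
  have hc : ∀ n, c.d (n + 1) n = d n := fun n => ChainComplex.of_d _ _ _
  have hex : ∀ n, (ShortComplex.mk (d (n + 1)) (d n) (hd n)).Exact := fun n => by
    rw [ShortComplex.moduleCat_exact_iff]
    intro x hx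
    have h1 : q (n + 1) x = 0 := hi n (by simpa [d] using hx)
    obtain ⟨y, rfl⟩ := (he (n + 1) x).1 h1
    obtain ⟨z, rfl⟩ := hq (n + 2) y
    exact ⟨z, rfl⟩
  have hex0 : (ShortComplex.mk (d 0) (ModuleCat.ofHom (q 0)) hd0).Exact := by
    rw [ShortComplex.moduleCat_exact_iff]
    intro x hx
    obtain ⟨y, rfl⟩ := (he 0 x).1 hx
    obtain ⟨z, rfl⟩ := hq 1 y
    exact ⟨z, rfl⟩
  refine ⟨{ complex := c
            projective := fun n => ?_
            π := (ChainComplex.toSingle₀Equiv _ _).symm ⟨ModuleCat.ofHom (q 0), ?_⟩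
            quasiIso := ⟨fun n => ?_⟩ }, fun n => rfl⟩
  · have := hP n
    exact ModuleCat.projective_of_categoryTheory_projective (P n)
  · rw [hc]
    exact hd0
  · cases n with
    | zero =>
      rw [ChainComplex.quasiIsoAt₀_iff, ShortComplex.quasiIso_iff_of_zeros']
      · refine (ShortComplex.exact_and_epi_g_iff_of_iso ?_).2
          ⟨hex0, (ModuleCat.epi_iff_surjective _).2 (hq 0)⟩
        exact ShortComplex.isoMk (Iso.refl _) (Iso.refl _) (Iso.refl _)
          (by simp [hc]; exact (Category.id_comp _).trans (Category.comp_id _).symm)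
          (by simp; exact (Category.id_comp _).trans (Category.comp_id _).symm)
      all_goals rfl
    | succ n =>
      rw [quasiIsoAt_iff_exactAt']
      · rw [HomologicalComplex.exactAt_iff' _ (n + 1 + 1) (n + 1) n (by simp) (by simp)]
        refine (ShortComplex.exact_iff_of_iso ?_).2 (hex n)
        exact ShortComplex.isoMk (Iso.refl _) (Iso.refl _) (Iso.refl _)
          (by simp [hc]; exact (Category.id_comp _).trans (Category.comp_id _).symm)
          (by simp [hc]; exact (Category.id_comp _).trans (Category.comp_id _).symm)
      · apply ChainComplex.exactAt_succ_single_obj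

theorem Bounded.exists_resolution {M : ModuleCat.{0} R} {b : ℕ → NNReal} (h : Bounded R b M) :
    ∃ P : ProjectiveResolution M, ∀ n, RankLE R (P.complex.X n) (b n) := by
  obtain ⟨S, h0, hS⟩ := h
  choose next hnext hS' using hS
  let seq : ∀ n, {X : ModuleCat.{0} R // S n X} := fun n =>
    n.rec ⟨ModuleCat.of R M, h0⟩ fun n X => ⟨next n X.1 X.2, hS' n X.1 X.2⟩
  have hs : ∀ n, IsSyzygy R (b n) (seq n).1 (seq (n + 1)).1 := fun n => hnext n _ (seq n).2
  choose P hP hr i q hi he hq using hs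
  obtain ⟨Q, hQ⟩ := exists_resolution_of_syzygies (fun n => (seq n).1) P hP i q hi he hq
  exact ⟨Q, fun n => by rw [hQ n]; exact hr n⟩

theorem complexityLE_iff {M : ModuleCat.{0} R} {f : ℕ → NNReal} :
    ComplexityLE R M f ↔ Cpx R f M := by
  constructor
  · rintro ⟨P, d, h⟩
    exact ⟨d, .of_resolution P h⟩
  · rintro ⟨d, h⟩
    obtain ⟨P, hP⟩ := h.exists_resolution
    exact ⟨P, d, hP⟩

theorem cdsLE_iff {M : ModuleCat.{0} R} {f : ℕ → NNReal} : CdsLE R M f ↔ Cds R f M :=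
  exists_congr fun _ => complexityLE_iff

end Resolution

open scoped MonoidAlgebra

/-! ### Modules over group rings -/

section GroupRing

variable {k : Type} [Ring k] {G : Type} [Group G]

section Act

variable {V : Type} [AddCommGroup V] (act : G → k → V → V)
  (h_vadd : ∀ g a v w, act g a (v + w) = act g a v + act g a w)
  (h_one : ∀ v, act 1 1 v = v) (h_add : ∀ g a b v, act g (a + b) v = act g a v + act g b v)
  (h_mul : ∀ g h a b v, act (g * h) (a * b) v = act g a (act h b v))

/-- The representation of the group ring defined by a compatible family of additive maps
`act g a`, the action of `a • g`. -/
def actRingHom : k[G] →+* AddMonoid.End V :=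
  MonoidAlgebra.liftNCRingHom (R := AddMonoid.End V)
    { toFun := fun a => AddMonoidHom.mk' (act 1 a) (h_vadd 1 a)
      map_one' := AddMonoidHom.ext h_one
      map_mul' := fun a b => AddMonoidHom.ext fun v => by
        have := h_mul 1 1 a b v
        rw [one_mul] at this
        exact this
      map_add' := fun a b => AddMonoidHom.ext fun v => h_add 1 a b v
      map_zero' := AddMonoidHom.ext fun v => by
        have := h_add 1 0 0 v
        rw [add_zero] at this
        exact left_eq_add.1 this }
    { toFun := fun g => AddMonoidHom.mk' (act g 1) (h_vadd g 1)
      map_one' := AddMonoidHom.ext h_one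
      map_mul' := fun g h => AddMonoidHom.ext fun v => by
        have := h_mul g h 1 1 v
        rw [one_mul] at this
        exact this }
    (fun a g => AddMonoidHom.ext fun v => by
      have h1 := h_mul 1 g a 1 v
      have h2 := h_mul g 1 1 a v
      simp only [one_mul, mul_one] at h1 h2
      exact h1.symm.trans h2)

theorem actRingHom_single (g : G) (a : k) (v : V) :
    actRingHom act h_vadd h_one h_add h_mul (MonoidAlgebra.single g a) v = act g a v := by
  have h1 := h_mul 1 g a 1 v
  simp only [one_mul, mul_one] at h1
  rw [h1, actRingHom]
  erw [MonoidAlgebra.liftNCRingHom_single]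
  rfl

/-- A module over the group ring, from a compatible family of additive maps `act g a`, the
action of `a • g`. -/
@[reducible]
def moduleOfAct : Module k[G] V :=
  Module.compHom V (actRingHom act h_vadd h_one h_add h_mul)

end Act

variable {V W : Type} [AddCommGroup V] [Module k[G] V] [AddCommGroup W] [Module k[G] W]

/-- An additive map commuting with the action of monomials is linear. -/
def linearOfSingle (φ : V →+ W)
    (h : ∀ (g : G) (a : k) v, φ (MonoidAlgebra.single g a • v) = MonoidAlgebra.single g a • φ v) :
    V →ₗ[k[G]] W :=
  { φ with
    map_smul' := fun x v => by
      induction x using MonoidAlgebra.induction_linear with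
      | zero => simp
      | add x y hx hy => simp_all [add_smul]
      | single g a => exact h g a v }

@[simp]
theorem linearOfSingle_apply (φ : V →+ W)
    (h : ∀ (g : G) (a : k) v, φ (MonoidAlgebra.single g a • v) = MonoidAlgebra.single g a • φ v)
    (v : V) : linearOfSingle φ h v = φ v := rfl

end GroupRing

section Restriction

variable {k : Type} [Ring k] {G L : Type} [Group G] [Group L]

/-- The restriction of a `k[G]`-module along a group homomorphism. -/
def Res (_ : L →* G) (M : Type) : Type := M

variable (j : L →* G) (M : Type) [AddCommGroup M] [Module k[G] M]

instance : AddCommGroup (Res j M) := inferInstanceAs (AddCommGroup M)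

instance : Module k[L] (Res j M) :=
  Module.compHom M (MonoidAlgebra.mapDomainRingHom k j)

theorem Res.single_smul (l : L) (a : k) (m : M) :
    (HSMul.hSMul (α := k[L]) (β := Res j M) (MonoidAlgebra.single l a) m : Res j M) =
      (MonoidAlgebra.single (j l) a • m : M) := by
  change MonoidAlgebra.mapDomainRingHom k j (MonoidAlgebra.single l a) • m = _
  simp

end Restriction

/-! ### Coinduction along injective homomorphisms with range of finite index -/

section Coinduction

variable {k : Type} [Ring k] {G L : Type} [Group G] [Group L]

variable (k) in
/-- The module coinduced along `j : L → G`. -/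
def Coind (j : L →* G) (N : Type) [AddCommGroup N] [Module k[L] N] : AddSubgroup (G → N) where
  carrier := {φ | ∀ l x, φ (j l * x) = MonoidAlgebra.single l (1 : k) • φ x}
  add_mem' := fun ha hb l x => by simp [ha l x, hb l x]
  zero_mem' := fun l x => by simp
  neg_mem' := fun ha l x => by simp [ha l x]

variable (j : L →* G) {N N' : Type} [AddCommGroup N'] [Module k[L] N'] [AddCommGroup N]
  [Module k[L] N]

/-- The action of `a • g` on a coinduced module. -/
def Coind.act (g : G) (a : k) (φ : Coind k j N) : Coind k j N :=
  ⟨fun x => MonoidAlgebra.single (1 : L) a • φ.1 (x * g), fun l x => by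
    change MonoidAlgebra.single (1 : L) a • φ.1 (j l * x * g) = _ • _ • φ.1 (x * g)
    rw [mul_assoc, φ.2, smul_smul, smul_smul]
    simp [MonoidAlgebra.single_mul_single]⟩

theorem Coind.act_vadd (g : G) (a : k) (φ ψ : Coind k j N) :
    Coind.act j g a (φ + ψ) = Coind.act j g a φ + Coind.act j g a ψ := by
  ext x; simp [Coind.act]

theorem Coind.act_one (φ : Coind k j N) : Coind.act j 1 1 φ = φ := by
  ext x; simp [Coind.act, ← MonoidAlgebra.one_def]

theorem Coind.act_add (g : G) (a b : k) (φ : Coind k j N) :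
    Coind.act j g (a + b) φ = Coind.act j g a φ + Coind.act j g b φ := by
  ext x; simp [Coind.act, add_smul, MonoidAlgebra.single_add]

theorem Coind.act_mul (g h : G) (a b : k) (φ : Coind k j N) :
    Coind.act j (g * h) (a * b) φ = Coind.act j g a (Coind.act j h b φ) := by
  ext x; simp [Coind.act, smul_smul, mul_assoc, MonoidAlgebra.single_mul_single]

instance : Module k[G] (Coind k j N) :=
  moduleOfAct (Coind.act j) (Coind.act_vadd j) (Coind.act_one j) (Coind.act_add j)
    (Coind.act_mul j)

theorem Coind.single_smul_apply (g : G) (a : k) (φ : Coind k j N) (x : G) :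
    (MonoidAlgebra.single g a • φ).1 x = MonoidAlgebra.single (1 : L) a • φ.1 (x * g) :=
  congrArg (fun ψ : Coind k j N => ψ.1 x) (actRingHom_single (Coind.act j) (Coind.act_vadd j)
    (Coind.act_one j) (Coind.act_add j) (Coind.act_mul j) g a φ)

/-- Functoriality of coinduction. -/
def Coind.map (u : N →ₗ[k[L]] N') : Coind k j N →ₗ[k[G]] Coind k j N' :=
  linearOfSingle
    { toFun := fun φ => ⟨fun x => u (φ.1 x), fun l x => by
        rw [← map_smul, ← φ.2]⟩
      map_zero' := by ext; simp
      map_add' := fun φ ψ => by ext; simp }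
    (fun g a φ => by
      ext x
      rw [Coind.single_smul_apply]
      simp [Coind.single_smul_apply])

@[simp]
theorem Coind.map_apply (u : N →ₗ[k[L]] N') (φ : Coind k j N) (x : G) :
    (Coind.map j u φ).1 x = u (φ.1 x) := rfl

/-- Representatives for the cosets of the range of an injective homomorphism. -/
theorem exists_coset_representatives (hj : Function.Injective j) [j.range.FiniteIndex] :
    ∃ (T : Finset G) (c : G → L) (r : G → G), (∀ x, r x ∈ T) ∧ (∀ x, x = j (c x) * r x) ∧
      (∀ l x, c (j l * x) = l * c x) ∧ ∀ l x, r (j l * x) = r x := by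
  classical
  let s := QuotientGroup.rightRel j.range
  have hfin : Finite (Quotient s) :=
    Finite.of_equiv _ (QuotientGroup.quotientRightRelEquivQuotientLeftRel j.range).symm
  have := Fintype.ofFinite (Quotient s)
  let r : G → G := fun x => (Quotient.mk s x).out
  have hr : ∀ x, ∃ l, x = j l * r x := fun x => by
    have h : s (r x) x := Quotient.exact (Quotient.out_eq (Quotient.mk s x))
    obtain ⟨l, hl⟩ := QuotientGroup.rightRel_apply.1 h
    exact ⟨l, by rw [hl]; group⟩
  choose c hc using hr
  have hr' : ∀ l x, r (j l * x) = r x := fun l x => by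
    refine congrArg Quotient.out (Quotient.sound ?_)
    exact QuotientGroup.rightRel_apply.2 ⟨l⁻¹, by simp⟩
  refine ⟨Finset.univ.image fun q : Quotient s => q.out, c, r,
    fun x => Finset.mem_image_of_mem _ (Finset.mem_univ _), hc, fun l x => hj ?_, hr'⟩
  have h1 := hc (j l * x)
  rw [hr'] at h1
  rw [map_mul]
  refine mul_right_cancel (b := r x) ?_
  rw [← h1, mul_assoc, ← hc]

theorem Coind.map_surjective (hj : Function.Injective j) [j.range.FiniteIndex]
    (u : N →ₗ[k[L]] N') (hu : Function.Surjective u) : Function.Surjective (Coind.map j u) := by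
  obtain ⟨T, c, r, -, hc, hcl, hrl⟩ := exists_coset_representatives j hj
  intro ψ
  obtain ⟨s, hs⟩ := hu.hasRightInverse
  refine ⟨⟨fun x => MonoidAlgebra.single (c x) (1 : k) • s (ψ.1 (r x)), fun l x => ?_⟩, ?_⟩
  · beta_reduce
    rw [hcl, hrl, smul_smul, MonoidAlgebra.single_mul_single, one_mul]
  · ext x
    rw [Coind.map_apply, map_smul, hs, ← ψ.2, ← hc]

theorem SES.coind (hj : Function.Injective j) [j.range.FiniteIndex] {A B C : Type}
    [AddCommGroup A] [Module k[L] A] [AddCommGroup B] [Module k[L] B] [AddCommGroup C]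
    [Module k[L] C] (h : SES k[L] A B C) :
    SES k[G] (Coind k j A) (Coind k j B) (Coind k j C) := by
  obtain ⟨i, q, hi, he, hq⟩ := h
  refine ⟨Coind.map j i, Coind.map j q, fun φ ψ h => ?_, fun φ => ⟨fun h => ?_, ?_⟩,
    Coind.map_surjective j hj q hq⟩
  · ext x
    exact hi (congrFun (congrArg Subtype.val h) x)
  · have h1 : ∀ x, ∃ y, i y = φ.1 x := fun x =>
      (he _).1 (congrFun (congrArg Subtype.val h) x)
    choose ψ hψ using h1
    exact ⟨⟨ψ, fun l x => hi (by rw [map_smul, hψ, hψ, φ.2])⟩, Subtype.ext (funext hψ)⟩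
  · rintro ⟨ψ, rfl⟩
    ext x
    simp [he.apply_apply_eq_zero]

/-- Coinduction commutes with binary products. -/
def Coind.prodEquiv : Coind k j (N × N') ≃ₗ[k[G]] Coind k j N × Coind k j N' :=
  LinearEquiv.ofBijective
    ((Coind.map j (LinearMap.fst _ N N')).prod (Coind.map j (LinearMap.snd _ N N')))
    ⟨fun φ ψ h => by
      refine Subtype.ext (funext fun x => ?_)
      exact Prod.ext (congrFun (congrArg (fun z => z.1.1) h) x)
        (congrFun (congrArg (fun z => z.2.1) h) x),
    fun ψ => ⟨⟨fun x => (ψ.1.1 x, ψ.2.1 x), fun l x => by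
      change (ψ.1.1 (j l * x), ψ.2.1 (j l * x)) = _
      rw [ψ.1.2, ψ.2.2]; rfl⟩, rfl⟩⟩

/-- The group ring is coinduced from the group ring of a subgroup of finite index. -/
theorem Coind.regular (hj : Function.Injective j) [j.range.FiniteIndex] :
    Nonempty (k[G] ≃ₗ[k[G]] Coind k j k[L]) := by
  classical
  have hinj : ∀ x : G, Function.Injective fun l : L => x⁻¹ * j l := fun x =>
    (mul_right_injective _).comp hj
  let θ : k[G] →+ Coind k j k[L] :=
    { toFun := fun a => ⟨fun x => .ofCoeff (a.coeff.comapDomain _ (hinj x).injOn), fun l x => by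
        ext m
        simp [MonoidAlgebra.coeff_single_mul_apply, mul_assoc]⟩
      map_zero' := by ext; simp
      map_add' := fun a b => by ext; simp }
  have hθ : ∀ a x l, ((θ a).1 x).coeff l = a.coeff (x⁻¹ * j l) := fun a x l => rfl
  refine ⟨LinearEquiv.ofBijective (linearOfSingle θ fun g a b => ?_) ⟨?_, ?_⟩⟩
  · ext x l
    rw [Coind.single_smul_apply]
    simp [hθ, mul_assoc]
  · intro a b h
    ext g
    have := congrArg (fun φ : Coind k j k[L] => (φ.1 g⁻¹).coeff 1) h
    simpa [hθ] using this
  · obtain ⟨T, c, r, hT, hc, hcl, hrl⟩ := exists_coset_representatives j hj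
    intro φ
    let S : Finset G := T.biUnion fun t => (φ.1 t).coeff.support.image fun l => t⁻¹ * j l
    refine ⟨.ofCoeff (Finsupp.onFinset S (fun g => (φ.1 g⁻¹).coeff 1) fun g hg => ?_), ?_⟩
    · simp only [S, Finset.mem_biUnion, Finset.mem_image]
      refine ⟨r g⁻¹, hT _, (c g⁻¹)⁻¹, ?_, ?_⟩
      · rw [hc g⁻¹, φ.2] at hg
        simpa using hg
      · have := hc g⁻¹
        rw [map_inv, ← mul_inv_rev, ← this, inv_inv]
    · ext x l
      simp only [linearOfSingle_apply]
      rw [hθ]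
      simp only [Finsupp.onFinset_apply, mul_inv_rev, inv_inv]
      rw [← map_inv, φ.2]
      simp

/-- Coinduction commutes with products. -/
def Coind.piEquiv (ι : Type) (N : Type) [AddCommGroup N] [Module k[L] N] :
    Coind k j (ι → N) ≃ₗ[k[G]] (ι → Coind k j N) :=
  LinearEquiv.ofBijective (LinearMap.pi fun i => Coind.map j (LinearMap.proj i))
    ⟨fun φ ψ h => Subtype.ext (funext fun x => funext fun i =>
      congrFun (congrArg (fun z => (z i).1) h) x),
    fun ψ => ⟨⟨fun x i => (ψ i).1 x, fun l x => by
      ext1 i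
      exact (ψ i).2 l x⟩, rfl⟩⟩

theorem IsSyzygy.coind (hj : Function.Injective j) [j.range.FiniteIndex] {r : NNReal}
    (h : IsSyzygy k[L] r N N') : IsSyzygy k[G] r (Coind k j N) (Coind k j N') := by
  obtain ⟨P, h1, ⟨s, hs, hr⟩, h3⟩ := h
  obtain ⟨e⟩ := Coind.regular (k := k) j hj
  let q : (s → k[L]) →ₗ[k[L]] P := Fintype.linearCombination k[L] (fun x : s => (x : P))
  have hq : Function.Surjective q := by
    rw [← LinearMap.range_eq_top, Fintype.range_linearCombination, ← hs]
    simp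
  let E : (s → k[G]) ≃ₗ[k[G]] Coind k j (s → k[L]) :=
    (LinearEquiv.piCongrRight fun _ => e).trans (Coind.piEquiv j s k[L]).symm
  obtain ⟨i, hi⟩ := Module.projective_lifting_property q LinearMap.id hq
  refine ⟨ModuleCat.of _ (Coind k j P), ?_, ?_, h3.coind j hj⟩
  · have : Module.Projective k[G] (Coind k j (s → k[L])) := .of_equiv E
    refine Module.Projective.of_split (Coind.map j i) (Coind.map j q) ?_
    ext φ x
    exact LinearMap.congr_fun hi _
  · have hfree : RankLE k[G] (s → k[G]) r := by
      classical
      refine ⟨Finset.univ.image fun x : s => Pi.single x 1, ?_,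
        (Nat.cast_le.2 Finset.card_image_le).trans (by simpa using hr)⟩
      have := (Pi.basisFun k[G] s).span_eq
      rw [← this]
      congr 1
      ext x
      simp
    exact hfree.of_surjective (Coind.map j q ∘ₗ E.toLinearMap)
      ((Coind.map_surjective j hj q hq).comp E.surjective)

theorem Bounded.coind (hj : Function.Injective j) [j.range.FiniteIndex] {b : ℕ → NNReal}
    (h : Bounded k[L] b N) : Bounded k[G] b (Coind k j N) := by
  obtain ⟨S, h0, hS⟩ := h
  refine ⟨fun n X => ∃ Y, S n Y ∧ X = ModuleCat.of k[G] (Coind k j Y), ⟨_, h0, rfl⟩, ?_⟩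
  rintro n _ ⟨Y, hY, rfl⟩
  obtain ⟨K, hK, hK'⟩ := hS n Y hY
  exact ⟨_, hK.coind j hj, K, hK', rfl⟩

theorem Cds.coind (hj : Function.Injective j) [j.range.FiniteIndex] {f : ℕ → NNReal}
    (h : Cds k[L] f N) : Cds k[G] f (Coind k j N) := by
  obtain ⟨W, d, hd⟩ := h
  exact ⟨ModuleCat.of _ (Coind k j W), d, (hd.coind j hj).congr (Coind.prodEquiv j)⟩

end Coinduction

/-! ### Modules of functions on finite sets with group action -/

section FunMod

variable {k : Type} [Ring k] {G : Type} [Group G] {M : Type} [AddCommGroup M] [Module k[G] M]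

/-- Restriction of `M` to the subgroup `S` has complexity at most `f`, up to summands. -/
def SubCds (k : Type) [Ring k] {G : Type} [Group G] (M : Type) [AddCommGroup M] [Module k[G] M]
    (f : ℕ → NNReal) (S : Subgroup G) : Prop :=
  ∃ (L : Type) (_ : Group L) (j : L →* G), Function.Injective j ∧ j.range = S ∧
    Cds k[L] f (Res j M)

variable {ι : Type} (τ : G →* Equiv.Perm ι)

/-- Functions `ι → M`, with the diagonal action of `G`. -/
def FunMod (_ : G →* Equiv.Perm ι) (M : Type) : Type := ι → M

instance : AddCommGroup (FunMod τ M) := inferInstanceAs (AddCommGroup (ι → M))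

@[ext]
theorem FunMod.ext {F F' : FunMod τ M} (h : ∀ i, F i = F' i) : F = F' := funext h

@[simp]
theorem FunMod.add_apply (F F' : FunMod τ M) (i : ι) : (F + F') i = F i + F' i := rfl

/-- The action of `a • g` on functions. -/
def FunMod.act (g : G) (a : k) (F : FunMod τ M) : FunMod τ M :=
  fun i => MonoidAlgebra.single g a • F (τ g⁻¹ i)

theorem FunMod.act_vadd (g : G) (a : k) (F F' : FunMod τ M) :
    FunMod.act τ g a (F + F') = FunMod.act τ g a F + FunMod.act τ g a F' := by
  ext x; simp [FunMod.act]

theorem FunMod.act_one (F : FunMod τ M) : FunMod.act τ 1 (1 : k) F = F := by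
  ext x; simp [FunMod.act, ← MonoidAlgebra.one_def]

theorem FunMod.act_add (g : G) (a b : k) (F : FunMod τ M) :
    FunMod.act τ g (a + b) F = FunMod.act τ g a F + FunMod.act τ g b F := by
  ext x; simp [FunMod.act, add_smul, MonoidAlgebra.single_add]

theorem FunMod.act_mul (g h : G) (a b : k) (F : FunMod τ M) :
    FunMod.act τ (g * h) (a * b) F = FunMod.act τ g a (FunMod.act τ h b F) := by
  ext x; simp [FunMod.act, smul_smul, MonoidAlgebra.single_mul_single]

instance : Module k[G] (FunMod τ M) :=
  moduleOfAct (FunMod.act τ) (FunMod.act_vadd τ) (FunMod.act_one τ) (FunMod.act_add τ)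
    (FunMod.act_mul τ)

theorem FunMod.single_smul_apply (g : G) (a : k) (F : FunMod τ M) (i : ι) :
    (MonoidAlgebra.single g a • F) i = MonoidAlgebra.single g a • F (τ g⁻¹ i) :=
  congrFun (actRingHom_single (FunMod.act τ) (FunMod.act_vadd τ)
    (FunMod.act_one τ) (FunMod.act_add τ) (FunMod.act_mul τ) g a F) i

/-- Evaluation of functions along the orbit of `b`. -/
def FunMod.toCoind {L : Type} [Group L] (j : L →* G) (b : ι) (hb : ∀ l, τ (j l) b = b) :
    FunMod τ M →ₗ[k[G]] Coind k j (Res j M) :=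
  linearOfSingle
    { toFun := fun F => ⟨fun x => (MonoidAlgebra.single x (1 : k) • F (τ x⁻¹ b) : M),
        fun l x => by
          have hl : τ (j l)⁻¹ b = b := by
            rw [map_inv, Equiv.Perm.inv_eq_iff_eq, hb]
          refine Eq.trans ?_ (Res.single_smul j M l (1 : k) _).symm
          change (MonoidAlgebra.single (j l * x) (1 : k) • F (τ (j l * x)⁻¹ b) : M) =
            MonoidAlgebra.single (j l) (1 : k) • (MonoidAlgebra.single x (1 : k) • F (τ x⁻¹ b) : M)
          rw [mul_inv_rev, map_mul, Equiv.Perm.mul_apply, hl, smul_smul,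
            MonoidAlgebra.single_mul_single, one_mul]⟩
      map_zero' := Subtype.ext (funext fun x => smul_zero (A := M) (MonoidAlgebra.single x (1 : k)))
      map_add' := fun F F' => Subtype.ext (funext fun x =>
        smul_add (A := M) (MonoidAlgebra.single x (1 : k)) _ _) }
    (fun g a F => by
      refine Subtype.ext (funext fun x => ?_)
      rw [Coind.single_smul_apply]
      refine Eq.trans ?_ (Res.single_smul j M 1 a _).symm
      change (MonoidAlgebra.single x (1 : k) • (MonoidAlgebra.single g a • F) (τ x⁻¹ b) : M) =
        MonoidAlgebra.single (j 1) a • (MonoidAlgebra.single (x * g) (1 : k) • F (τ (x * g)⁻¹ b))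
      rw [FunMod.single_smul_apply, smul_smul, smul_smul, MonoidAlgebra.single_mul_single,
        MonoidAlgebra.single_mul_single]
      simp)

theorem FunMod.toCoind_apply {L : Type} [Group L] (j : L →* G) (b : ι) (hb : ∀ l, τ (j l) b = b)
    (F : FunMod τ M) (x : G) :
    (FunMod.toCoind (k := k) τ j b hb F).1 x = (MonoidAlgebra.single x (1 : k) • F (τ x⁻¹ b) : M) :=
  rfl

variable {f : ℕ → NNReal}

theorem Cds.funMod (hf : IsProperComplexityFunction f) [Finite ι]
    (h : ∀ i : ι, SubCds k M f ((MulAction.stabilizer (Equiv.Perm ι) i).comap τ)) :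
    Cds k[G] f (FunMod τ M) := by
  classical
  choose L hL j hj hr hc using h
  let s : Setoid ι :=
    { r := fun i i' => ∃ g, τ g i' = i
      iseqv := ⟨fun i => ⟨1, by simp⟩,
        fun {i i'} ⟨g, hg⟩ => ⟨g⁻¹, by rw [map_inv, Equiv.Perm.inv_eq_iff_eq, hg]⟩,
        fun {i i' i''} ⟨g, hg⟩ ⟨g', hg'⟩ => ⟨g * g', by simp [hg', hg]⟩⟩ }
  have hst : ∀ i l, τ (j i l) i = i := fun i l => by
    have : j i l ∈ (MulAction.stabilizer (Equiv.Perm ι) i).comap τ := by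
      rw [← hr]
      exact ⟨l, rfl⟩
    exact this
  have hst' : ∀ i x, τ x i = i → ∃ l, j i l = x := fun i x hx => by
    have : x ∈ (j i).range := by
      rw [hr]
      exact hx
    exact this
  have hfi : ∀ i, (j i).range.FiniteIndex := fun i => by
    rw [hr]
    exact ⟨by rw [Subgroup.index_comap]; exact Subgroup.index_ne_zero_of_finite⟩
  have hfin : Finite (Quotient s) := inferInstance
  have hex : ∀ i : ι, ∃ x, τ x⁻¹ (Quotient.mk s i).out = i := fun i => by
    obtain ⟨g, hg⟩ := Quotient.exact (Quotient.out_eq (Quotient.mk s i)).symm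
    exact ⟨g⁻¹, by rw [inv_inv, hg]⟩
  choose X hX using hex
  have hXq : ∀ (ω : Quotient s) (x : G), Quotient.mk s (τ x⁻¹ ω.out) = ω := fun ω x => by
    conv_rhs => rw [← Quotient.out_eq ω]
    exact Quotient.sound ⟨x⁻¹, rfl⟩
  refine Cds.congr (Cds.pi hf (fun ω : Quotient s => Coind k (j ω.out) (Res (j ω.out) M))
    fun ω => Cds.coind _ (hj _) (hc _)) (LinearEquiv.ofBijective
      (LinearMap.pi fun ω : Quotient s => FunMod.toCoind (k := k) τ (j ω.out) ω.out (hst _))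
      ⟨?_, ?_⟩).symm
  · intro F F' h
    ext i
    have h1 := congrArg (fun z => (z (Quotient.mk s i)).1 (X i)) h
    simp only [LinearMap.pi_apply, FunMod.toCoind_apply] at h1
    rw [hX] at h1
    have h2 := congrArg (fun m : M => MonoidAlgebra.single (X i)⁻¹ (1 : k) • m) h1
    simpa [smul_smul, MonoidAlgebra.single_mul_single, ← MonoidAlgebra.one_def] using h2
  · intro φ
    let ψ : Quotient s → G → M := fun ω x => (φ ω).1 x
    have hψ : ∀ ω l x, ψ ω (j ω.out l * x) = MonoidAlgebra.single (j ω.out l) (1 : k) • ψ ω x :=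
      fun ω l x => ((φ ω).2 l x).trans (Res.single_smul _ M l (1 : k) _)
    refine ⟨fun i => MonoidAlgebra.single (X i)⁻¹ (1 : k) • ψ (Quotient.mk s i) (X i), ?_⟩
    refine funext fun ω => Subtype.ext (funext fun x => ?_)
    change MonoidAlgebra.single x (1 : k) • MonoidAlgebra.single (X (τ x⁻¹ ω.out))⁻¹ (1 : k) •
      ψ (Quotient.mk s (τ x⁻¹ ω.out)) (X (τ x⁻¹ ω.out)) = ψ ω x
    generalize hi : τ x⁻¹ ω.out = i
    obtain rfl : Quotient.mk s i = ω := by rw [← hi, hXq]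
    have h1 := hX i
    rw [smul_smul, MonoidAlgebra.single_mul_single, one_mul]
    obtain ⟨l, hl⟩ := hst' (Quotient.mk s i).out (x * (X i)⁻¹) (by
      rw [map_mul, Equiv.Perm.mul_apply, h1]
      rw [map_inv, Equiv.Perm.inv_eq_iff_eq] at hi
      exact hi.symm)
    rw [← hl, ← hψ, hl]
    simp

theorem Cds.of_subCds_top (hf : IsProperComplexityFunction f) (h : SubCds k M f (⊤ : Subgroup G)) :
    Cds k[G] f M := by
  have := Cds.funMod (M := M) (τ := (1 : G →* Equiv.Perm Unit)) hf (fun i => by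
    convert h
    ext
    simp)
  refine this.congr (LinearEquiv.ofBijective (linearOfSingle
    (V := FunMod (1 : G →* Equiv.Perm Unit) M) (W := M)
    { toFun := fun F => F (), map_zero' := rfl, map_add' := fun _ _ => rfl } fun g a F => ?_)
    ⟨fun F F' h => FunMod.ext _ fun _ => h, fun m => ⟨fun _ => m, rfl⟩⟩)
  exact FunMod.single_smul_apply _ g a F ()

theorem SubCds.res {S T : Subgroup G} (h : SubCds k M f T) (hTS : T ≤ S) :
    SubCds k (Res S.subtype M) f (T.subgroupOf S) := by
  obtain ⟨L, hL, j, hj, hr, hc⟩ := h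
  have hm : ∀ l, j l ∈ S := fun l => hTS (hr ▸ ⟨l, rfl⟩)
  refine ⟨L, hL, j.codRestrict S hm, fun a b h => hj (congrArg Subtype.val h), ?_, ?_⟩
  · rw [← hr]
    ext x
    simp only [MonoidHom.mem_range, Subgroup.mem_subgroupOf]
    exact exists_congr fun l => Subtype.ext_iff
  · refine hc.congr (LinearEquiv.ofBijective (linearOfSingle (V := Res j M)
      (W := Res (j.codRestrict S hm) (Res S.subtype M)) (AddMonoidHom.id M) fun g a m => ?_)
      Function.bijective_id)
    refine (Res.single_smul j M g a m).trans ?_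
    refine Eq.trans ?_ (Res.single_smul (j.codRestrict S hm) (Res S.subtype M) g a m).symm
    exact (Res.single_smul S.subtype M (j.codRestrict S hm g) a m).symm

end FunMod

/-! ### Modules of cochains -/

section HomMod

variable {k : Type} [Ring k] {G : Type} [Group G] {M : Type} [AddCommGroup M] [Module k[G] M]
  {C C' : Type} [AddCommGroup C'] [AddCommGroup C]

/-- Additive maps `C → M`, with the diagonal action of `G`. -/
def HomMod (_ : G →* Module.End ℤ C) (M : Type) [AddCommGroup M] : Type := C →ₗ[ℤ] M

variable (σ : G →* Module.End ℤ C) (σ' : G →* Module.End ℤ C')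

instance : AddCommGroup (HomMod σ M) := inferInstanceAs (AddCommGroup (C →ₗ[ℤ] M))

/-- The linear map underlying an element of `HomMod σ M`. -/
def HomMod.lin {σ : G →* Module.End ℤ C} : HomMod σ M ≃+ (C →ₗ[ℤ] M) := AddEquiv.refl _

@[ext]
theorem HomMod.ext {F F' : HomMod σ M} (h : ∀ c, F.lin c = F'.lin c) : F = F' :=
  LinearMap.ext h

/-- The action of `a • g` on cochains. -/
def HomMod.act (g : G) (a : k) (F : HomMod σ M) : HomMod σ M :=
  HomMod.lin.symm ((DistribSMul.toAddMonoidHom M (MonoidAlgebra.single g a)).toIntLinearMap ∘ₗ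
    HomMod.lin F ∘ₗ σ g⁻¹)

theorem HomMod.lin_act (g : G) (a : k) (F : HomMod σ M) (c : C) :
    (HomMod.act σ g a F).lin c = MonoidAlgebra.single g a • F.lin (σ g⁻¹ c) := rfl

theorem HomMod.act_vadd (g : G) (a : k) (F F' : HomMod σ M) :
    HomMod.act σ g a (F + F') = HomMod.act σ g a F + HomMod.act σ g a F' := by
  ext x; simp [HomMod.lin_act]

theorem HomMod.act_one (F : HomMod σ M) : HomMod.act σ 1 (1 : k) F = F := by
  ext x; simp [HomMod.lin_act, ← MonoidAlgebra.one_def]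

theorem HomMod.act_add (g : G) (a b : k) (F : HomMod σ M) :
    HomMod.act σ g (a + b) F = HomMod.act σ g a F + HomMod.act σ g b F := by
  ext x; simp [HomMod.lin_act, add_smul, MonoidAlgebra.single_add]

theorem HomMod.act_mul (g h : G) (a b : k) (F : HomMod σ M) :
    HomMod.act σ (g * h) (a * b) F = HomMod.act σ g a (HomMod.act σ h b F) := by
  ext x; simp [HomMod.lin_act, smul_smul, MonoidAlgebra.single_mul_single]

instance : Module k[G] (HomMod σ M) :=
  moduleOfAct (HomMod.act σ) (HomMod.act_vadd σ) (HomMod.act_one σ) (HomMod.act_add σ)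
    (HomMod.act_mul σ)

theorem HomMod.lin_single_smul (g : G) (a : k) (F : HomMod σ M) (c : C) :
    HomMod.lin (MonoidAlgebra.single g a • F) c = MonoidAlgebra.single g a • F.lin (σ g⁻¹ c) :=
  congrArg (fun F' : HomMod σ M => F'.lin c) (actRingHom_single (HomMod.act σ) (HomMod.act_vadd σ)
    (HomMod.act_one σ) (HomMod.act_add σ) (HomMod.act_mul σ) g a F)

variable {σ σ'}

variable (k M) in
/-- Precomposition with an equivariant map. -/
def HomMod.precomp (T : C →ₗ[ℤ] C') (hT : ∀ g, T ∘ₗ σ g = σ' g ∘ₗ T) :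
    HomMod σ' M →ₗ[k[G]] HomMod σ M :=
  linearOfSingle
    { toFun := fun F => HomMod.lin.symm (F.lin ∘ₗ T)
      map_zero' := rfl
      map_add' := fun _ _ => rfl }
    (fun g a F => by
      ext c
      rw [HomMod.lin_single_smul]
      refine (HomMod.lin_single_smul _ g a F (T c)).trans ?_
      rw [← LinearMap.comp_apply (σ' g⁻¹), ← hT]
      rfl)

variable (k M) in
/-- The submodule of cochains which are fixed by precomposition with `p`. -/
def HomMod.fixed (p : Module.End ℤ C) (hp : ∀ g, p ∘ₗ σ g = σ g ∘ₗ p) :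
    Submodule k[G] (HomMod σ M) :=
  LinearMap.eqLocus (HomMod.precomp k M p hp) LinearMap.id

theorem HomMod.mem_fixed (p : Module.End ℤ C) (hp : ∀ g, p ∘ₗ σ g = σ g ∘ₗ p) (F : HomMod σ M) :
    F ∈ HomMod.fixed k M p hp ↔ F.lin ∘ₗ p = F.lin := Iff.rfl

variable (σ) in
/-- The cochain `c ↦ N c • m` for an invariant functional `N`. -/
def HomMod.ofFunctional (N : C →ₗ[ℤ] ℤ) (hN : ∀ g, N ∘ₗ σ g = N) : M →ₗ[k[G]] HomMod σ M :=
  linearOfSingle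
    { toFun := fun m => HomMod.lin.symm (N.smulRight m)
      map_zero' := by ext; exact smul_zero _
      map_add' := fun m m' => by ext c; exact smul_add (N c) m m' }
    (fun g a m => by
      ext c
      rw [HomMod.lin_single_smul]
      change N c • (MonoidAlgebra.single g a • m) = MonoidAlgebra.single g a • (N (σ g⁻¹ c) • m)
      rw [← LinearMap.comp_apply N, hN, smul_comm])

theorem HomMod.lin_ofFunctional (N : C →ₗ[ℤ] ℤ) (hN : ∀ g, N ∘ₗ σ g = N) (m : M) (c : C) :
    (HomMod.ofFunctional (k := k) σ N hN m).lin c = N c • m := rfl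

end HomMod

/-! ### Signed permutation modules -/

section Diag

variable {B : Type}

/-- The diagonal operator with weights `w`. -/
def diag (w : B → ℤ) : Module.End ℤ (B →₀ ℤ) :=
  Finsupp.linearCombination ℤ fun b => Finsupp.single b (w b)

@[simp]
theorem diag_single (w : B → ℤ) (b : B) : diag w (Finsupp.single b 1) = Finsupp.single b (w b) := by
  simp [diag]

theorem end_ext {A : Type} [AddCommGroup A] {S T : (B →₀ ℤ) →ₗ[ℤ] A}
    (h : ∀ b, S (Finsupp.single b 1) = T (Finsupp.single b 1)) : S = T :=
  Finsupp.lhom_ext' fun b => LinearMap.ext_ring (h b)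

theorem diag_mul (w w' : B → ℤ) : diag w * diag w' = diag fun b => w b * w' b :=
  end_ext fun b => by
    rw [Module.End.mul_apply, diag_single, diag_single, ← mul_one (w' b), ← smul_eq_mul,
      ← Finsupp.smul_single, map_smul, diag_single]
    simp [mul_comm]

end Diag

section Signed

variable {k : Type} [Ring k] {G : Type} [Group G] {M : Type} [AddCommGroup M] [Module k[G] M]
  {Q : Type} [Group Q] {B : Type} (τ : Q →* Equiv.Perm B)
  (ε : Q → B → ℤˣ) {f : ℕ → NNReal}

/-- The action on an invariant subset. -/
def subPerm (s : Set B) (hs : ∀ q b, b ∈ s → τ q b ∈ s) : Q →* Equiv.Perm s where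
  toFun q :=
    { toFun := fun b => ⟨τ q b, hs q b b.2⟩
      invFun := fun b => ⟨τ q⁻¹ b, hs _ b b.2⟩
      left_inv := fun b => by simp
      right_inv := fun b => by simp }
  map_one' := by ext; simp
  map_mul' := fun q q' => by ext; simp

/-- The action on an invariant subset with signs. -/
def signPerm (hε : ∀ q q' b, ε (q * q') b = ε q (τ q' b) * ε q' b) (s : Set B)
    (hs : ∀ q b, b ∈ s → τ q b ∈ s) : Q →* Equiv.Perm (s × ℤˣ) where
  toFun q :=
    { toFun := fun z => (⟨τ q z.1, hs q z.1 z.1.2⟩, ε q z.1 * z.2)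
      invFun := fun z => (⟨τ q⁻¹ z.1, hs _ z.1 z.1.2⟩, ε q⁻¹ z.1 * z.2)
      left_inv := fun z => by
        have := hε q⁻¹ q z.1
        have h1 := hε 1 1 z.1
        simp at this h1
        ext <;> simp [← mul_assoc, ← this, h1]
      right_inv := fun z => by
        have := hε q q⁻¹ z.1
        have h1 := hε 1 1 z.1
        simp at this h1
        ext <;> simp [← mul_assoc, ← this, h1] }
  map_one' := by
    ext z
    · simp
    · have h1 := hε 1 1 z.1
      simp at h1
      simp [h1]
  map_mul' := fun q q' => by ext z <;> simp [hε, mul_assoc]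

variable {τ ε}

/-- Functions on a finite set of basis elements with a signed action. -/
theorem Cds.signed (hf : IsProperComplexityFunction f) (π : G →* Q)
    (hM : ∀ S : Subgroup Q, S ≠ ⊤ → SubCds k M f (S.comap π))
    (hε : ∀ q q' b, ε (q * q') b = ε q (τ q' b) * ε q' b)
    (ρ : Q →* Module.End ℤ (B →₀ ℤ))
    (hρ : ∀ q b, ρ q (Finsupp.single b 1) = Finsupp.single (τ q b) (ε q b : ℤ))
    (s : Set B) [Finite s] (hs : ∀ q b, b ∈ s → τ q b ∈ s)
    (hst : ∀ b ∈ s, ∃ q, τ q b ≠ b)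
    (w : B → ℤ) (hw : ∀ b, w b = s.indicator 1 b)
    (hp : ∀ g, diag w ∘ₗ (ρ.comp π) g = (ρ.comp π) g ∘ₗ diag w) :
    Cds k[G] f (HomMod.fixed k M (diag w) hp) := by
  classical
  have h1 : Cds k[G] f (FunMod ((subPerm τ s hs).comp π) M) := by
    refine .funMod _ hf fun b => ?_
    rw [← Subgroup.comap_comap]
    refine hM _ fun h => ?_
    obtain ⟨q, hq⟩ := hst b b.2
    have : q ∈ (⊤ : Subgroup Q) := trivial
    rw [← h] at this
    exact hq (congrArg Subtype.val this)
  have h2 : Cds k[G] f (FunMod ((signPerm τ ε hε s hs).comp π) M) := by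
    refine .funMod _ hf fun b => ?_
    rw [← Subgroup.comap_comap]
    refine hM _ fun h => ?_
    obtain ⟨q, hq⟩ := hst b.1 b.1.2
    have : q ∈ (⊤ : Subgroup Q) := trivial
    rw [← h] at this
    exact hq (congrArg (fun z => z.1.1) this)
  refine .kernel hf ?_ h2 h1
  have hmem : ∀ F ∈ HomMod.fixed k M (diag w) hp, ∀ b, b ∉ s → F.lin (Finsupp.single b 1) = 0 :=
    fun F hF b hb => by
      rw [HomMod.mem_fixed] at hF
      rw [← hF, LinearMap.comp_apply, diag_single, hw]
      simp [hb]
  let i : HomMod (ρ.comp π) M →ₗ[k[G]] FunMod ((signPerm τ ε hε s hs).comp π) M :=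
    linearOfSingle
      { toFun := fun F z => (z.2 : ℤ) • F.lin (Finsupp.single z.1.1 1)
        map_zero' := FunMod.ext _ fun z => smul_zero _
        map_add' := fun F F' => FunMod.ext _ fun z => smul_add (z.2 : ℤ) _ _ }
      (fun g a F => FunMod.ext _ fun z => by
        rw [FunMod.single_smul_apply]
        change (z.2 : ℤ) • (MonoidAlgebra.single g a • F).lin (Finsupp.single z.1.1 1) =
          MonoidAlgebra.single g a • ((ε (π g⁻¹) z.1 * z.2 : ℤˣ) : ℤ) •
            F.lin (Finsupp.single (τ (π g⁻¹) z.1.1) 1)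
        rw [HomMod.lin_single_smul, MonoidHom.comp_apply, hρ,
          ← mul_one ((ε (π g⁻¹) z.1 : ℤˣ) : ℤ), ← smul_eq_mul, ← Finsupp.smul_single,
          map_smul, smul_comm (z.2 : ℤ), smul_smul, Units.val_mul, mul_comm])
  let r : FunMod ((signPerm τ ε hε s hs).comp π) M →ₗ[k[G]] FunMod ((subPerm τ s hs).comp π) M :=
    linearOfSingle
      { toFun := fun H b => H (b, 1) + H (b, -1)
        map_zero' := FunMod.ext _ fun z => add_zero (0 : M)
        map_add' := fun H H' => FunMod.ext _ fun b => add_add_add_comm (G := M) _ _ _ _ }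
      (fun g a H => FunMod.ext _ fun b => by
        rw [FunMod.single_smul_apply]
        change (MonoidAlgebra.single g a • H) (b, 1) + (MonoidAlgebra.single g a • H) (b, -1) =
          MonoidAlgebra.single g a • (H (⟨τ (π g⁻¹) b.1, hs _ _ b.2⟩, 1) +
            H (⟨τ (π g⁻¹) b.1, hs _ _ b.2⟩, -1))
        rw [FunMod.single_smul_apply, FunMod.single_smul_apply, ← smul_add]
        change MonoidAlgebra.single g a • (H (⟨τ (π g⁻¹) b.1, hs _ _ b.2⟩, ε (π g⁻¹) b * 1) +
            H (⟨τ (π g⁻¹) b.1, hs _ _ b.2⟩, ε (π g⁻¹) b * -1)) = _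
        rcases Int.units_eq_one_or (ε (π g⁻¹) b) with h | h
        · rw [h, one_mul, one_mul]
        · rw [h, mul_one, neg_mul_neg, one_mul, add_comm])
  refine ⟨i ∘ₗ Submodule.subtype _, r, ?_, fun H => ⟨fun h => ?_, ?_⟩, fun h => ?_⟩
  · intro F F' h
    refine Subtype.ext (end_ext (A := M) fun b => ?_)
    by_cases hb : b ∈ s
    · have := congrFun h (⟨b, hb⟩, 1)
      change ((1 : ℤˣ) : ℤ) • F.1.lin (Finsupp.single b 1) =
        ((1 : ℤˣ) : ℤ) • F'.1.lin (Finsupp.single b 1) at this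
      rw [Units.val_one, one_smul, one_smul] at this
      exact this
    · exact (hmem _ F.2 b hb).trans (hmem _ F'.2 b hb).symm
  · let F : HomMod (ρ.comp π) M := HomMod.lin.symm
      (Finsupp.linearCombination ℤ fun b => if hb : b ∈ s then (H (⟨b, hb⟩, 1) : M) else 0)
    have hF : ∀ b, F.lin (Finsupp.single b 1) = if hb : b ∈ s then (H (⟨b, hb⟩, 1) : M) else 0 :=
      fun b => by
        change Finsupp.linearCombination ℤ _ (Finsupp.single b 1) = _
        simp
    refine ⟨⟨F, ?_⟩, FunMod.ext _ fun z => ?_⟩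
    · rw [HomMod.mem_fixed]
      refine end_ext fun b => ?_
      rw [LinearMap.comp_apply, diag_single, hw]
      by_cases hb : b ∈ s
      · simp [hb]
      · simp [hb, hF]
    · obtain ⟨b, e⟩ := z
      change (e : ℤ) • F.lin (Finsupp.single b.1 1) = H (b, e)
      rw [hF, dif_pos b.2]
      rcases Int.units_eq_one_or e with rfl | rfl
      · simp
      · have := congrFun h b
        change (H (b, 1) + H (b, -1) : M) = 0 at this
        simp only [Units.val_neg, Units.val_one, neg_smul, one_smul]
        exact neg_eq_of_add_eq_zero_right this
  · rintro ⟨F, rfl⟩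
    refine FunMod.ext _ fun b => ?_
    change ((1 : ℤˣ) : ℤ) • F.1.lin (Finsupp.single b.1 1) +
      ((-1 : ℤˣ) : ℤ) • F.1.lin (Finsupp.single b.1 1) = 0
    simp
  · refine ⟨fun z => if z.2 = 1 then h z.1 else 0, FunMod.ext _ fun b => ?_⟩
    change ((if (1 : ℤˣ) = 1 then (h b : M) else 0) + if (-1 : ℤˣ) = 1 then (h b : M) else 0) = h b
    rw [if_pos rfl, if_neg (by decide), add_zero]

end Signed

/-! ### A comparison of two coresolutions -/

section Ladder

variable {R : Type} [Ring R] {V W : Type} [AddCommGroup V] [Module R V] [AddCommGroup W]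
  [Module R W] {f : ℕ → NNReal}

theorem SES.of_submodule (K : Submodule R V) (ψ : V →ₗ[R] W) :
    SES R (K ⊓ LinearMap.ker ψ : Submodule R V) K (K.map ψ) :=
  ⟨Submodule.inclusion inf_le_left, ψ.submoduleMap K, Submodule.inclusion_injective _,
    fun x => ⟨fun h => ⟨⟨x.1, x.2, congrArg Subtype.val h⟩, rfl⟩, by
      rintro ⟨y, rfl⟩
      exact Subtype.ext y.2.2⟩,
    ψ.submoduleMap_surjective K⟩

theorem Cds.submodule_prod (hf : IsProperComplexityFunction f) {K : Submodule R V}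
    {K' : Submodule R W} (hK : Cds R f K) (hK' : Cds R f K') : Cds R f (K.prod K') :=
  (hK.prod hf hK').congr
    { toFun := fun z => ⟨(z.1, z.2), z.1.2, z.2.2⟩
      invFun := fun z => (⟨z.1.1, z.2.1⟩, ⟨z.1.2, z.2.2⟩)
      map_add' := fun _ _ => rfl
      map_smul' := fun _ _ => rfl
      left_inv := fun _ => rfl
      right_inv := fun _ => rfl }

/-- If `E` and `D` are coresolutions of the same module, and the comparison map `Φ : E → D`
factors in the last degree of `E` through a module of bounded complexity up to a boundary-free
map, then the last term of `E` has bounded complexity. -/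
theorem Cds.ladder (hf : IsProperComplexityFunction f) (E : ℕ → Submodule R V)
    (D : ℕ → Submodule R W) (dE : V →ₗ[R] V) (dD : W →ₗ[R] W) (Φ : V →ₗ[R] W)
    (hdE : ∀ n, ∀ x ∈ E n, dE x ∈ E (n + 1)) (hdD : ∀ n, ∀ x ∈ D n, dD x ∈ D (n + 1))
    (hΦ : ∀ n, ∀ x ∈ E n, Φ x ∈ D n) (hddE : ∀ x, dE (dE x) = 0) (hddD : ∀ x, dD (dD x) = 0)
    (hΦd : ∀ x, Φ (dE x) = dD (Φ x))
    (exE : ∀ n, ∀ x ∈ E (n + 1), dE x = 0 → ∃ y ∈ E n, dE y = x)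
    (exD : ∀ n, ∀ x ∈ D (n + 1), dD x = 0 → ∃ y ∈ D n, dD y = x)
    (hsurj : ∀ x ∈ D 0, dD x = 0 → ∃ y ∈ E 0, dE y = 0 ∧ Φ y = x)
    (hinj : ∀ y ∈ E 0, dE y = 0 → Φ y = 0 → y = 0) (n : ℕ)
    (cE : ∀ i ≤ n, Cds R f (E i)) (cD : ∀ i ≤ n, Cds R f (D i))
    (htop : ∀ x ∈ E (n + 1), dE x = 0)
    {B : Type} [AddCommGroup B] [Module R B] (hB : Cds R f B) (α : E (n + 1) →ₗ[R] B)
    (β : B →ₗ[R] W) (hβ : ∀ b, β b ∈ D (n + 1)) (hβd : ∀ b, dD (β b) = 0)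
    (hαβ : ∀ y, β (α y) = Φ y) : Cds R f (E (n + 1)) := by
  let ψ : (W × V) →ₗ[R] (W × V) :=
    (Φ ∘ₗ LinearMap.snd R W V - dD ∘ₗ LinearMap.fst R W V).prod (dE ∘ₗ LinearMap.snd R W V)
  have hψ : ∀ x y, ψ (x, y) = (Φ y - dD x, dE y) := fun _ _ => rfl
  let K : ℕ → Submodule R (W × V) := fun i => (D i).prod (E (i + 1))
  let Z : ℕ → Submodule R (W × V) := fun i => K i ⊓ LinearMap.ker ψ
  have hZ : ∀ i x y, (x, y) ∈ Z i ↔ (x ∈ D i ∧ y ∈ E (i + 1)) ∧ dD x = Φ y ∧ dE y = 0 := by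
    intro i x y
    simp only [Z, K, Submodule.mem_inf, Submodule.mem_prod, LinearMap.mem_ker, hψ, Prod.ext_iff,
      Prod.fst_zero, Prod.snd_zero, sub_eq_zero, eq_comm (a := Φ y) (b := dD x)]
  have hmap : ∀ i, (K i).map ψ = Z (i + 1) := by
    intro i
    ext ⟨x', y'⟩
    rw [hZ]
    constructor
    · rintro ⟨⟨x, y⟩, ⟨hx, hy⟩, h⟩
      rw [hψ] at h
      obtain ⟨rfl, rfl⟩ := Prod.ext_iff.1 h
      exact ⟨⟨sub_mem (hΦ _ _ hy) (hdD _ _ hx), hdE _ _ hy⟩, by simp [hddD, hΦd], hddE _⟩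
    · rintro ⟨⟨hx, hy⟩, h1, h2⟩
      obtain ⟨y, hy1, rfl⟩ := exE _ _ hy h2
      obtain ⟨x, hx1, hx2⟩ := exD _ (x' - Φ y) (sub_mem hx (hΦ _ _ hy1)) (by
        rw [map_sub, h1, hΦd, sub_self])
      exact ⟨(-x, y), ⟨neg_mem hx1, hy1⟩, by rw [hψ, map_neg, hx2]; simp⟩
  have hZ0 : Cds R f (Z 0) := by
    let e : E 0 →ₗ[R] Z 0 := LinearMap.codRestrict (Z 0) ((Φ.prod dE) ∘ₗ (E 0).subtype)
      (fun y => (hZ _ _ _).2 ⟨⟨hΦ _ _ y.2, hdE _ _ y.2⟩, (hΦd _).symm, hddE _⟩)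
    refine (cE 0 (Nat.zero_le _)).congr (LinearEquiv.ofBijective e ⟨?_, ?_⟩)
    · rw [← LinearMap.ker_eq_bot, LinearMap.ker_eq_bot']
      intro y hy
      obtain ⟨h1, h2⟩ := Prod.ext_iff.1 (congrArg Subtype.val hy)
      exact Subtype.ext (hinj _ y.2 h2 h1)
    · rintro ⟨⟨x, y⟩, h⟩
      obtain ⟨⟨hx, hy⟩, h1, h2⟩ := (hZ _ _ _).1 h
      obtain ⟨y, hy1, rfl⟩ := exE _ _ hy h2
      obtain ⟨z, hz1, hz2, hz3⟩ := hsurj (x - Φ y) (sub_mem hx (hΦ _ _ hy1)) (by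
        rw [map_sub, h1, hΦd, sub_self])
      refine ⟨⟨y + z, add_mem hy1 hz1⟩, Subtype.ext (Prod.ext ?_ ?_)⟩
      · change Φ (y + z) = x
        rw [map_add, hz3, add_sub_cancel]
      · change dE (y + z) = dE y
        rw [map_add, hz2, add_zero]
  have hZn : ∀ i ≤ n, Cds R f (Z i) := by
    intro i
    induction i with
    | zero => exact fun _ => hZ0
    | succ i ih =>
      intro hi
      rw [← hmap]
      exact .quotient hf (SES.of_submodule (K i) ψ) (ih (by omega))
        (.submodule_prod hf (cD i (by omega)) (cE (i + 1) hi))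
  let χ : (B × (W × V)) →ₗ[R] W :=
    Φ ∘ₗ LinearMap.snd R W V ∘ₗ LinearMap.snd R B (W × V) - β ∘ₗ LinearMap.fst R B (W × V) -
      dD ∘ₗ LinearMap.fst R W V ∘ₗ LinearMap.snd R B (W × V)
  have hχ : ∀ b x y, χ (b, (x, y)) = Φ y - β b - dD x := fun _ _ _ => rfl
  let P : Submodule R (B × (W × V)) := (⊤ : Submodule R B).prod (K n) ⊓ LinearMap.ker χ
  have hP : ∀ b x y, (b, (x, y)) ∈ P ↔ (x ∈ D n ∧ y ∈ E (n + 1)) ∧ Φ y - β b = dD x := by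
    intro b x y
    simp only [P, K, Submodule.mem_inf, Submodule.mem_prod, LinearMap.mem_ker, hχ,
      Submodule.mem_top, true_and, sub_eq_zero]
  have hPc : Cds R f P := by
    refine .extension hf (A := Z n) (C := B) ?_ (hZn n le_rfl) hB
    refine ⟨LinearMap.codRestrict P (LinearMap.inr R B (W × V) ∘ₗ (Z n).subtype) ?_,
      LinearMap.fst R B (W × V) ∘ₗ P.subtype, ?_, ?_, ?_⟩
    · rintro ⟨⟨x, y⟩, h⟩
      rw [hZ] at h
      refine (hP _ _ _).2 ⟨h.1, ?_⟩
      change Φ y - β 0 = dD x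
      rw [map_zero, sub_zero, h.2.1]
    · intro z z' h
      exact Subtype.ext (congrArg (fun p => p.1.2) h)
    · rintro ⟨⟨b, x, y⟩, h⟩
      have h' := (hP _ _ _).1 h
      constructor
      · intro (hb : b = 0)
        subst hb
        exact ⟨⟨(x, y), (hZ _ _ _).2 ⟨h'.1, by rw [← h'.2, map_zero, sub_zero],
          htop _ h'.1.2⟩⟩, rfl⟩
      · rintro ⟨z, hz⟩
        exact (congrArg (fun p => p.1.1) hz).symm
    · intro b
      obtain ⟨x, hx, hx'⟩ := exD _ _ (hβ b) (hβd b)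
      refine ⟨⟨(b, (-x, 0)), (hP _ _ _).2 ⟨⟨neg_mem hx, zero_mem _⟩, ?_⟩⟩, rfl⟩
      rw [map_zero, map_neg, hx', zero_sub]
  refine hPc.retract
    (LinearMap.codRestrict P (α.prod (LinearMap.inr R W V ∘ₗ (E (n + 1)).subtype)) fun y => ?_)
    (LinearMap.codRestrict (E (n + 1)) (LinearMap.snd R W V ∘ₗ LinearMap.snd R B (W × V) ∘ₗ
      P.subtype) ?_) fun y => rfl
  · exact (hP _ _ _).2 ⟨⟨zero_mem _, y.2⟩, by simp [hαβ]⟩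
  · rintro ⟨⟨b, x, y⟩, h⟩
    exact ((hP _ _ _).1 h).1.2

end Ladder

/-! ### Tensor powers of based free abelian groups -/

section Tensor

variable {I : Type} [Fintype I] {Y Y' Y'' : Type}

/-- The pure tensor of a family of chains, in the free abelian group on `I → Y`. -/
def pureTensor (c : I → Y →₀ ℤ) : (I → Y) →₀ ℤ := by
  classical
  exact Finsupp.onFinset (Fintype.piFinset fun x => (c x).support) (fun b => ∏ x, c x (b x))
    fun b hb => Fintype.mem_piFinset.2 fun x =>
      Finsupp.mem_support_iff.2 (Finset.prod_ne_zero_iff.1 hb x (Finset.mem_univ x))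

@[simp]
theorem pureTensor_apply (c : I → Y →₀ ℤ) (b : I → Y) : pureTensor c b = ∏ x, c x (b x) := by
  simp [pureTensor]

theorem pureTensor_single (b : I → Y) :
    pureTensor (fun x => Finsupp.single (b x) 1) = Finsupp.single b 1 := by
  classical
  ext b'
  simp only [pureTensor_apply, Finsupp.single_apply, Finset.prod_ite_zero, Finset.prod_const_one,
    Finset.mem_univ, true_implies, funext_iff]

/-- `pureTensor` as a multilinear map. -/
def pureMulti : MultilinearMap ℤ (fun _ : I => Y →₀ ℤ) ((I → Y) →₀ ℤ) where
  toFun := pureTensor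
  map_update_add' := fun c x a a' => Finsupp.ext fun b => by
    have := ((MultilinearMap.mkPiAlgebra ℤ I ℤ).compLinearMap
      fun x => Finsupp.lapply (M := ℤ) (R := ℤ) (b x)).map_update_add c x a a'
    simp only [MultilinearMap.compLinearMap_apply, MultilinearMap.mkPiAlgebra_apply,
      Finsupp.lapply_apply] at this
    simpa only [pureTensor_apply, Finsupp.add_apply, Finsupp.smul_apply] using this
  map_update_smul' := fun c x r a => Finsupp.ext fun b => by
    have := ((MultilinearMap.mkPiAlgebra ℤ I ℤ).compLinearMap
      fun x => Finsupp.lapply (M := ℤ) (R := ℤ) (b x)).map_update_smul c x r a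
    simp only [MultilinearMap.compLinearMap_apply, MultilinearMap.mkPiAlgebra_apply,
      Finsupp.lapply_apply] at this
    simpa only [pureTensor_apply, Finsupp.add_apply, Finsupp.smul_apply] using this

theorem multilinear_ext {A : Type} [AddCommGroup A]
    {f g : MultilinearMap ℤ (fun _ : I => Y →₀ ℤ) A}
    (h : ∀ b : I → Y, f (fun x => Finsupp.single (b x) 1) = g fun x => Finsupp.single (b x) 1) :
    f = g :=
  Module.Basis.ext_multilinear (fun _ => Finsupp.basisSingleOne) fun b => by simpa using h b

/-- The tensor product of a family of linear maps. -/
def tmap (K : I → (Y →₀ ℤ) →ₗ[ℤ] (Y' →₀ ℤ)) : ((I → Y) →₀ ℤ) →ₗ[ℤ] ((I → Y') →₀ ℤ) :=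
  Finsupp.linearCombination ℤ fun b => pureTensor fun x => K x (Finsupp.single (b x) 1)

theorem tmap_single (K : I → (Y →₀ ℤ) →ₗ[ℤ] (Y' →₀ ℤ)) (b : I → Y) :
    tmap K (Finsupp.single b 1) = pureTensor fun x => K x (Finsupp.single (b x) 1) := by
  simp [tmap]

theorem tmap_pureTensor (K : I → (Y →₀ ℤ) →ₗ[ℤ] (Y' →₀ ℤ)) (c : I → Y →₀ ℤ) :
    tmap K (pureTensor c) = pureTensor fun x => K x (c x) := by
  have := multilinear_ext (f := (tmap K).compMultilinearMap pureMulti)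
    (g := pureMulti.compLinearMap K) fun b => by
      change tmap K (pureTensor _) = pureTensor fun x => K x _
      rw [pureTensor_single, tmap_single]
  exact congrArg (fun f : MultilinearMap ℤ (fun _ : I => Y →₀ ℤ) _ => f c) this

theorem tmap_comp (L : I → (Y' →₀ ℤ) →ₗ[ℤ] (Y'' →₀ ℤ)) (K : I → (Y →₀ ℤ) →ₗ[ℤ] (Y' →₀ ℤ)) :
    tmap L ∘ₗ tmap K = tmap fun x => L x ∘ₗ K x :=
  end_ext fun b => by
    rw [LinearMap.comp_apply, tmap_single, tmap_pureTensor, tmap_single]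
    rfl

theorem tmap_mul (L K : I → Module.End ℤ (Y →₀ ℤ)) : tmap L * tmap K = tmap fun x => L x * K x :=
  tmap_comp L K

theorem tmap_one : tmap (fun _ : I => (1 : Module.End ℤ (Y →₀ ℤ))) = 1 :=
  end_ext fun b => by
    rw [tmap_single]
    exact pureTensor_single b

/-- The tensor product of a family of functionals. -/
def tfun (w : I → (Y →₀ ℤ) →ₗ[ℤ] ℤ) : ((I → Y) →₀ ℤ) →ₗ[ℤ] ℤ :=
  Finsupp.linearCombination ℤ fun b => ∏ x, w x (Finsupp.single (b x) 1)

theorem tfun_single (w : I → (Y →₀ ℤ) →ₗ[ℤ] ℤ) (b : I → Y) :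
    tfun w (Finsupp.single b 1) = ∏ x, w x (Finsupp.single (b x) 1) := by
  simp [tfun]

theorem tfun_pureTensor (w : I → (Y →₀ ℤ) →ₗ[ℤ] ℤ) (c : I → Y →₀ ℤ) :
    tfun w (pureTensor c) = ∏ x, w x (c x) := by
  have := multilinear_ext (f := (tfun w).compMultilinearMap pureMulti)
    (g := (MultilinearMap.mkPiAlgebra ℤ I ℤ).compLinearMap w) fun b => by
      change tfun w (pureTensor _) = _
      rw [pureTensor_single, tfun_single]
      simp
  have h := congrArg (fun f : MultilinearMap ℤ (fun _ : I => Y →₀ ℤ) _ => f c) this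
  simp only [MultilinearMap.compLinearMap_apply, MultilinearMap.mkPiAlgebra_apply] at h
  exact h

theorem tfun_comp_tmap (w : I → (Y' →₀ ℤ) →ₗ[ℤ] ℤ) (K : I → (Y →₀ ℤ) →ₗ[ℤ] (Y' →₀ ℤ)) :
    tfun w ∘ₗ tmap K = tfun fun x => w x ∘ₗ K x :=
  end_ext fun b => by
    rw [LinearMap.comp_apply, tmap_single, tfun_pureTensor, tfun_single]
    rfl

variable [DecidableEq I]

theorem tmap_update_single (K : I → (Y →₀ ℤ) →ₗ[ℤ] (Y' →₀ ℤ)) (x : I)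
    (A : (Y →₀ ℤ) →ₗ[ℤ] (Y' →₀ ℤ)) (b : I → Y) :
    tmap (Function.update K x A) (Finsupp.single b 1) =
      pureMulti (Function.update (fun z => K z (Finsupp.single (b z) 1)) x
        (A (Finsupp.single (b x) 1))) := by
  rw [tmap_single]
  change pureTensor _ = pureTensor _
  congr 1
  ext1 z
  by_cases h : z = x
  · subst h; simp
  · simp [h]

theorem tmap_update_add (K : I → (Y →₀ ℤ) →ₗ[ℤ] (Y' →₀ ℤ)) (x : I)
    (A A' : (Y →₀ ℤ) →ₗ[ℤ] (Y' →₀ ℤ)) :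
    tmap (Function.update K x (A + A')) =
      tmap (Function.update K x A) + tmap (Function.update K x A') :=
  end_ext fun b => by
    simp only [LinearMap.add_apply, tmap_update_single, MultilinearMap.map_update_add]

theorem tmap_update_neg (K : I → (Y →₀ ℤ) →ₗ[ℤ] (Y' →₀ ℤ)) (x : I)
    (A : (Y →₀ ℤ) →ₗ[ℤ] (Y' →₀ ℤ)) :
    tmap (Function.update K x (-A)) = -tmap (Function.update K x A) :=
  end_ext fun b => by
    simp only [LinearMap.neg_apply, tmap_update_single, MultilinearMap.map_update_neg]

theorem tmap_update_zero (K : I → (Y →₀ ℤ) →ₗ[ℤ] (Y' →₀ ℤ)) (x : I) :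
    tmap (Function.update K x 0) = 0 :=
  end_ext fun b => by
    rw [tmap_update_single, LinearMap.zero_apply, MultilinearMap.map_update_zero,
      LinearMap.zero_apply]

theorem tmap_update_sub (K : I → (Y →₀ ℤ) →ₗ[ℤ] (Y' →₀ ℤ)) (x : I)
    (A A' : (Y →₀ ℤ) →ₗ[ℤ] (Y' →₀ ℤ)) :
    tmap (Function.update K x (A - A')) =
      tmap (Function.update K x A) - tmap (Function.update K x A') := by
  rw [sub_eq_add_neg, tmap_update_add, tmap_update_neg, sub_eq_add_neg]

theorem pureTensor_update (b : I → Y) (x : I) (c : Y →₀ ℤ) :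
    pureTensor (Function.update (fun z => Finsupp.single (b z) 1) x c) =
      Finsupp.mapDomain (Function.update b x) c := by
  have : pureMulti.toLinearMap (fun z => Finsupp.single (b z) 1) x =
      Finsupp.lmapDomain ℤ ℤ (Function.update b x) := end_ext fun y => by
    simp only [MultilinearMap.toLinearMap_apply, Finsupp.lmapDomain_apply,
      Finsupp.mapDomain_single]
    rw [← pureTensor_single]
    change pureTensor _ = pureTensor _
    congr 1
    ext1 z
    by_cases h : z = x
    · subst h; simp
    · simp [h]
  exact congrArg (fun f : (Y →₀ ℤ) →ₗ[ℤ] _ => f c) this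

end Tensor

section TensorAux

variable {I : Type} [Fintype I] {Y Y' : Type}

theorem diag_apply {B : Type} (w : B → ℤ) (c : B →₀ ℤ) (b : B) : diag w c b = w b * c b := by
  have : Finsupp.lapply b ∘ₗ diag w = w b • Finsupp.lapply (M := ℤ) (R := ℤ) b :=
    end_ext fun b' => by
      classical
      by_cases h : b' = b
      · subst h; simp
      · simp [h]
  simpa using congrArg (fun f : (B →₀ ℤ) →ₗ[ℤ] ℤ => f c) this

theorem diag_comp {B B' : Type} (w : B' → ℤ) (w' : B → ℤ) (k : (B →₀ ℤ) →ₗ[ℤ] (B' →₀ ℤ))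
    (h : ∀ b b', k (Finsupp.single b 1) b' ≠ 0 → w b' = w' b) : diag w ∘ₗ k = k ∘ₗ diag w' :=
  end_ext fun b => by
    rw [LinearMap.comp_apply, LinearMap.comp_apply, diag_single, ← mul_one (w' b), ← smul_eq_mul,
      ← Finsupp.smul_single, map_smul]
    ext b'
    rw [diag_apply, Finsupp.smul_apply, smul_eq_mul]
    by_cases h0 : k (Finsupp.single b 1) b' = 0
    · rw [h0, mul_zero, mul_zero]
    · rw [h _ _ h0]

theorem diag_eq_one {B : Type} {w : B → ℤ} (h : ∀ b, w b = 1) : diag w = 1 :=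
  end_ext fun b => by rw [diag_single, h]; rfl

theorem tmap_eq_zero (K : I → (Y →₀ ℤ) →ₗ[ℤ] (Y' →₀ ℤ)) (x : I) (h : K x = 0) : tmap K = 0 := by
  classical
  rw [← Function.update_eq_self x K, h, tmap_update_zero]

theorem tmap_eq_neg (K L : I → (Y →₀ ℤ) →ₗ[ℤ] (Y' →₀ ℤ)) (x : I) (h : K x = -L x)
    (h' : ∀ z, z ≠ x → K z = L z) : tmap K = -tmap L := by
  classical
  have : K = Function.update L x (-L x) := by
    ext1 z
    by_cases hz : z = x
    · subst hz; simp [h]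
    · simp [hz, h']
  rw [this, tmap_update_neg, Function.update_eq_self]

end TensorAux

/-! ### Contractible based complexes and their tensor powers -/

/-- The augmentation of a graded based free abelian group. -/
def degAug {Y : Type} (deg : Y → ℕ) : (Y →₀ ℤ) →ₗ[ℤ] ℤ :=
  Finsupp.linearCombination ℤ fun y => if deg y = 0 then 1 else 0

theorem degAug_single {Y : Type} (deg : Y → ℕ) (y : Y) :
    degAug deg (Finsupp.single y 1) = if deg y = 0 then 1 else 0 := by
  simp [degAug]

/-- A complex of free abelian groups on the graded set `Y`, with a contraction onto `base`. -/
structure BasedCx (Y : Type) where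
  deg : Y → ℕ
  δ : Module.End ℤ (Y →₀ ℤ)
  h : Module.End ℤ (Y →₀ ℤ)
  base : Y
  deg_base : deg base = 0
  δ_deg : ∀ y y', δ (Finsupp.single y 1) y' ≠ 0 → deg y = deg y' + 1
  h_deg : ∀ y y', h (Finsupp.single y 1) y' ≠ 0 → deg y' = deg y + 1
  δ_mul_δ : δ * δ = 0
  homotopy : δ * h + h * δ = 1 - (degAug deg).smulRight (Finsupp.single base 1)
  aug_δ : degAug deg ∘ₗ δ = 0

namespace BasedCx

variable {Y : Type} (𝒞 : BasedCx Y)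

/-- The projection onto the base point. -/
def proj : Module.End ℤ (Y →₀ ℤ) := (degAug 𝒞.deg).smulRight (Finsupp.single 𝒞.base 1)

/-- The sign operator. -/
def sgn : Module.End ℤ (Y →₀ ℤ) := diag fun y => (-1) ^ 𝒞.deg y

theorem proj_single (y : Y) :
    𝒞.proj (Finsupp.single y 1) = (if 𝒞.deg y = 0 then 1 else 0 : ℤ) • Finsupp.single 𝒞.base 1 := by
  rw [proj, LinearMap.smulRight_apply, degAug_single]

theorem sgn_mul_sgn : 𝒞.sgn * 𝒞.sgn = 1 := by
  rw [sgn, diag_mul]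
  exact diag_eq_one fun b => by rw [← mul_pow]; simp

theorem sgn_anti (k : Module.End ℤ (Y →₀ ℤ)) (h : ∀ y y', k (Finsupp.single y 1) y' ≠ 0 →
    (-1 : ℤ) ^ 𝒞.deg y = - (-1) ^ 𝒞.deg y') : 𝒞.sgn * k = -(k * 𝒞.sgn) := by
  have h1 : 𝒞.sgn * k = k * diag fun y => - (-1) ^ 𝒞.deg y :=
    diag_comp _ _ k fun b b' hb => by rw [h b b' hb, neg_neg]
  have h2 : (diag fun y => - (-1) ^ 𝒞.deg y) = -𝒞.sgn := end_ext fun b => by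
    rw [LinearMap.neg_apply, sgn, diag_single, diag_single, Finsupp.single_neg]
  rw [h1, h2, mul_neg]

theorem sgn_mul_δ : 𝒞.sgn * 𝒞.δ = -(𝒞.δ * 𝒞.sgn) :=
  𝒞.sgn_anti _ fun y y' h => by rw [𝒞.δ_deg y y' h]; ring

theorem sgn_mul_h : 𝒞.sgn * 𝒞.h = -(𝒞.h * 𝒞.sgn) :=
  𝒞.sgn_anti _ fun y y' h => by rw [𝒞.h_deg y y' h]; ring

theorem aug_sgn : degAug 𝒞.deg ∘ₗ 𝒞.sgn = degAug 𝒞.deg := end_ext fun y => by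
  rw [LinearMap.comp_apply, sgn, diag_single, ← mul_one ((-1 : ℤ) ^ _), ← smul_eq_mul,
    ← Finsupp.smul_single, map_smul, degAug_single]
  split_ifs with h <;> simp [h]

theorem sgn_mul_proj : 𝒞.sgn * 𝒞.proj = 𝒞.proj := LinearMap.ext fun c => by
  rw [Module.End.mul_apply, proj, LinearMap.smulRight_apply, map_smul, sgn, diag_single,
    𝒞.deg_base, pow_zero]

theorem proj_mul_sgn : 𝒞.proj * 𝒞.sgn = 𝒞.proj := LinearMap.ext fun c => by
  rw [Module.End.mul_apply, proj, LinearMap.smulRight_apply, LinearMap.smulRight_apply,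
    ← LinearMap.comp_apply, aug_sgn]

theorem proj_mul_δ : 𝒞.proj * 𝒞.δ = 0 := LinearMap.ext fun c => by
  rw [Module.End.mul_apply, proj, LinearMap.smulRight_apply, ← LinearMap.comp_apply, 𝒞.aug_δ]
  simp

theorem δ_mul_proj : 𝒞.δ * 𝒞.proj = 0 := LinearMap.ext fun c => by
  rw [Module.End.mul_apply, proj, LinearMap.smulRight_apply, map_smul]
  have : 𝒞.δ (Finsupp.single 𝒞.base 1) = 0 := Finsupp.ext fun y => by
    by_contra h
    have := 𝒞.δ_deg _ _ h
    rw [𝒞.deg_base] at this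
    omega
  rw [this, smul_zero, LinearMap.zero_apply]

variable {I : Type} [Fintype I] [LinearOrder I]

/-- The operator `k` on the coordinate `x`, with the sign for moving past the coordinates
before `x`. -/
def atCoord (x : I) (k : Module.End ℤ (Y →₀ ℤ)) : Module.End ℤ ((I → Y) →₀ ℤ) :=
  tmap (Function.update (fun z => if z < x then 𝒞.sgn else 1) x k)

theorem at_mul_at (x : I) (k l : Module.End ℤ (Y →₀ ℤ)) :
    𝒞.atCoord x k * 𝒞.atCoord x l = tmap (Function.update (fun _ => 1) x (k * l)) := by
  rw [atCoord, atCoord, tmap_mul]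
  congr 1
  ext1 z
  by_cases hz : z = x
  · subst hz; simp
  · simp only [Function.update_of_ne hz]
    split_ifs
    · rw [sgn_mul_sgn]
    · rw [one_mul]

theorem at_anti {x y : I} (h : x ≠ y) {k l : Module.End ℤ (Y →₀ ℤ)}
    (hk : 𝒞.sgn * k = -(k * 𝒞.sgn)) (hl : 𝒞.sgn * l = -(l * 𝒞.sgn)) :
    𝒞.atCoord x k * 𝒞.atCoord y l = -(𝒞.atCoord y l * 𝒞.atCoord x k) := by
  rw [atCoord, atCoord, tmap_mul, tmap_mul]
  rcases lt_or_gt_of_ne h with hxy | hxy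
  · refine tmap_eq_neg _ _ x ?_ fun z hz => ?_
    · simp [h, hxy, hk]
    · by_cases hz' : z = y
      · subst hz'; simp [hz, hxy.not_gt]
      · simp only [Function.update_of_ne hz, Function.update_of_ne hz']
        split_ifs <;> simp
  · refine tmap_eq_neg _ _ y ?_ fun z hz => ?_
    · simp [h.symm, hxy, hl]
    · by_cases hz' : z = x
      · subst hz'; simp [hz, hxy.not_gt]
      · simp only [Function.update_of_ne hz, Function.update_of_ne hz']
        split_ifs <;> simp

theorem at_support (x : I) (k : Module.End ℤ (Y →₀ ℤ)) (b b' : I → Y)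
    (h : 𝒞.atCoord x k (Finsupp.single b 1) b' ≠ 0) :
    k (Finsupp.single (b x) 1) (b' x) ≠ 0 ∧ ∀ z, z ≠ x → b' z = b z := by
  rw [atCoord, tmap_single, pureTensor_apply, Finset.prod_ne_zero_iff] at h
  refine ⟨by simpa using h x (Finset.mem_univ x), fun z hz => ?_⟩
  have := h z (Finset.mem_univ z)
  rw [Function.update_of_ne hz] at this
  by_contra hne
  refine this ?_
  split_ifs
  · rw [sgn, diag_single, Finsupp.single_eq_of_ne hne]
  · exact Finsupp.single_eq_of_ne hne

/-- The degree of a basis element of the tensor power. -/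
def tdeg (b : I → Y) : ℕ := ∑ x, 𝒞.deg (b x)

/-- The projection onto degree `n`. -/
def pr (n : ℕ) : Module.End ℤ ((I → Y) →₀ ℤ) := diag fun b => if 𝒞.tdeg b = n then 1 else 0

theorem tdeg_eq (x : I) (b : I → Y) :
    𝒞.tdeg b = 𝒞.deg (b x) + ∑ z ∈ Finset.univ.erase x, 𝒞.deg (b z) :=
  (Finset.add_sum_erase _ _ (Finset.mem_univ x)).symm

theorem tdeg_of_at {x : I} {k : Module.End ℤ (Y →₀ ℤ)} {b b' : I → Y}
    (h : 𝒞.atCoord x k (Finsupp.single b 1) b' ≠ 0) :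
    𝒞.tdeg b + 𝒞.deg (b' x) = 𝒞.tdeg b' + 𝒞.deg (b x) := by
  have : ∑ z ∈ Finset.univ.erase x, 𝒞.deg (b z) = ∑ z ∈ Finset.univ.erase x, 𝒞.deg (b' z) :=
    Finset.sum_congr rfl fun z hz => by
      rw [(𝒞.at_support x k b b' h).2 z (Finset.ne_of_mem_erase hz)]
  rw [𝒞.tdeg_eq x, 𝒞.tdeg_eq x b', this]
  omega

theorem pr_mul_at_δ (n : ℕ) (x : I) : 𝒞.pr n * 𝒞.atCoord x 𝒞.δ = 𝒞.atCoord x 𝒞.δ * 𝒞.pr (n + 1) :=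
  diag_comp _ _ _ fun b b' h => by
    have h1 := 𝒞.tdeg_of_at h
    have h2 := 𝒞.δ_deg _ _ (𝒞.at_support x _ b b' h).1
    congr 1
    exact propext (by omega)

theorem pr_mul_at_h (n : ℕ) (x : I) : 𝒞.pr (n + 1) * 𝒞.atCoord x 𝒞.h = 𝒞.atCoord x 𝒞.h * 𝒞.pr n :=
  diag_comp _ _ _ fun b b' h => by
    have h1 := 𝒞.tdeg_of_at h
    have h2 := 𝒞.h_deg _ _ (𝒞.at_support x _ b b' h).1
    congr 1
    exact propext (by omega)

theorem diag_zero {B : Type} : diag (fun _ : B => 0) = 0 := end_ext fun b => by simp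

theorem pr_zero_mul_at_h (x : I) : 𝒞.pr 0 * 𝒞.atCoord x 𝒞.h = 0 :=
  (diag_comp _ (fun _ => 0) _ fun b b' h => by
    have h1 := 𝒞.tdeg_of_at h
    have h2 := 𝒞.h_deg _ _ (𝒞.at_support x _ b b' h).1
    rw [if_neg]
    omega).trans (by rw [diag_zero, LinearMap.comp_zero])

theorem at_δ_mul_pr_zero (x : I) : 𝒞.atCoord x 𝒞.δ * 𝒞.pr 0 = 0 :=
  (diag_comp (fun _ => 0) _ _ fun b b' h => by
    have h1 := 𝒞.tdeg_of_at h
    have h2 := 𝒞.δ_deg _ _ (𝒞.at_support x _ b b' h).1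
    rw [if_neg]
    omega).symm.trans (by rw [diag_zero, LinearMap.zero_comp])

/-- The differential of the tensor power. -/
def d : Module.End ℤ ((I → Y) →₀ ℤ) := ∑ x, 𝒞.atCoord x 𝒞.δ

theorem pr_mul_d (n : ℕ) : 𝒞.pr n * 𝒞.d (I := I) = 𝒞.d * 𝒞.pr (n + 1) := by
  simp only [d, Finset.mul_sum, Finset.sum_mul, pr_mul_at_δ]

theorem d_mul_pr_zero : 𝒞.d (I := I) * 𝒞.pr 0 = 0 := by
  simp only [d, Finset.sum_mul, at_δ_mul_pr_zero, Finset.sum_const_zero]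

theorem d_mul_d : 𝒞.d (I := I) * 𝒞.d = 0 := by
  rw [d, Finset.sum_mul_sum, ← Finset.sum_product']
  have hself : ∀ x : I, 𝒞.atCoord x 𝒞.δ * 𝒞.atCoord x 𝒞.δ = 0 := fun x => by
    rw [at_mul_at, 𝒞.δ_mul_δ, tmap_update_zero]
  refine Finset.sum_involution (fun p _ => p.swap) ?_ ?_ (fun _ _ => by simp) (fun p _ => p.swap_swap)
  · rintro ⟨x, y⟩ -
    by_cases h : x = y
    · subst h; simp [hself]
    · rw [𝒞.at_anti h 𝒞.sgn_mul_δ 𝒞.sgn_mul_δ]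
      exact neg_add_cancel _
  · rintro ⟨x, y⟩ - h heq
    obtain rfl : y = x := congrArg Prod.fst heq
    exact h (hself _)

theorem d_mul_at_h (x : I) : 𝒞.d * 𝒞.atCoord x 𝒞.h + 𝒞.atCoord x 𝒞.h * 𝒞.d =
    1 - tmap (Function.update (fun _ => 1) x 𝒞.proj) := by
  rw [d, Finset.sum_mul, Finset.mul_sum, ← Finset.sum_add_distrib, Finset.sum_eq_single x]
  · rw [at_mul_at, at_mul_at, ← tmap_update_add, 𝒞.homotopy, tmap_update_sub,
      Function.update_eq_self_iff.2 rfl, tmap_one]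
    rfl
  · intro y _ hy
    rw [𝒞.at_anti hy 𝒞.sgn_mul_δ 𝒞.sgn_mul_h, neg_add_cancel]
  · simp

/-- The projection onto the base point in the coordinates in `S`. -/
def projOn (S : Finset I) : Module.End ℤ ((I → Y) →₀ ℤ) :=
  tmap fun x => if x ∈ S then 𝒞.proj else 1

theorem projOn_insert (S : Finset I) (x : I) (hx : x ∉ S) :
    𝒞.projOn (insert x S) = 𝒞.projOn S * tmap (Function.update (fun _ => 1) x 𝒞.proj) := by
  rw [projOn, projOn, tmap_mul]
  congr 1
  ext1 z
  by_cases hz : z = x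
  · subst hz; simp [hx]
  · simp [hz]

theorem projOn_mul_d (S : Finset I) : 𝒞.projOn S * 𝒞.d = 𝒞.d * 𝒞.projOn S := by
  rw [d, Finset.mul_sum, Finset.sum_mul]
  refine Finset.sum_congr rfl fun x _ => ?_
  rw [projOn, atCoord, tmap_mul, tmap_mul]
  by_cases hx : x ∈ S
  · rw [tmap_eq_zero _ x, tmap_eq_zero _ x]
    · simp [hx, δ_mul_proj]
    · simp [hx, proj_mul_δ]
  · congr 1
    ext1 z
    by_cases hz : z = x
    · subst hz; simp [hx]
    · simp only [Function.update_of_ne hz]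
      split_ifs <;> simp [sgn_mul_proj, proj_mul_sgn]

theorem pr_mul_projOn (S : Finset I) (n : ℕ) : 𝒞.pr n * 𝒞.projOn S = 𝒞.projOn S * 𝒞.pr n :=
  diag_comp _ _ _ fun b b' h => by
    rw [projOn, tmap_single, pureTensor_apply, Finset.prod_ne_zero_iff] at h
    have : 𝒞.tdeg b' = 𝒞.tdeg b := Finset.sum_congr rfl fun x _ => by
      have hx := h x (Finset.mem_univ x)
      split_ifs at hx with hS
      · rw [proj_single] at hx
        by_cases h0 : 𝒞.deg (b x) = 0
        · rw [h0]
          by_contra hne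
          refine hx ?_
          rw [Finsupp.smul_apply, Finsupp.single_eq_of_ne, smul_zero]
          rintro heq
          exact hne (heq ▸ 𝒞.deg_base)
        · simp [h0] at hx
      · by_contra hne
        refine hx (Finsupp.single_eq_of_ne fun heq => hne (by rw [heq]))
    rw [this]

theorem exists_contraction_on (S : Finset I) : ∃ s : Module.End ℤ ((I → Y) →₀ ℤ),
    𝒞.d * s + s * 𝒞.d = 1 - 𝒞.projOn S ∧
      (∀ n, 𝒞.pr (n + 1) * s = s * 𝒞.pr n) ∧ 𝒞.pr 0 * s = 0 := by
  induction S using Finset.induction_on with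
  | empty => exact ⟨0, by simp [projOn, tmap_one], by simp, by simp⟩
  | insert x S hx ih =>
    obtain ⟨s, h1, h2, h3⟩ := ih
    refine ⟨s + 𝒞.projOn S * 𝒞.atCoord x 𝒞.h, ?_, fun n => ?_, ?_⟩
    · rw [projOn_insert _ _ _ hx, mul_add, add_mul, ← mul_assoc, ← projOn_mul_d, mul_assoc,
        mul_assoc, add_add_add_comm, h1, ← mul_add, d_mul_at_h]
      noncomm_ring
    · rw [mul_add, h2, ← mul_assoc, pr_mul_projOn, mul_assoc, pr_mul_at_h, ← mul_assoc, add_mul]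
    · rw [mul_add, h3, ← mul_assoc, pr_mul_projOn, mul_assoc, pr_zero_mul_at_h, mul_zero, add_zero]

variable (I) in
/-- The augmentation of the tensor power. -/
def aug : ((I → Y) →₀ ℤ) →ₗ[ℤ] ℤ := tfun fun _ => degAug 𝒞.deg

theorem aug_single (b : I → Y) : 𝒞.aug I (Finsupp.single b 1) = if 𝒞.tdeg b = 0 then 1 else 0 := by
  simp only [aug, tfun_single, degAug_single, Finset.prod_ite_zero, Finset.prod_const_one, tdeg,
    Finset.sum_eq_zero_iff]

theorem exists_contraction : ∃ s : Module.End ℤ ((I → Y) →₀ ℤ),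
    𝒞.d * s + s * 𝒞.d = 1 - (𝒞.aug I).smulRight (Finsupp.single (fun _ => 𝒞.base) 1) ∧
      (∀ n, 𝒞.pr (n + 1) * s = s * 𝒞.pr n) ∧ 𝒞.pr 0 * s = 0 := by
  obtain ⟨s, h1, h2⟩ := 𝒞.exists_contraction_on (I := I) Finset.univ
  refine ⟨s, h1.trans ?_, h2⟩
  congr 1
  refine end_ext fun b => ?_
  rw [projOn, tmap_single, LinearMap.smulRight_apply, aug, tfun_single, ← pureTensor_single]
  simp only [Finset.mem_univ, if_true]
  exact pureMulti.map_smul_univ _ fun _ => Finsupp.single 𝒞.base 1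

theorem tfun_comp_d (w : I → (Y →₀ ℤ) →ₗ[ℤ] ℤ) (hw : ∀ x, w x ∘ₗ 𝒞.δ = 0) : tfun w ∘ₗ 𝒞.d = 0 := by
  refine end_ext fun b => ?_
  rw [LinearMap.comp_apply, d, LinearMap.sum_apply, map_sum, LinearMap.zero_apply]
  refine Finset.sum_eq_zero fun x _ => ?_
  rw [atCoord, ← LinearMap.comp_apply, tfun_comp_tmap]
  rw [tfun_single]
  refine Finset.prod_eq_zero (Finset.mem_univ x) ?_
  rw [Function.update_self, hw, LinearMap.zero_apply]

theorem aug_comp_d : 𝒞.aug I ∘ₗ 𝒞.d = 0 := 𝒞.tfun_comp_d _ fun _ => 𝒞.aug_δ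

end BasedCx

/-! ### Signed permutation actions on tensor powers -/

section InversionSign

variable {I : Type} [Fintype I] [LinearOrder I]

/-- `-1` if the permutation `g` inverts the ordered pair `(z, w)`. -/
def invSign (g : Equiv.Perm I) (z w : I) : ℤˣ := if z < w ∧ g w < g z then -1 else 1

/-- The Koszul sign of the permutation `g` acting on homogeneous elements of degrees `o`. -/
def koszulSign (g : Equiv.Perm I) (o : I → ℕ) : ℤˣ := ∏ z, ∏ w, invSign g z w ^ (o z * o w)

theorem koszulSign_even (g : Equiv.Perm I) (o : I → ℕ) (h : ∀ x, Even (o x)) :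
    koszulSign g o = 1 :=
  Finset.prod_eq_one fun z _ => Finset.prod_eq_one fun w _ => by
    obtain ⟨r, hr⟩ := h z
    rw [hr, add_mul, pow_add, ← mul_pow, Int.units_mul_self, one_pow]

theorem invSign_mul_symm (g : Equiv.Perm I) (z w : I) : invSign g z w * invSign g w z =
    (if z < w then -1 else 1) * (if g z < g w then -1 else 1) := by
  unfold invSign
  rcases lt_trichotomy z w with h | rfl | h
  · rcases lt_trichotomy (g z) (g w) with h' | h' | h'
    · simp [h, h', h.not_gt, h'.not_gt]
    · exact absurd (g.injective h') h.ne
    · simp [h, h', h.not_gt, h'.not_gt]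
  · simp
  · rcases lt_trichotomy (g z) (g w) with h' | h' | h'
    · simp [h, h', h.not_gt]
    · exact absurd (g.injective h') h.ne'
    · simp [h.not_gt, h'.not_gt]

theorem koszulSign_mul (g h : Equiv.Perm I) (o : I → ℕ) :
    koszulSign (g * h) o = koszulSign g (fun x => o (h⁻¹ x)) * koszulSign h o := by
  have h1 : koszulSign g (fun x => o (h⁻¹ x)) =
      ∏ z, ∏ w, invSign g (h z) (h w) ^ (o z * o w) := by
    rw [koszulSign, ← Equiv.prod_comp h]
    refine Finset.prod_congr rfl fun z _ => ?_
    rw [← Equiv.prod_comp h]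
    simp
  rw [h1, ← mul_inv_eq_one, Int.units_inv_eq_self]
  simp only [koszulSign, ← Finset.prod_mul_distrib, ← mul_pow]
  rw [← Finset.prod_product']
  refine Finset.prod_involution (fun p _ => p.swap) ?_ ?_ (fun _ _ => by simp)
    (fun p _ => p.swap_swap)
  · rintro ⟨z, w⟩ -
    simp only [Prod.fst_swap, Prod.snd_swap]
    rw [mul_comm (o w), ← mul_pow]
    have a := invSign_mul_symm (g * h) z w
    have b := invSign_mul_symm g (h z) (h w)
    have c := invSign_mul_symm h z w
    have : invSign (g * h) z w * (invSign g (h z) (h w) * invSign h z w) *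
        (invSign (g * h) w z * (invSign g (h w) (h z) * invSign h w z)) =
        (invSign (g * h) z w * invSign (g * h) w z) *
        (invSign g (h z) (h w) * invSign g (h w) (h z)) *
        (invSign h z w * invSign h w z) := by
      ac_rfl
    rw [this, a, b, c]
    change (((if z < w then -1 else 1) * (if g (h z) < g (h w) then -1 else 1)) *
      ((if h z < h w then -1 else 1) * (if g (h z) < g (h w) then -1 else 1)) *
      ((if z < w then -1 else 1) * (if h z < h w then -1 else 1)) : ℤˣ) ^ (o z * o w) = 1
    generalize (if z < w then -1 else 1 : ℤˣ) = p
    generalize (if h z < h w then -1 else 1 : ℤˣ) = q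
    generalize (if g (h z) < g (h w) then -1 else 1 : ℤˣ) = r
    have : p * r * (q * r) * (p * q) = (p * p) * (q * q) * (r * r) := by ac_rfl
    rw [this]
    simp only [Int.units_mul_self, one_mul, one_pow]
  · rintro ⟨z, w⟩ - hne heq
    obtain rfl : w = z := congrArg Prod.fst heq
    exact hne (by simp [invSign])

theorem koszulSign_succ (g : Equiv.Perm I) (o o' : I → ℕ) (x : I) (hx : o x = o' x + 1)
    (h : ∀ z, z ≠ x → o z = o' z) : koszulSign g o = koszulSign g o' *
      ∏ z, ((if z < x then -1 else 1) * (if g z < g x then -1 else 1)) ^ o z := by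
  have ho : ∀ z, o z = o' z + if z = x then 1 else 0 := fun z => by
    split_ifs with hz
    · rw [hz, hx]
    · exact h z hz
  have h1 : ∀ z w, o z * o w = o' z * o' w + (if w = x then o' z else 0) +
      ((if z = x then o' w else 0) + if z = x then if w = x then 1 else 0 else 0) := by
    intro z w
    rw [ho, ho]
    split_ifs <;> ring
  have hxx : invSign g x x = 1 := by simp [invSign]
  simp only [koszulSign, h1, pow_add, Finset.prod_mul_distrib, pow_ite, pow_zero, pow_one,
    Finset.prod_ite_eq', Finset.mem_univ, if_true]
  have h2 : ∀ z, ((if z < x then -1 else 1) * (if g z < g x then -1 else 1) : ℤˣ) ^ o z =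
      invSign g z x ^ o' z * invSign g x z ^ o' z := fun z => by
    rw [← mul_pow, invSign_mul_symm]
    by_cases hz : z = x
    · subst hz; simp
    · rw [h z hz]
  have h3 : (∏ z, ∏ w, if z = x then invSign g z w ^ o' w else 1) =
      ∏ w, invSign g x w ^ o' w := by
    rw [Finset.prod_comm]
    simp
  have h4 : (∏ z, ∏ w, if z = x then if w = x then invSign g z w else 1 else 1) = 1 :=
    Finset.prod_eq_one fun z _ => Finset.prod_eq_one fun w _ => by
      split_ifs with hz hw
      · rw [hz, hw, hxx]
      · rfl
      · rfl
  simp only [h2, Finset.prod_mul_distrib, h3, h4, mul_one, mul_assoc]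

end InversionSign

/-- An action of `Γ` on the coordinates of the tensor power `I → Y`, compatible with
an action on the index set. -/
structure Twist {Y I Γ : Type} [Group Γ] (𝒞 : BasedCx Y) (θ : Γ →* Equiv.Perm I) where
  act : Γ → I → Y → Y
  act_one : ∀ x y, act 1 x y = y
  act_mul : ∀ g h x y, act (g * h) x y = act g (θ h x) (act h x y)
  deg_act : ∀ g x y, 𝒞.deg (act g x y) = 𝒞.deg y
  δ_act : ∀ g x y, 𝒞.δ (Finsupp.single (act g x y) 1) =
    Finsupp.mapDomain (act g x) (𝒞.δ (Finsupp.single y 1))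

namespace Twist

variable {Y I Γ : Type} [Group Γ] {𝒞 : BasedCx Y} {θ : Γ →* Equiv.Perm I} (a : Twist 𝒞 θ)

/-- The permutation action on basis elements. -/
def perm : Γ →* Equiv.Perm (I → Y) where
  toFun g :=
    { toFun := fun b y => a.act g (θ g⁻¹ y) (b (θ g⁻¹ y))
      invFun := fun b y => a.act g⁻¹ (θ g y) (b (θ g y))
      left_inv := fun b => funext fun y => by
        have := a.act_mul g⁻¹ g y (b y)
        simp only [inv_mul_cancel, a.act_one] at this
        simpa using this.symm
      right_inv := fun b => funext fun y => by
        have := a.act_mul g g⁻¹ y (b y)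
        simp only [mul_inv_cancel, a.act_one] at this
        simpa using this.symm }
  map_one' := by ext b y; simp [a.act_one]
  map_mul' := fun g h => by
    ext b y
    simp [a.act_mul]

theorem perm_apply (g : Γ) (b : I → Y) (x : I) : a.perm g b x = a.act g (θ g⁻¹ x) (b (θ g⁻¹ x)) :=
  rfl

theorem perm_apply_perm (g : Γ) (b : I → Y) (x : I) : a.perm g b (θ g x) = a.act g x (b x) := by
  simp [perm_apply]

theorem deg_perm (g : Γ) (b : I → Y) (x : I) : 𝒞.deg (a.perm g b x) = 𝒞.deg (b (θ g⁻¹ x)) := by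
  rw [perm_apply, a.deg_act]

theorem perm_update [DecidableEq I] (g : Γ) (b : I → Y) (x : I) (y : Y) :
    a.perm g (Function.update b x y) = Function.update (a.perm g b) (θ g x) (a.act g x y) := by
  ext1 z
  obtain ⟨z, rfl⟩ := (θ g).surjective z
  rw [perm_apply_perm]
  by_cases hz : z = x
  · subst hz; simp
  · rw [Function.update_of_ne hz, Function.update_of_ne ((θ g).injective.ne hz), perm_apply_perm]

variable [Fintype I] [LinearOrder I]

/-- The sign of the action on a basis element. -/
def sign (_ : Twist 𝒞 θ) (g : Γ) (b : I → Y) : ℤˣ := koszulSign (θ g) fun x => 𝒞.deg (b x)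

theorem sign_mul (g h : Γ) (b : I → Y) :
    a.sign (g * h) b = a.sign g (a.perm h b) * a.sign h b := by
  simp only [sign, map_mul, koszulSign_mul, deg_perm, map_inv]

/-- The signed action on the tensor power. -/
def rep : Γ →* Module.End ℤ ((I → Y) →₀ ℤ) where
  toFun g := Finsupp.linearCombination ℤ fun b => Finsupp.single (a.perm g b) (a.sign g b : ℤ)
  map_one' := end_ext fun b => by
    have : a.sign 1 b = 1 := by simpa using a.sign_mul 1 1 b
    simp [this]
  map_mul' := fun g h => end_ext fun b => by
    simp only [Module.End.mul_apply, Finsupp.linearCombination_single, one_smul, map_mul,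
      Equiv.Perm.mul_apply, sign_mul, Units.val_mul, Finsupp.smul_single, smul_eq_mul]
    rw [mul_comm]

theorem rep_single (g : Γ) (b : I → Y) :
    a.rep g (Finsupp.single b 1) = Finsupp.single (a.perm g b) (a.sign g b : ℤ) := by
  simp [rep]

theorem tdeg_perm (g : Γ) (b : I → Y) : 𝒞.tdeg (a.perm g b) = 𝒞.tdeg b := by
  simp only [BasedCx.tdeg, deg_perm]
  exact Equiv.sum_comp (θ g⁻¹) fun x => 𝒞.deg (b x)

theorem rep_support {g : Γ} {b b' : I → Y} (h : a.rep g (Finsupp.single b 1) b' ≠ 0) :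
    b' = a.perm g b := by
  by_contra hne
  rw [rep_single, Finsupp.single_eq_of_ne hne] at h
  exact h rfl

theorem pr_mul_rep (n : ℕ) (g : Γ) : 𝒞.pr n * a.rep g = a.rep g * 𝒞.pr n :=
  diag_comp _ _ _ fun b b' h => by
    rw [a.rep_support h, tdeg_perm]

end Twist

theorem BasedCx.atCoord_single {Y I : Type} [Fintype I] [LinearOrder I] (𝒞 : BasedCx Y) (x : I)
    (k : Module.End ℤ (Y →₀ ℤ)) (b : I → Y) : 𝒞.atCoord x k (Finsupp.single b 1) =
      (∏ z, (if z < x then -1 else 1 : ℤ) ^ 𝒞.deg (b z)) •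
        Finsupp.mapDomain (Function.update b x) (k (Finsupp.single (b x) 1)) := by
  rw [atCoord, tmap_single, ← pureTensor_update]
  refine Eq.trans ?_ (pureMulti.map_smul_univ _ _)
  change pureTensor _ = pureTensor _
  congr 1
  ext1 z
  by_cases hz : z = x
  · subst hz; simp
  · simp only [Function.update_of_ne hz]
    split_ifs
    · rw [sgn, diag_single, Finsupp.smul_single, smul_eq_mul, mul_one]
    · rw [one_pow, one_smul, Module.End.one_apply]

namespace Twist

variable {Y I Γ : Type} [Group Γ] {𝒞 : BasedCx Y} {θ : Γ →* Equiv.Perm I} (a : Twist 𝒞 θ)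
  [Fintype I] [LinearOrder I]

theorem rep_mapDomain_update (g : Γ) (b : I → Y) (x : I) (c : Y →₀ ℤ) (e : ℤ)
    (he : ∀ y, c y ≠ 0 → (a.sign g (Function.update b x y) : ℤ) = e) :
    a.rep g (Finsupp.mapDomain (Function.update b x) c) = e • Finsupp.mapDomain
      (Function.update (a.perm g b) (θ g x)) (Finsupp.mapDomain (a.act g x) c) := by
  have h1 : a.rep g ∘ₗ Finsupp.lmapDomain ℤ ℤ (Function.update b x) =
      Finsupp.lmapDomain ℤ ℤ (Function.update (a.perm g b) (θ g x)) ∘ₗ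
        Finsupp.lmapDomain ℤ ℤ (a.act g x) ∘ₗ
          diag fun y => (a.sign g (Function.update b x y) : ℤ) := end_ext fun y => by
    simp [rep_single, perm_update]
  have h2 : (diag fun y => (a.sign g (Function.update b x y) : ℤ)) c = e • c :=
    Finsupp.ext fun y => by
      rw [diag_apply, Finsupp.smul_apply, smul_eq_mul]
      by_cases hy : c y = 0
      · rw [hy, mul_zero, mul_zero]
      · rw [he y hy]
  have h3 := congrArg (fun f : (Y →₀ ℤ) →ₗ[ℤ] _ => f c) h1
  simp only [LinearMap.comp_apply, h2, map_smul] at h3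
  exact h3

theorem rep_mul_atCoord_δ (g : Γ) (x : I) :
    a.rep g * 𝒞.atCoord x 𝒞.δ = 𝒞.atCoord (θ g x) 𝒞.δ * a.rep g := end_ext fun b => by
  rw [Module.End.mul_apply, Module.End.mul_apply, BasedCx.atCoord_single, rep_single,
    map_smul, ← mul_one (a.sign g b : ℤ), ← smul_eq_mul, ← Finsupp.smul_single, map_smul,
    BasedCx.atCoord_single, perm_apply_perm, a.δ_act]
  set s : ℤˣ := ∏ z, (if z < x then -1 else 1 : ℤˣ) ^ 𝒞.deg (b z) with hs
  set t : ℤˣ := ∏ z, (if z < θ g x then -1 else 1 : ℤˣ) ^ 𝒞.deg (a.perm g b z) with ht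
  have hs' : (∏ z, (if z < x then -1 else 1 : ℤ) ^ 𝒞.deg (b z)) = (s : ℤ) := by
    rw [hs, Units.coe_prod]
    refine Finset.prod_congr rfl fun z _ => ?_
    split_ifs <;> simp
  have ht' : (∏ z, (if z < θ g x then -1 else 1 : ℤ) ^ 𝒞.deg (a.perm g b z)) = (t : ℤ) := by
    rw [ht, Units.coe_prod]
    refine Finset.prod_congr rfl fun z _ => ?_
    split_ifs <;> simp
  have ht2 : t = ∏ z, (if θ g z < θ g x then -1 else 1 : ℤˣ) ^ 𝒞.deg (b z) := by
    rw [ht, ← Equiv.prod_comp (θ g)]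
    simp only [perm_apply_perm, a.deg_act]
  rw [hs', ht', a.rep_mapDomain_update g b x _ (a.sign g b * s * t : ℤˣ), smul_smul, smul_smul,
    ← Units.val_mul, ← Units.val_mul]
  · congr 2
    rw [mul_comm s, mul_assoc, mul_assoc, mul_comm t, ← mul_assoc s, Int.units_mul_self, one_mul]
  · intro y hy
    congr 1
    have h1 := 𝒞.δ_deg _ _ hy
    have h2 := koszulSign_succ (θ g) (fun z => 𝒞.deg (b z))
      (fun z => 𝒞.deg (Function.update b x y z)) x (by simpa using h1)
      (fun z hz => by simp [hz])
    simp only [mul_pow, Finset.prod_mul_distrib, ← hs, ← ht2] at h2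
    change _ = koszulSign (θ g) (fun z => 𝒞.deg (b z)) * s * t
    rw [h2, mul_assoc, mul_assoc, mul_assoc s, mul_comm t (s * t), mul_assoc s t t,
      Int.units_mul_self, mul_one, Int.units_mul_self, mul_one, sign]

theorem rep_mul_d (g : Γ) : a.rep g * 𝒞.d = 𝒞.d * a.rep g := by
  simp only [BasedCx.d, Finset.mul_sum, Finset.sum_mul, rep_mul_atCoord_δ]
  exact Equiv.sum_comp (θ g) fun x => 𝒞.atCoord x 𝒞.δ * a.rep g

/-- A product functional supported in even degrees is permuted without signs. -/
theorem tfun_comp_rep (g : Γ) (w w' : I → (Y →₀ ℤ) →ₗ[ℤ] ℤ)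
    (hw : ∀ x y, w x (Finsupp.single y 1) ≠ 0 → Even (𝒞.deg y))
    (h : ∀ x y, w (θ g x) (Finsupp.single (a.act g x y) 1) = w' x (Finsupp.single y 1)) :
    tfun w ∘ₗ a.rep g = tfun w' := end_ext fun b => by
  rw [LinearMap.comp_apply, rep_single, ← mul_one (a.sign g b : ℤ), ← smul_eq_mul,
    ← Finsupp.smul_single, map_smul, tfun_single, tfun_single, ← Equiv.prod_comp (θ g)]
  simp only [perm_apply_perm, h]
  by_cases h0 : ∏ x, w' x (Finsupp.single (b x) 1) = 0
  · rw [h0, smul_zero]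
  · rw [sign, koszulSign_even, Units.val_one, one_smul]
    intro x
    rw [← a.deg_act g x]
    refine hw (θ g x) _ ?_
    rw [h]
    exact Finset.prod_ne_zero_iff.1 h0 x (Finset.mem_univ x)

theorem aug_comp_rep (g : Γ) : 𝒞.aug I ∘ₗ a.rep g = 𝒞.aug I :=
  a.tfun_comp_rep g _ _ (fun x y h => by
    rw [degAug_single] at h
    split_ifs at h with h0
    · simp [h0]
    · exact absurd rfl h) fun x y => by
    rw [degAug_single, degAug_single, a.deg_act]

end Twist

/-! ### Equivariant homotopies -/

section Homotopy

variable {A Q : Type} [Ring A] [Group Q] [Fintype Q]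

/-- The relative trace of `y * e`. -/
def traceAvg (ρ : Q →* A) (e y : A) : A := ∑ q, ρ q * (y * e) * ρ q⁻¹

theorem mul_traceAvg (ρ : Q →* A) (e x y : A) (h : ∀ q, x * ρ q = ρ q * x) :
    x * traceAvg ρ e y = traceAvg ρ e (x * y) := by
  simp only [traceAvg, Finset.mul_sum, ← mul_assoc, h]

theorem traceAvg_mul (ρ : Q →* A) (e x y : A) (h : ∀ q, x * ρ q = ρ q * x) (he : x * e = e * x) :
    traceAvg ρ e (y * x) = traceAvg ρ e y * x := by
  simp only [traceAvg, Finset.sum_mul]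
  refine Finset.sum_congr rfl fun q _ => ?_
  rw [mul_assoc y, he, mul_assoc _ _ x, ← h]
  simp only [mul_assoc]

theorem rho_mul_traceAvg (ρ : Q →* A) (e y : A) (g : Q) :
    ρ g * traceAvg ρ e y = traceAvg ρ e y * ρ g := by
  simp only [traceAvg, Finset.mul_sum, Finset.sum_mul]
  refine Eq.trans ?_ (Equiv.sum_comp (Equiv.mulLeft g) _)
  refine Finset.sum_congr rfl fun q _ => ?_
  simp only [Equiv.coe_mulLeft, mul_inv_rev, map_mul, mul_assoc]
  rw [← map_mul, inv_mul_cancel, map_one, mul_one]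

theorem traceAvg_of_comm (ρ : Q →* A) (e y : A) (he : traceAvg ρ e 1 = 1)
    (h : ∀ q, y * ρ q = ρ q * y) : traceAvg ρ e y = y := by
  rw [← mul_one y, ← mul_traceAvg ρ e y 1 h, he]

theorem exists_homotopy {d s ϖ Ψ e : A} {pr : ℕ → A} (ρ : Q →* A)
    (hs : d * s + s * d = 1 - ϖ) (hdd : d * d = 0) (hprd : ∀ n, pr n * d = d * pr (n + 1))
    (hprd0 : d * pr 0 = 0) (hprs : ∀ n, pr (n + 1) * s = s * pr n) (hprs0 : pr 0 * s = 0)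
    (hϖ : ∀ n, ϖ * pr (n + 1) = 0) (hϖΨ : ϖ * Ψ = 0) (hprΨ : ∀ n, pr n * Ψ = Ψ * pr n)
    (hdΨ : d * Ψ = Ψ * d) (hρΨ : ∀ q, Ψ * ρ q = ρ q * Ψ) (hρd : ∀ q, d * ρ q = ρ q * d)
    (hρpr : ∀ n q, pr n * ρ q = ρ q * pr n) (hepr : ∀ n, pr n * e = e * pr n)
    (he : traceAvg ρ e 1 = 1) (n : ℕ) :
    ∃ T T' : A, d * T' * pr n = (Ψ - T * d) * pr n ∧ (∀ q, T * ρ q = ρ q * T) ∧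
      (∀ i, pr (i + 1) * T = T * pr i) ∧ pr 0 * T = 0 ∧ (∀ q, T' * ρ q = ρ q * T') ∧
      (∀ i, pr (i + 1) * T' = T' * pr i) ∧ pr 0 * T' = 0 := by
  have step : ∀ n : ℕ, ∀ T : A, (∀ q, T * ρ q = ρ q * T) → (∀ i, pr (i + 1) * T = T * pr i) →
      pr 0 * T = 0 → (d * T * d * pr n = Ψ * d * pr n) → ϖ * T * d * pr n = 0 →
      ∃ T' : A, d * T' * pr n = (Ψ - T * d) * pr n ∧ (∀ q, T' * ρ q = ρ q * T') ∧
      (∀ i, pr (i + 1) * T' = T' * pr i) ∧ pr 0 * T' = 0 := by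
    intro n T h1 h2 h3 h4 h5
    have hZ : ∀ i, pr i * (Ψ - T * d) = (Ψ - T * d) * pr i := by
      intro i
      rw [mul_sub, sub_mul, hprΨ, ← mul_assoc]
      cases i with
      | zero => rw [h3, mul_assoc T, hprd0, zero_mul, mul_zero]
      | succ i => rw [h2, mul_assoc, hprd, mul_assoc]
    have hZρ : ∀ q, (Ψ - T * d) * ρ q = ρ q * (Ψ - T * d) := fun q => by
      rw [sub_mul, mul_sub, hρΨ, mul_assoc, hρd, ← mul_assoc, h1, mul_assoc]
    refine ⟨traceAvg ρ e (s * (Ψ - T * d)), ?_, fun q => (rho_mul_traceAvg _ _ _ _).symm,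
      fun i => ?_, ?_⟩
    · rw [mul_traceAvg _ _ _ _ hρd, ← traceAvg_mul _ _ _ _ (hρpr n) (hepr n)]
      have : d * (s * (Ψ - T * d)) * pr n = (Ψ - T * d) * pr n := by
        have hd : d * s = 1 - ϖ - s * d := by rw [← hs]; abel
        have h6 : (1 - ϖ - s * d) * (Ψ - T * d) * pr n = (Ψ - T * d) * pr n - ϖ * Ψ * pr n +
            ϖ * T * d * pr n - s * (d * Ψ * pr n - d * T * d * pr n) := by noncomm_ring
        rw [← mul_assoc, hd, h6, hϖΨ, h5, hdΨ, h4]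
        simp
      rw [this]
      exact traceAvg_of_comm _ _ _ he fun q => by
        rw [mul_assoc, hρpr, ← mul_assoc, hZρ, mul_assoc]
    · rw [mul_traceAvg _ _ _ _ (hρpr _), ← mul_assoc, hprs, mul_assoc, hZ, ← mul_assoc,
        traceAvg_mul _ _ _ _ (hρpr i) (hepr i)]
    · rw [mul_traceAvg _ _ _ _ (hρpr _), ← mul_assoc, hprs0, zero_mul]
      simp [traceAvg]
  induction n with
  | zero =>
    obtain ⟨T', h⟩ := step 0 0 (by simp) (by simp) (by simp)
      (by rw [mul_assoc Ψ, hprd0]; simp) (by simp)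
    exact ⟨0, T', h.1, by simp, by simp, by simp, h.2⟩
  | succ n ih =>
    obtain ⟨T₀, T, h1, -, -, -, h5, h6, h7⟩ := ih
    obtain ⟨T', h⟩ := step (n + 1) T h5 h6 h7
      (by
        rw [mul_assoc, ← hprd, ← mul_assoc, h1, mul_assoc, hprd, ← mul_assoc, sub_mul,
          mul_assoc T₀, hdd, mul_zero, sub_zero])
      (by rw [mul_assoc, ← hprd, ← mul_assoc, mul_assoc ϖ, ← h6, ← mul_assoc, hϖ, zero_mul,
          zero_mul])
    exact ⟨T, T', h.1, h5, h6, h7, h.2⟩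

end Homotopy

namespace Twist

variable {Y I Γ Q : Type} [Group Γ] {𝒞 : BasedCx Y} {θ : Γ →* Equiv.Perm I} (a : Twist 𝒞 θ)
  [Fintype I] [LinearOrder I] [Group Q] [Fintype Q]

theorem aug_proj_mul_pr (n : ℕ) :
    (𝒞.aug I).smulRight (Finsupp.single (fun _ => 𝒞.base) (1 : ℤ)) * 𝒞.pr (n + 1) = 0 :=
  end_ext fun b => by
    rw [Module.End.mul_apply, BasedCx.pr, diag_single, ← mul_one (ite _ _ _), ← smul_eq_mul,
      ← Finsupp.smul_single, map_smul, LinearMap.smulRight_apply, BasedCx.aug_single]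
    split_ifs with h1 h2
    · omega
    · simp
    · simp
    · simp

/-- An element commuting with a freely acting group changes invariant cocycles by coboundaries
of invariant cochains. -/
theorem exists_coboundary (j : Q →* Γ) (r : Γ) (hr : ∀ q, Commute r (j q)) (w : (I → Y) → ℤ)
    (hw : ∀ b, ∑ q, w (a.perm (j q) b) = 1) {n : ℕ} (N : ((I → Y) →₀ ℤ) →ₗ[ℤ] ℤ)
    (hN : N ∘ₗ 𝒞.d = 0) (hNpr : N ∘ₗ 𝒞.pr (n + 1) = N) (hNj : ∀ q, N ∘ₗ a.rep (j q) = N) :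
    ∃ N' : ((I → Y) →₀ ℤ) →ₗ[ℤ] ℤ, N' ∘ₗ 𝒞.d = N ∘ₗ a.rep r - N ∧ N' ∘ₗ 𝒞.pr n = N' ∧
      ∀ q, N' ∘ₗ a.rep (j q) = N' := by
  obtain ⟨s, hs1, hs2, hs3⟩ := 𝒞.exists_contraction (I := I)
  have hrj : ∀ q, a.rep r * a.rep (j q) = a.rep (j q) * a.rep r := fun q => by
    rw [← map_mul, (hr q).eq, map_mul]
  obtain ⟨T, T', h1, h2, h3, -, -, -, -⟩ := exists_homotopy (Ψ := a.rep r - 1) (e := diag w)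
    (a.rep.comp j) hs1 𝒞.d_mul_d 𝒞.pr_mul_d 𝒞.d_mul_pr_zero hs2 hs3 aug_proj_mul_pr
    (by
      rw [mul_sub, mul_one, sub_eq_zero]
      refine LinearMap.ext fun c => ?_
      rw [Module.End.mul_apply, LinearMap.smulRight_apply, LinearMap.smulRight_apply,
        ← LinearMap.comp_apply, a.aug_comp_rep])
    (fun n => by rw [mul_sub, sub_mul, a.pr_mul_rep, mul_one, one_mul])
    (by rw [mul_sub, sub_mul, a.rep_mul_d, mul_one, one_mul])
    (fun q => by rw [MonoidHom.comp_apply, mul_sub, sub_mul, mul_one, one_mul, hrj])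
    (fun q => (a.rep_mul_d _).symm) (fun n q => a.pr_mul_rep _ _)
    (fun n => by simp only [BasedCx.pr, diag_mul, mul_comm])
    (end_ext fun b => by
      have key : ∀ q, (a.rep (j q) * (1 * diag w) * a.rep (j q⁻¹)) (Finsupp.single b 1) =
          Finsupp.single b (w (a.perm (j q⁻¹) b)) := fun q => by
        have hinv : a.rep (j q) * a.rep (j q⁻¹) = 1 := by rw [← map_mul, ← map_mul]; simp
        have hdiag : diag w * a.rep (j q⁻¹) =
            a.rep (j q⁻¹) * diag fun b => w (a.perm (j q⁻¹) b) :=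
          diag_comp _ _ _ fun b b' hb => by rw [a.rep_support hb]
        rw [one_mul, mul_assoc, hdiag, ← mul_assoc, hinv, one_mul, diag_single]
      simp only [traceAvg, LinearMap.sum_apply, MonoidHom.comp_apply]
      rw [Finset.sum_congr rfl fun q _ => key q, ← Finsupp.single_finsetSum]
      exact congrArg _ ((Equiv.sum_comp (Equiv.inv Q) fun q => w (a.perm (j q) b)).trans (hw b))) (n + 1)
  refine ⟨N ∘ₗ T, ?_, ?_, fun q => ?_⟩
  · have h4 : N ∘ₗ (𝒞.d * T' * 𝒞.pr (n + 1)) = 0 := by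
      rw [mul_assoc, Module.End.mul_eq_comp, ← LinearMap.comp_assoc, hN, LinearMap.zero_comp]
    rw [h1, sub_mul, LinearMap.comp_sub, sub_mul, one_mul, LinearMap.comp_sub, hNpr,
      ← a.pr_mul_rep, Module.End.mul_eq_comp, ← LinearMap.comp_assoc, hNpr, mul_assoc,
      ← 𝒞.pr_mul_d, ← mul_assoc, ← h3, mul_assoc, Module.End.mul_eq_comp (𝒞.pr (n + 1)),
      ← LinearMap.comp_assoc, hNpr, sub_eq_zero] at h4
    rw [h4]
    rfl
  · rw [LinearMap.comp_assoc, ← Module.End.mul_eq_comp, ← h3, Module.End.mul_eq_comp,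
      ← LinearMap.comp_assoc, hNpr]
  · have := h2 q
    rw [MonoidHom.comp_apply] at this
    rw [LinearMap.comp_assoc, ← Module.End.mul_eq_comp, this, Module.End.mul_eq_comp,
      ← LinearMap.comp_assoc, hNj]

end Twist

/-! ### Maps of tensor powers -/

theorem prod_withBot {X A : Type} [Fintype X] [CommMonoid A] (F : WithBot X → A) :
    ∏ z, F z = F ⊥ * ∏ x : X, F x := Fintype.prod_option F

theorem sum_withBot {X A : Type} [Fintype X] [AddCommMonoid A] (F : WithBot X → A) :
    ∑ z, F z = F ⊥ + ∑ x : X, F x := Fintype.sum_option F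

namespace Twist

variable {Y I Γ : Type} [Group Γ] {𝒞 : BasedCx Y} {θ : Γ →* Equiv.Perm I} (a : Twist 𝒞 θ)

theorem act_injective (g : Γ) (x : I) : Function.Injective (a.act g x) := fun y y' h => by
  have := congrArg (a.act g⁻¹ (θ g x)) h
  simpa only [← a.act_mul, inv_mul_cancel, a.act_one] using this

theorem rep_apply_perm [Fintype I] [LinearOrder I] (g : Γ) (c : (I → Y) →₀ ℤ) (b : I → Y) :
    a.rep g c (a.perm g b) = a.sign g b * c b := by
  classical
  have : Finsupp.lapply (a.perm g b) ∘ₗ a.rep g =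
      (a.sign g b : ℤ) • Finsupp.lapply (M := ℤ) (R := ℤ) b := end_ext fun b' => by
    simp only [LinearMap.comp_apply, rep_single, Finsupp.lapply_apply, LinearMap.smul_apply,
      smul_eq_mul, Finsupp.single_apply, EmbeddingLike.apply_eq_iff_eq]
    split_ifs with h
    · rw [h, mul_one]
    · rw [mul_zero]
  exact congrArg (fun f : ((I → Y) →₀ ℤ) →ₗ[ℤ] ℤ => f c) this

end Twist

/-- A family of degree preserving chain maps. -/
structure CxFam {Y Y' : Type} (𝒞 : BasedCx Y) (𝒞' : BasedCx Y') (I : Type) where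
  map : I → (Y →₀ ℤ) →ₗ[ℤ] (Y' →₀ ℤ)
  deg_map : ∀ x y y', map x (Finsupp.single y 1) y' ≠ 0 → 𝒞'.deg y' = 𝒞.deg y
  δ_map : ∀ x, 𝒞'.δ ∘ₗ map x = map x ∘ₗ 𝒞.δ
  aug_map : ∀ x, degAug 𝒞'.deg ∘ₗ map x = degAug 𝒞.deg

namespace CxFam

variable {Y Y' I : Type} {𝒞 : BasedCx Y} {𝒞' : BasedCx Y'} (φ : CxFam 𝒞 𝒞' I)

theorem sgn_map (x : I) : 𝒞'.sgn ∘ₗ φ.map x = φ.map x ∘ₗ 𝒞.sgn :=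
  diag_comp _ _ _ fun y y' h => by rw [φ.deg_map x y y' h]

variable [Fintype I] [LinearOrder I]

theorem atCoord_comp_tmap (x : I) :
    𝒞'.atCoord x 𝒞'.δ ∘ₗ tmap φ.map = tmap φ.map ∘ₗ 𝒞.atCoord x 𝒞.δ := by
  rw [BasedCx.atCoord, BasedCx.atCoord, tmap_comp, tmap_comp]
  congr 1
  ext1 z
  by_cases hz : z = x
  · subst hz
    simp only [Function.update_self, φ.δ_map]
  · simp only [Function.update_of_ne hz]
    split_ifs
    · exact φ.sgn_map z
    · rfl

theorem d_comp_tmap : 𝒞'.d ∘ₗ tmap φ.map = tmap φ.map ∘ₗ 𝒞.d (I := I) := by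
  refine LinearMap.ext fun c => ?_
  simp only [LinearMap.comp_apply, BasedCx.d, LinearMap.sum_apply, map_sum]
  exact Finset.sum_congr rfl fun x _ => LinearMap.congr_fun (φ.atCoord_comp_tmap x) c

theorem pr_comp_tmap (n : ℕ) : 𝒞'.pr n ∘ₗ tmap φ.map = tmap φ.map ∘ₗ 𝒞.pr (I := I) n :=
  diag_comp _ _ _ fun b b' h => by
    rw [tmap_single, pureTensor_apply, Finset.prod_ne_zero_iff] at h
    have : 𝒞'.tdeg b' = 𝒞.tdeg b :=
      Finset.sum_congr rfl fun x _ => φ.deg_map _ _ _ (h x (Finset.mem_univ x))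
    rw [this]

theorem aug_comp_tmap : 𝒞'.aug I ∘ₗ tmap φ.map = 𝒞.aug I := by
  rw [BasedCx.aug, tfun_comp_tmap]
  simp only [φ.aug_map]
  rfl

theorem rep_comp_tmap {Γ : Type} [Group Γ] {θ : Γ →* Equiv.Perm I} (a : Twist 𝒞 θ)
    (a' : Twist 𝒞' θ) (g : Γ)
    (h : ∀ x y, φ.map (θ g x) (Finsupp.single (a.act g x y) 1) =
      Finsupp.mapDomain (a'.act g x) (φ.map x (Finsupp.single y 1))) :
    a'.rep g ∘ₗ tmap φ.map = tmap φ.map ∘ₗ a.rep g := end_ext fun b => Finsupp.ext fun b' => by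
  obtain ⟨b', rfl⟩ := (a'.perm g).surjective b'
  rw [LinearMap.comp_apply, LinearMap.comp_apply, a'.rep_apply_perm, a.rep_single,
    ← mul_one (a.sign g b : ℤ), ← smul_eq_mul (a.sign g b : ℤ), ← Finsupp.smul_single, map_smul,
    tmap_single, tmap_single, Finsupp.smul_apply, pureTensor_apply, pureTensor_apply,
    ← Equiv.prod_comp (θ g) fun x => φ.map x (Finsupp.single (a.perm g b x) 1) (a'.perm g b' x),
    smul_eq_mul]
  simp only [Twist.perm_apply_perm, h, Finsupp.mapDomain_apply (a'.act_injective g _)]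
  by_cases h0 : ∏ x, φ.map x (Finsupp.single (b x) 1) (b' x) = 0
  · rw [h0, mul_zero, mul_zero]
  · rw [← ne_eq, Finset.prod_ne_zero_iff] at h0
    have : (fun x => 𝒞'.deg (b' x)) = fun x => 𝒞.deg (b x) := funext fun x =>
      φ.deg_map _ _ _ (h0 x (Finset.mem_univ x))
    rw [Twist.sign, Twist.sign, this]

end CxFam

section Forget

variable {Y X : Type} [Fintype X] [LinearOrder X] (𝒞 : BasedCx Y)

/-- Apply the augmentation in the first coordinate. -/
def forgetBot : ((WithBot X → Y) →₀ ℤ) →ₗ[ℤ] ((X → Y) →₀ ℤ) :=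
  Finsupp.linearCombination ℤ fun b =>
    (if 𝒞.deg (b ⊥) = 0 then 1 else 0 : ℤ) • Finsupp.single (fun x : X => b x) 1

theorem forgetBot_single (b : WithBot X → Y) : forgetBot 𝒞 (Finsupp.single b 1) =
    (if 𝒞.deg (b ⊥) = 0 then 1 else 0 : ℤ) • Finsupp.single (fun x : X => b x) 1 := by
  simp [forgetBot]

theorem forgetBot_mapDomain_bot (b : WithBot X → Y) (c : Y →₀ ℤ) :
    forgetBot 𝒞 (Finsupp.mapDomain (Function.update b ⊥) c) =
      degAug 𝒞.deg c • Finsupp.single (fun x : X => b x) 1 := by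
  have : forgetBot 𝒞 ∘ₗ Finsupp.lmapDomain ℤ ℤ (Function.update b ⊥) =
      (degAug 𝒞.deg).smulRight (Finsupp.single (fun x : X => b x) 1) := end_ext fun y => by
    simp [forgetBot_single, degAug_single]
  exact LinearMap.congr_fun this c

theorem forgetBot_mapDomain_coe (b : WithBot X → Y) (x : X) (c : Y →₀ ℤ) :
    forgetBot 𝒞 (Finsupp.mapDomain (Function.update b x) c) =
      (if 𝒞.deg (b ⊥) = 0 then 1 else 0 : ℤ) •
        Finsupp.mapDomain (Function.update (fun x : X => b x) x) c := by
  have : forgetBot 𝒞 ∘ₗ Finsupp.lmapDomain ℤ ℤ (Function.update b x) =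
      (if 𝒞.deg (b ⊥) = 0 then 1 else 0 : ℤ) •
        Finsupp.lmapDomain ℤ ℤ (Function.update (fun x : X => b x) x) := end_ext fun y => by
    have h : (fun z : X => Function.update b (x : WithBot X) y z) =
        Function.update (fun x : X => b x) x y := by
      ext1 z
      by_cases hz : z = x
      · subst hz; simp
      · simp [hz]
    rw [LinearMap.smul_apply, LinearMap.comp_apply, Finsupp.lmapDomain_apply,
      Finsupp.lmapDomain_apply, Finsupp.mapDomain_single, Finsupp.mapDomain_single,
      forgetBot_single, h, Function.update_of_ne (WithBot.bot_ne_coe)]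
  exact LinearMap.congr_fun this c

theorem forgetBot_comp_d : forgetBot (X := X) 𝒞 ∘ₗ 𝒞.d = 𝒞.d ∘ₗ forgetBot 𝒞 :=
  end_ext fun b => by
    rw [LinearMap.comp_apply, LinearMap.comp_apply, forgetBot_single, map_smul, BasedCx.d,
      BasedCx.d, LinearMap.sum_apply, LinearMap.sum_apply, map_sum, sum_withBot,
      BasedCx.atCoord_single, map_smul, forgetBot_mapDomain_bot, ← LinearMap.comp_apply,
      𝒞.aug_δ, LinearMap.zero_apply, zero_smul, smul_zero, zero_add, Finset.smul_sum]
    refine Finset.sum_congr rfl fun x _ => ?_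
    rw [BasedCx.atCoord_single, map_smul, forgetBot_mapDomain_coe, BasedCx.atCoord_single,
      prod_withBot, smul_smul, smul_smul]
    by_cases h0 : 𝒞.deg (b ⊥) = 0
    · simp only [h0, if_true, pow_zero, one_mul, mul_one, WithBot.coe_lt_coe]
    · simp only [h0, if_false, zero_mul, mul_zero]

theorem pr_comp_forgetBot (n : ℕ) : 𝒞.pr n ∘ₗ forgetBot (X := X) 𝒞 = forgetBot 𝒞 ∘ₗ 𝒞.pr n :=
  diag_comp _ _ _ fun b b' h => by
    rw [forgetBot_single] at h
    split_ifs at h with h0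
    · have hb : b' = fun x : X => b x := by
        by_contra hne
        exact h (by rw [Finsupp.smul_apply, Finsupp.single_eq_of_ne hne, smul_zero])
      have : 𝒞.tdeg b = 𝒞.tdeg b' := by
        rw [hb, BasedCx.tdeg, BasedCx.tdeg, sum_withBot, h0, zero_add]
      rw [this]
    · simp at h

theorem aug_comp_forgetBot : 𝒞.aug X ∘ₗ forgetBot 𝒞 = 𝒞.aug (WithBot X) := end_ext fun b => by
  rw [LinearMap.comp_apply, forgetBot_single, map_smul, BasedCx.aug_single, BasedCx.aug_single,
    BasedCx.tdeg, BasedCx.tdeg, sum_withBot]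
  split_ifs <;> simp_all

theorem tfun_comp_forgetBot (w : X → (Y →₀ ℤ) →ₗ[ℤ] ℤ) : tfun w ∘ₗ forgetBot 𝒞 =
    tfun fun z : WithBot X => z.recBotCoe (C := fun _ => (Y →₀ ℤ) →ₗ[ℤ] ℤ) (degAug 𝒞.deg) w :=
  end_ext fun b => by
    rw [LinearMap.comp_apply, forgetBot_single, map_smul, tfun_single, tfun_single, prod_withBot]
    rw [WithBot.recBotCoe_bot, degAug_single, smul_eq_mul]
    rfl

theorem rep_comp_forgetBot {Γ : Type} [Group Γ] {θ : Γ →* Equiv.Perm X}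
    {θ' : Γ →* Equiv.Perm (WithBot X)} (a : Twist 𝒞 θ) (a' : Twist 𝒞 θ') (g : Γ)
    (hbot : θ' g ⊥ = ⊥) (hcoe : ∀ x : X, θ' g x = θ g x)
    (hact : ∀ (x : X) y, a'.act g x y = a.act g x y) :
    a.rep g ∘ₗ forgetBot 𝒞 = forgetBot 𝒞 ∘ₗ a'.rep g := end_ext fun b => by
  have hb : a'.perm g b ⊥ = a'.act g ⊥ (b ⊥) := by
    conv_lhs => rw [← hbot]
    exact a'.perm_apply_perm g b ⊥
  have hc : (fun x : X => a'.perm g b x) = a.perm g fun x : X => b x := by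
    ext1 x
    obtain ⟨x, rfl⟩ := (θ g).surjective x
    rw [← hcoe, a'.perm_apply_perm, a.perm_apply_perm, hact]
  rw [LinearMap.comp_apply, LinearMap.comp_apply, forgetBot_single, map_smul, a.rep_single,
    a'.rep_single, ← mul_one (a'.sign g b : ℤ), ← smul_eq_mul, ← Finsupp.smul_single, map_smul,
    forgetBot_single, hb, a'.deg_act, hc]
  split_ifs with h0
  · have : a'.sign g b = a.sign g fun x : X => b x := by
      simp only [Twist.sign, koszulSign, prod_withBot, h0, mul_zero, zero_mul, pow_zero, one_mul,
        Finset.prod_const_one]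
      refine Finset.prod_congr rfl fun z _ => Finset.prod_congr rfl fun w _ => ?_
      simp only [invSign, hcoe, WithBot.coe_lt_coe]
    rw [this]
    simp
  · simp

end Forget

/-! ### The bar complex -/

namespace Bar

variable {Q : Type}

/-- Prepend a vertex to a simplex. -/
def cons (y : Q) (p : Q × List Q) : Q × List Q := (y, p.1 :: p.2)

/-- The degree of a simplex. -/
def deg (p : Q × List Q) : ℕ := p.2.length

/-- The boundary of a simplex. -/
def bd : Q → List Q → (Q × List Q →₀ ℤ)
  | _, [] => 0
  | y, z :: l => Finsupp.single (z, l) 1 - Finsupp.mapDomain (cons y) (bd z l) -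
      (if l.length = 0 then 1 else 0 : ℤ) • Finsupp.single (y, []) 1

/-- The boundary operator. -/
def δ : Module.End ℤ (Q × List Q →₀ ℤ) := Finsupp.linearCombination ℤ fun p => bd p.1 p.2

theorem δ_single (p : Q × List Q) : δ (Finsupp.single p 1) = bd p.1 p.2 := by simp [δ]

theorem degAug_mapDomain_cons (y : Q) (c : Q × List Q →₀ ℤ) :
    degAug deg (Finsupp.mapDomain (cons y) c) = 0 := by
  have : degAug deg ∘ₗ Finsupp.lmapDomain ℤ ℤ (cons y) = 0 := end_ext fun p => by
    simp [degAug_single, deg, cons]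
  exact LinearMap.congr_fun this c

theorem δ_mapDomain_cons (y : Q) (c : Q × List Q →₀ ℤ) : δ (Finsupp.mapDomain (cons y) c) =
    c - Finsupp.mapDomain (cons y) (δ c) - degAug deg c • Finsupp.single (y, []) 1 := by
  have : δ ∘ₗ Finsupp.lmapDomain ℤ ℤ (cons y) = LinearMap.id -
      Finsupp.lmapDomain ℤ ℤ (cons y) ∘ₗ δ - (degAug deg).smulRight (Finsupp.single (y, []) 1) :=
    end_ext fun p => by
      simp only [LinearMap.comp_apply, Finsupp.lmapDomain_apply, Finsupp.mapDomain_single,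
        δ_single, LinearMap.sub_apply, LinearMap.id_apply, LinearMap.smulRight_apply,
        degAug_single]
      rfl
  exact LinearMap.congr_fun this c

theorem degAug_bd (y : Q) (l : List Q) : degAug deg (bd y l) = 0 := by
  cases l with
  | nil => simp [bd]
  | cons z l =>
    rw [bd, map_sub, map_sub, degAug_mapDomain_cons, map_smul, degAug_single, degAug_single]
    simp [deg]

theorem δ_bd (y : Q) (l : List Q) : δ (bd y l) = 0 := by
  induction l generalizing y with
  | nil => simp [bd]
  | cons z l ih =>
    rw [bd, map_sub, map_sub, δ_mapDomain_cons, map_smul, δ_single, δ_single, ih, degAug_bd]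
    simp [bd]

theorem bd_deg (y : Q) (l : List Q) (p : Q × List Q) (h : bd y l p ≠ 0) :
    l.length = deg p + 1 := by
  classical
  induction l generalizing y p with
  | nil => simp [bd] at h
  | cons z l ih =>
    by_contra hne
    refine h ?_
    rw [bd, Finsupp.sub_apply, Finsupp.sub_apply, Finsupp.smul_apply, Finsupp.single_eq_of_ne,
      zero_sub]
    · have h1 : Finsupp.mapDomain (cons y) (bd z l) p = 0 := by
        by_contra h1
        obtain ⟨p', hp', rfl⟩ := Finset.mem_image.1
          (Finsupp.mapDomain_support (Finsupp.mem_support_iff.2 h1))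
        have := ih _ _ (Finsupp.mem_support_iff.1 hp')
        refine hne ?_
        simp only [List.length_cons, this, deg, cons]
      rw [h1]
      split_ifs with hl
      · rw [Finsupp.single_eq_of_ne]
        · simp
        · rintro rfl
          simp [deg, hl] at hne
      · simp
    · rintro rfl
      exact hne rfl

/-- The translation action on simplices. -/
def shift [Mul Q] (g : Q) (p : Q × List Q) : Q × List Q := (g * p.1, p.2.map (g * ·))

theorem bd_shift [Mul Q] (g y : Q) (l : List Q) :
    bd (g * y) (l.map (g * ·)) = Finsupp.mapDomain (shift g) (bd y l) := by
  induction l generalizing y with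
  | nil => simp [bd]
  | cons z l ih =>
    have h1 : ∀ c : Q × List Q →₀ ℤ, Finsupp.mapDomain (cons (g * y)) (Finsupp.mapDomain (shift g) c) =
        Finsupp.mapDomain (shift g) (Finsupp.mapDomain (cons y) c) := fun c => by
      rw [← Finsupp.mapDomain_comp, ← Finsupp.mapDomain_comp]
      rfl
    have h2 : ∀ c : Q × List Q →₀ ℤ, Finsupp.mapDomain (shift g) c =
      Finsupp.lmapDomain ℤ ℤ (shift g) c := fun _ => rfl
    rw [List.map_cons, bd, bd, ih, h1, h2 (_ - _), map_sub, map_sub, map_smul]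
    simp [shift]

end Bar

/-- The bar complex. -/
def barCx (Q : Type) [One Q] : BasedCx (Q × List Q) where
  deg := Bar.deg
  δ := Bar.δ
  h := Finsupp.lmapDomain ℤ ℤ (Bar.cons 1)
  base := (1, [])
  deg_base := rfl
  δ_deg := fun p p' h => by
    rw [Bar.δ_single] at h
    exact Bar.bd_deg _ _ _ h
  h_deg := fun p p' h => by
    rw [Finsupp.lmapDomain_apply, Finsupp.mapDomain_single] at h
    by_cases hp : p' = Bar.cons 1 p
    · subst hp; rfl
    · exact absurd (Finsupp.single_eq_of_ne hp) h
  δ_mul_δ := end_ext fun p => by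
    rw [Module.End.mul_apply, Bar.δ_single, Bar.δ_bd, LinearMap.zero_apply]
  homotopy := LinearMap.ext fun c => by
    simp only [LinearMap.add_apply, Module.End.mul_apply, Finsupp.lmapDomain_apply,
      Bar.δ_mapDomain_cons, LinearMap.sub_apply, Module.End.one_apply, LinearMap.smulRight_apply]
    abel
  aug_δ := end_ext fun p => by
    rw [LinearMap.comp_apply, Bar.δ_single, Bar.degAug_bd, LinearMap.zero_apply]

/-- The translation action on the bar complex. -/
def barTwist {Q I Γ : Type} [Group Q] [Group Γ] (θ : Γ →* Equiv.Perm I) (j : Γ →* Q) :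
    Twist (barCx Q) θ where
  act g _ := Bar.shift (j g)
  act_one x p := by simp [Bar.shift]
  act_mul g h x p := by simp [Bar.shift, mul_assoc]
  deg_act g x p := by simp [barCx, Bar.deg, Bar.shift]
  δ_act g x p := by
    change Bar.δ _ = Finsupp.mapDomain _ (Bar.δ _)
    rw [Bar.δ_single, Bar.δ_single]
    exact Bar.bd_shift _ _ _

theorem barTwist_perm_fst {Q I Γ : Type} [Group Q] [Group Γ] (θ : Γ →* Equiv.Perm I) (j : Γ →* Q)
    (g : Γ) (b : I → Q × List Q) (x : I) (hx : θ g x = x) :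
    ((barTwist θ j).perm g b x).1 = j g * (b x).1 := by
  conv_lhs => rw [← hx]
  rw [Twist.perm_apply_perm]
  rfl

theorem finite_tdeg_barCx {Q I : Type} [One Q] [Finite Q] [Fintype I] [LinearOrder I] (n : ℕ) :
    {b : I → Q × List Q | (barCx Q).tdeg b = n}.Finite := by
  have h1 : {p : Q × List Q | p.2.length ≤ n}.Finite :=
    (Set.finite_univ.prod (List.finite_length_le Q n)).subset fun p hp => ⟨trivial, hp⟩
  refine (Set.Finite.pi fun _ : I => h1).subset fun b hb x _ => ?_
  exact (Finset.single_le_sum (f := fun x => (barCx Q).deg (b x)) (fun _ _ => Nat.zero_le _)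
    (Finset.mem_univ x)).trans hb.le

/-! ### The polygon -/

/-- The cells of a regular `m`-gon. -/
inductive Cell (m : ℕ) : Type
  | vert (j : ZMod m)
  | edge (j : ZMod m)
  | top

namespace Cell

variable {m : ℕ}

/-- The dimension of a cell. -/
def deg : Cell m → ℕ
  | vert _ => 0
  | edge _ => 1
  | top => 2

/-- Rotation of the cells. -/
def shift (κ : ZMod m) : Cell m → Cell m
  | vert j => vert (j + κ)
  | edge j => edge (j + κ)
  | top => top

/-- The edge path from the vertex `0` to the vertex `i`. -/
def path (m : ℕ) (i : ℤ) : Cell m →₀ ℤ :=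
  ∑ k ∈ Finset.Ico 0 i, Finsupp.single (edge (k : ZMod m)) 1 -
    ∑ k ∈ Finset.Ico i 0, Finsupp.single (edge (k : ZMod m)) 1

theorem path_zero : path m 0 = 0 := by simp [path]

theorem path_succ (i : ℤ) : path m (i + 1) = path m i + Finsupp.single (edge (i : ZMod m)) 1 := by
  unfold path
  rcases le_or_gt 0 i with h | h
  · rw [← Finset.insert_Ico_right_eq_Ico_add_one h, Finset.sum_insert (by simp),
      Finset.Ico_eq_empty_of_le h, Finset.Ico_eq_empty_of_le (by omega : (0 : ℤ) ≤ i + 1)]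
    simp [add_comm]
  · rw [← Finset.insert_Ico_add_one_left_eq_Ico (a := i) (b := 0) h, Finset.sum_insert (by simp),
      Finset.Ico_eq_empty_of_le h.le, Finset.Ico_eq_empty_of_le (by omega : i + 1 ≤ (0 : ℤ))]
    simp

theorem eq_of_succ {A : Type} [AddCommGroup A] {F F' : ℤ → A} (h0 : F 0 = F' 0)
    (h : ∀ i, F (i + 1) - F i = F' (i + 1) - F' i) (i : ℤ) : F i = F' i := by
  induction i using Int.induction_on with
  | zero => exact h0
  | succ i ih =>
    have := h i
    rwa [ih, sub_left_inj] at this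
  | pred i ih =>
    have := h (-(i : ℤ) - 1)
    rwa [sub_add_cancel, ih, sub_right_inj] at this

/-- The boundary of a cell. -/
def bd [NeZero m] : Cell m → (Cell m →₀ ℤ)
  | vert _ => 0
  | edge j => Finsupp.single (vert (j + 1)) 1 - Finsupp.single (vert j) 1
  | top => ∑ j, Finsupp.single (edge j) 1

/-- The boundary operator. -/
def δ (m : ℕ) [NeZero m] : Module.End ℤ (Cell m →₀ ℤ) := Finsupp.linearCombination ℤ bd

theorem δ_single [NeZero m] (c : Cell m) : δ m (Finsupp.single c 1) = bd c := by simp [δ]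

theorem δ_path [NeZero m] (i : ℤ) :
    δ m (path m i) = Finsupp.single (vert (i : ZMod m)) 1 - Finsupp.single (vert 0) 1 :=
  eq_of_succ (F := fun i : ℤ => δ m (path m i))
    (F' := fun i : ℤ => Finsupp.single (vert (i : ZMod m)) 1 - Finsupp.single (vert 0) 1)
    (by simp [path_zero]) (fun i => by simp [path_succ, δ_single, bd]) i

theorem path_self [NeZero m] : path m m = bd top := by
  have h : path m m = ∑ k ∈ Finset.Ico (0 : ℤ) m, Finsupp.single (edge (k : ZMod m)) 1 := by
    rw [path, Finset.Ico_eq_empty_of_le (Int.natCast_nonneg m), Finset.sum_empty, sub_zero]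
  rw [h, bd]
  refine Finset.sum_bij' (fun k _ => (k : ZMod m)) (fun j _ => (j.val : ℤ)) (by simp)
    (fun j _ => Finset.mem_Ico.2 ⟨by positivity, by exact_mod_cast ZMod.val_lt j⟩) (fun k hk => ?_) (fun j _ => by simp) (by simp)
  rw [Finset.mem_Ico] at hk
  rw [ZMod.val_intCast, Int.emod_eq_of_lt hk.1 hk.2]

theorem path_add_self [NeZero m] (i : ℤ) : path m (i + m) = path m i + bd top :=
  eq_of_succ (F := fun i => path m (i + m)) (F' := fun i => path m i + bd top)
    (by simp [path_zero, path_self]) (fun i => by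
      have : i + 1 + (m : ℤ) = i + m + 1 := by ring
      simp [this, path_succ]) i

theorem path_add_mul [NeZero m] (i n : ℤ) : path m (i + m * n) = path m i + n • bd top :=
  eq_of_succ (F := fun n => path m (i + m * n)) (F' := fun n : ℤ => path m i + n • bd top)
    (by simp) (fun n => by
      have : i + m * (n + 1) = i + m * n + (m : ℤ) := by ring
      simp [this, path_add_self, add_smul]) n

theorem mapDomain_shift_path (κ i : ℤ) :
    Finsupp.mapDomain (shift (κ : ZMod m)) (path m i) = path m (i + κ) - path m κ :=
  eq_of_succ (F := fun i => Finsupp.lmapDomain ℤ ℤ (shift (κ : ZMod m)) (path m i))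
    (F' := fun i => path m (i + κ) - path m κ) (by simp [path_zero]) (fun i => by
      have : i + 1 + κ = i + κ + 1 := by ring
      simp [this, path_succ, shift, Finsupp.mapDomain_add]) i

theorem path_apply_eq_zero (i : ℤ) (c : Cell m) (hc : c.deg ≠ 1) : path m i c = 0 :=
  eq_of_succ (F := fun i => path m i c) (F' := fun _ => 0) (by simp [path_zero]) (fun i => by
    simp only [path_succ, Finsupp.add_apply]
    rw [Finsupp.single_eq_of_ne]
    · simp
    · rintro rfl
      exact hc rfl) i

theorem degAug_path (i : ℤ) : degAug deg (path m i) = 0 :=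
  eq_of_succ (F := fun i => degAug deg (path m i)) (F' := fun _ => 0) (by simp [path_zero])
    (fun i => by simp [path_succ, degAug_single, deg]) i

/-- The contraction. -/
def contract : Cell m → (Cell m →₀ ℤ)
  | vert j => path m j.val
  | edge j => (if j = -1 then 1 else 0 : ℤ) • Finsupp.single top 1
  | top => 0

/-- The contraction operator. -/
def h (m : ℕ) : Module.End ℤ (Cell m →₀ ℤ) := Finsupp.linearCombination ℤ contract

theorem h_single (c : Cell m) : h m (Finsupp.single c 1) = contract c := by simp [h]

theorem bd_top_add_path [NeZero m] (j : ZMod m) :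
    (if j = -1 then 1 else 0 : ℤ) • bd top + (path m (j + 1).val - path m j.val) =
      Finsupp.single (edge j) 1 := by
  have hj : path m (j.val + 1 : ℤ) = path m j.val + Finsupp.single (edge j) 1 := by
    rw [path_succ]; simp
  by_cases h : j = -1
  · have h1 : (j.val : ℤ) + 1 = m := by
      have : j.val + 1 = m := by
        obtain ⟨n, rfl⟩ := Nat.exists_eq_succ_of_ne_zero (NeZero.ne m)
        rw [h, ZMod.val_neg_one]
      exact_mod_cast this
    rw [h1, path_self] at hj
    rw [if_pos h, hj, h, neg_add_cancel, ZMod.val_zero]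
    simp [path_zero]
  · have h1 : (j + 1).val = j.val + 1 := by
      have h2 := ZMod.val_lt j
      rcases Nat.lt_or_ge (j.val + 1) m with h3 | h3
      · have := ZMod.val_natCast_of_lt h3
        simpa using this
      · exfalso
        refine h (eq_neg_of_add_eq_zero_left ?_)
        have h4 : j.val + 1 = m := by omega
        have := congrArg (Nat.cast (R := ZMod m)) h4
        simpa using this
    rw [if_neg h, h1, Nat.cast_add, Nat.cast_one, hj]
    simp

end Cell

/-- The cellular chain complex of the polygon. -/
def polyCx (m : ℕ) [NeZero m] : BasedCx (Cell m) where
  deg := Cell.deg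
  δ := Cell.δ m
  h := Cell.h m
  base := Cell.vert 0
  deg_base := rfl
  δ_deg c c' h := by
    classical
    rw [Cell.δ_single] at h
    cases c with
    | vert j => simp [Cell.bd] at h
    | edge j =>
      cases c' with
      | vert j => rfl
      | edge j => simp [Cell.bd] at h
      | top => simp [Cell.bd] at h
    | top =>
      cases c' with
      | vert j => simp [Cell.bd] at h
      | edge j => rfl
      | top => simp [Cell.bd] at h
  h_deg c c' h := by
    classical
    rw [Cell.h_single] at h
    cases c with
    | vert j =>
      by_contra h1
      exact h (Cell.path_apply_eq_zero _ _ h1)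
    | edge j =>
      cases c' with
      | vert j =>
        rw [Cell.contract, Finsupp.smul_apply, Finsupp.single_eq_of_ne (by simp)] at h
        simp at h
      | edge j =>
        rw [Cell.contract, Finsupp.smul_apply, Finsupp.single_eq_of_ne (by simp)] at h
        simp at h
      | top => rfl
    | top => simp [Cell.contract] at h
  δ_mul_δ := end_ext fun c => by
    rw [Module.End.mul_apply, Cell.δ_single, LinearMap.zero_apply]
    cases c with
    | vert j => simp [Cell.bd]
    | edge j => simp [Cell.bd, Cell.δ_single]
    | top =>
      rw [← Cell.path_self, Cell.δ_path]
      simp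
  homotopy := end_ext fun c => by
    simp only [LinearMap.add_apply, Module.End.mul_apply, LinearMap.sub_apply,
      Module.End.one_apply, LinearMap.smulRight_apply, degAug_single, Cell.h_single,
      Cell.δ_single]
    cases c with
    | vert j =>
      rw [Cell.contract, Cell.δ_path]
      simp [Cell.bd, Cell.deg]
    | edge j =>
      rw [Cell.contract, map_smul, Cell.δ_single]
      refine Eq.trans ?_ ((Cell.bd_top_add_path j).trans ?_)
      · rw [Cell.bd, map_sub, Cell.h_single, Cell.h_single]
        rfl
      · simp [Cell.deg]
    | top =>
      rw [Cell.contract, Cell.bd, map_sum]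
      simp only [Cell.h_single, Cell.contract]
      rw [← Finset.sum_smul]
      simp [Cell.deg]
  aug_δ := end_ext fun c => by
    rw [LinearMap.comp_apply, Cell.δ_single, LinearMap.zero_apply]
    cases c with
    | vert j => simp [Cell.bd]
    | edge j => simp [Cell.bd, degAug_single, Cell.deg]
    | top => rw [← Cell.path_self, Cell.degAug_path]

/-- A family of one-cochains, indexed by `X` and compatible with the action of `Q` on `X`, which
are cocycles modulo `m`. -/
structure ModCocycle {Q X : Type} [Group Q] (m : ℕ) (θ : Q →* Equiv.Perm X) where
  V : X → Q → Q → ℤ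
  V_mul : ∀ q x y z, V (θ q x) (q * y) (q * z) = V x y z
  cocycle : ∀ x y z w, (m : ℤ) ∣ V x y z + V x z w - V x y w

/-- The functional on the bar complex given by a two-cochain. -/
def barFun {Q : Type} (U : Q → Q → Q → ℤ) : (Q × List Q →₀ ℤ) →ₗ[ℤ] ℤ :=
  Finsupp.linearCombination ℤ fun p =>
    match p.2 with
    | [z, w] => U p.1 z w
    | _ => 0

/-- The functional on the polygon dual to the two-cell. -/
def topFun (m : ℕ) : (Cell m →₀ ℤ) →ₗ[ℤ] ℤ := Finsupp.lapply Cell.top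

theorem topFun_comp_δ (m : ℕ) [NeZero m] : topFun m ∘ₗ (polyCx m).δ = 0 := end_ext fun c => by
  change Cell.δ m _ Cell.top = 0
  rw [Cell.δ_single]
  cases c with
  | vert j => simp [Cell.bd]
  | edge j => simp [Cell.bd]
  | top => rw [← Cell.path_self]; exact Cell.path_apply_eq_zero _ _ (by simp [Cell.deg])

namespace ModCocycle

variable {Q X : Type} [Group Q] {m : ℕ} [NeZero m] {θ : Q →* Equiv.Perm X} (v : ModCocycle m θ)

/-- The Bockstein of a cocycle modulo `m`. -/
def U (x : X) (y z w : Q) : ℤ := (v.V x y z + v.V x z w - v.V x y w) / m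

theorem mul_U (x : X) (y z w : Q) : (m : ℤ) * v.U x y z w = v.V x y z + v.V x z w - v.V x y w :=
  Int.mul_ediv_cancel' (v.cocycle x y z w)

theorem m_ne_zero (_ : ModCocycle m θ) : (m : ℤ) ≠ 0 := by exact_mod_cast NeZero.ne m

theorem U_mul (q : Q) (x : X) (y z w : Q) :
    v.U (θ q x) (q * y) (q * z) (q * w) = v.U x y z w := by
  simp only [U, v.V_mul]

theorem U_cocycle (x : X) (y z w t : Q) :
    v.U x z w t - v.U x y w t + v.U x y z t - v.U x y z w = 0 := by
  refine (mul_eq_zero.1 ?_).resolve_left v.m_ne_zero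
  rw [mul_sub, mul_add, mul_sub, mul_U, mul_U, mul_U, mul_U]
  ring

/-- The rotation by which `q` acts at `x`. -/
def rot (q : Q) (x : X) : ℤ := v.V (θ q x) 1 q

theorem V_one_mul (q : Q) (x : X) (y : Q) :
    v.V (θ q x) 1 (q * y) = v.rot q x + v.V x 1 y + m * -v.U (θ q x) 1 q (q * y) := by
  have h : v.V (θ q x) q (q * y) = v.V x 1 y := by
    rw [← v.V_mul q x 1 y, mul_one]
  rw [mul_neg, mul_U, h, rot]
  ring

theorem rot_mul (g h : Q) (x : X) :
    ((v.rot (g * h) x : ℤ) : ZMod m) = v.rot h x + v.rot g (θ h x) := by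
  have := v.V_one_mul g (θ h x) h
  rw [← Equiv.Perm.mul_apply, ← map_mul] at this
  rw [rot, this]
  push_cast
  rw [ZMod.natCast_self, zero_mul, add_zero, add_comm]
  rfl

theorem rot_one (x : X) : ((v.rot 1 x : ℤ) : ZMod m) = 0 := by
  have := v.rot_mul 1 1 x
  simpa using this

/-- The rotation action on the polygons. -/
def twist : Twist (polyCx m) θ where
  act g x := Cell.shift (v.rot g x : ZMod m)
  act_one x c := by
    rw [v.rot_one]
    cases c <;> simp [Cell.shift]
  act_mul g h x c := by
    rw [v.rot_mul]
    cases c <;> simp [Cell.shift, add_assoc]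
  deg_act g x c := by cases c <;> rfl
  δ_act g x c := by
    change Cell.δ m _ = Finsupp.mapDomain _ (Cell.δ m _)
    rw [Cell.δ_single, Cell.δ_single, ← Finsupp.lmapDomain_apply ℤ ℤ]
    cases c with
    | vert j => simp [Cell.shift, Cell.bd]
    | edge j => simp [Cell.shift, Cell.bd, add_right_comm, Finsupp.mapDomain_sub]
    | top =>
      simp only [Cell.shift, Cell.bd, map_sum, Finsupp.lmapDomain_apply, Finsupp.mapDomain_single]
      exact (Equiv.sum_comp (Equiv.addRight (v.rot g x : ZMod m))
        fun j => Finsupp.single (Cell.edge j) (1 : ℤ)).symm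

/-- The image of a simplex in the polygon. -/
def image (x : X) (y : Q) : List Q → (Cell m →₀ ℤ)
  | [] => Finsupp.single (Cell.vert (v.V x 1 y : ZMod m)) 1
  | [z] => Cell.path m (v.V x 1 y + v.V x y z) - Cell.path m (v.V x 1 y)
  | [z, w] => v.U x y z w • Finsupp.single Cell.top 1
  | _ => 0

/-- The classifying map. -/
def toPoly (x : X) : (Q × List Q →₀ ℤ) →ₗ[ℤ] (Cell m →₀ ℤ) :=
  Finsupp.linearCombination ℤ fun p => v.image x p.1 p.2

theorem toPoly_single (x : X) (p : Q × List Q) :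
    v.toPoly x (Finsupp.single p 1) = v.image x p.1 p.2 := by simp [toPoly]

theorem image_of_three_le (x : X) (y : Q) (l : List Q) (h : 3 ≤ l.length) : v.image x y l = 0 := by
  match l, h with
  | _ :: _ :: _ :: _, _ => rfl

theorem degAug_image (x : X) (y : Q) (l : List Q) :
    degAug Cell.deg (v.image x y l) = if l.length = 0 then 1 else 0 := by
  match l with
  | [] => simp [image, degAug_single, Cell.deg]
  | [z] => simp [image, Cell.degAug_path]
  | [z, w] =>
    rw [image, map_smul, degAug_single]
    simp [Cell.deg]
  | _ :: _ :: _ :: _ => simp [image]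

theorem image_deg (x : X) (y : Q) (l : List Q) (c : Cell m) (h : v.image x y l c ≠ 0) :
    c.deg = l.length := by
  match l with
  | [] =>
    by_contra hne
    refine h (Finsupp.single_eq_of_ne ?_)
    rintro rfl
    exact hne rfl
  | [z] =>
    by_contra hne
    refine h ?_
    rw [image, Finsupp.sub_apply, Cell.path_apply_eq_zero _ _ hne,
      Cell.path_apply_eq_zero _ _ hne, sub_zero]
  | [z, w] =>
    by_contra hne
    refine h ?_
    rw [image, Finsupp.smul_apply, Finsupp.single_eq_of_ne, smul_zero]
    rintro rfl
    exact hne rfl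
  | _ :: _ :: _ :: _ => exact absurd rfl h

theorem V_add (x : X) (y z w : Q) : v.V x y z + v.V x z w = v.V x y w + m * v.U x y z w := by
  rw [mul_U]; ring

theorem path_image (x : X) (y z w : Q) :
    Cell.path m (v.V x 1 z + v.V x z w) - Cell.path m (v.V x 1 z) -
      (Cell.path m (v.V x 1 y + v.V x y w) - Cell.path m (v.V x 1 y)) +
      (Cell.path m (v.V x 1 y + v.V x y z) - Cell.path m (v.V x 1 y)) =
      v.U x y z w • Cell.bd Cell.top := by
  have h1 : v.V x 1 z = v.V x 1 y + v.V x y z + m * -v.U x 1 y z := by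
    rw [mul_neg, mul_U]; ring
  have h2 : v.V x 1 z + v.V x z w =
      v.V x 1 y + v.V x y w + m * (v.U x y z w - v.U x 1 y z) := by
    rw [mul_sub, mul_U, mul_U]; ring
  rw [h2, h1, Cell.path_add_mul, Cell.path_add_mul, sub_smul, neg_smul]
  abel

theorem δ_image (x : X) (y : Q) (l : List Q) :
    Cell.δ m (v.image x y l) = v.toPoly x (Bar.bd y l) := by
  match l with
  | [] => simp [image, Bar.bd, Cell.δ_single, Cell.bd]
  | [z] =>
    rw [image, map_sub, Cell.δ_path, Cell.δ_path, v.V_add]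
    simp [Bar.bd, toPoly_single, image]
  | [z, w] =>
    have h : Bar.bd y [z, w] = Finsupp.single (z, [w]) 1 - Finsupp.single (y, [w]) 1 +
        Finsupp.single (y, [z]) 1 := by
      simp [Bar.bd, Bar.cons, Finsupp.mapDomain_sub]
      abel
    rw [h, map_add, map_sub, toPoly_single, toPoly_single, toPoly_single]
    refine Eq.trans (b := v.U x y z w • Cell.bd Cell.top) ?_ ?_
    · rw [image, map_smul, Cell.δ_single]
    exact (v.path_image x y z w).symm
  | [z, w, t] =>
    have h : Bar.bd y [z, w, t] = Finsupp.single (z, [w, t]) 1 - Finsupp.single (y, [w, t]) 1 +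
        Finsupp.single (y, [z, t]) 1 - Finsupp.single (y, [z, w]) 1 := by
      simp [Bar.bd, Bar.cons, Finsupp.mapDomain_sub]
      abel
    rw [h, map_sub, map_add, map_sub, toPoly_single, toPoly_single, toPoly_single, toPoly_single]
    simp only [image]
    rw [map_zero, ← sub_smul, ← add_smul, ← sub_smul, v.U_cocycle, zero_smul]
  | z :: w :: t :: r :: l =>
    rw [image_of_three_le _ _ _ _ (by simp), map_zero, toPoly,
      Finsupp.linearCombination_apply, Finsupp.sum]
    refine (Finset.sum_eq_zero fun p hp => ?_).symm
    have := Bar.bd_deg _ _ _ (Finsupp.mem_support_iff.1 hp)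
    rw [image_of_three_le, smul_zero]
    simp only [List.length_cons, Bar.deg] at this
    omega

/-- The classifying maps, as a family of chain maps. -/
def fam : CxFam (barCx Q) (polyCx m) X where
  map := v.toPoly
  deg_map x p c h := by
    rw [toPoly_single] at h
    exact v.image_deg _ _ _ _ h
  δ_map x := end_ext fun p => by
    change Cell.δ m (v.toPoly x _) = v.toPoly x (Bar.δ _)
    rw [toPoly_single, Bar.δ_single, δ_image]
  aug_map x := end_ext fun p => by
    rw [LinearMap.comp_apply, toPoly_single]
    exact (v.degAug_image _ _ _).trans (degAug_single Bar.deg p).symm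

theorem topFun_comp_toPoly (x : X) : topFun m ∘ₗ v.toPoly x = barFun (v.U x) := by
  classical
  refine end_ext fun p => ?_
  obtain ⟨y, l⟩ := p
  rw [LinearMap.comp_apply, toPoly_single, barFun, Finsupp.linearCombination_single, one_smul]
  change v.image x y l Cell.top = _
  match l with
  | [] => simp [image]
  | [z] =>
    rw [image, Finsupp.sub_apply, Cell.path_apply_eq_zero _ _ (by simp [Cell.deg]),
      Cell.path_apply_eq_zero _ _ (by simp [Cell.deg])]
    rfl
  | [z, w] => simp [image]
  | _ :: _ :: _ :: _ => simp [image]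

theorem toPoly_shift (q : Q) (x : X) (p : Q × List Q) :
    v.toPoly (θ q x) (Finsupp.single (Bar.shift q p) 1) =
      Finsupp.mapDomain (v.twist.act q x) (v.toPoly x (Finsupp.single p 1)) := by
  obtain ⟨y, l⟩ := p
  rw [toPoly_single, toPoly_single]
  change v.image (θ q x) (q * y) (l.map (q * ·)) =
    Finsupp.lmapDomain ℤ ℤ (Cell.shift (v.rot q x : ZMod m)) (v.image x y l)
  match l with
  | [] =>
    simp only [List.map_nil, image, Finsupp.lmapDomain_apply, Finsupp.mapDomain_single,
      Cell.shift, v.V_one_mul]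
    push_cast
    rw [ZMod.natCast_self, zero_mul, add_zero, add_comm]
  | [z] =>
    simp only [List.map_cons, List.map_nil, image, map_sub, Finsupp.lmapDomain_apply,
      Cell.mapDomain_shift_path, v.V_one_mul, v.V_mul]
    rw [add_right_comm, Cell.path_add_mul, Cell.path_add_mul]
    rw [add_comm (v.rot q x), add_right_comm]
    abel
  | [z, w] =>
    simp only [List.map_cons, List.map_nil, image, map_smul, Finsupp.lmapDomain_apply,
      Finsupp.mapDomain_single, Cell.shift, v.U_mul]
  | _ :: _ :: _ :: _ => simp [image]

end ModCocycle

namespace Twist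

variable (k : Type) [Ring k] {G : Type} [Group G] (M : Type) [AddCommGroup M] [Module k[G] M]
  {Q Y I : Type} [Group Q] {𝒞 : BasedCx Y} {θ : Q →* Equiv.Perm I} [Fintype I] [LinearOrder I]
  (a : Twist 𝒞 θ) (π : G →* Q)

/-- Cochains of degree `n` with values in `M`. -/
def cochains (n : ℕ) : Submodule k[G] (HomMod (a.rep.comp π) M) :=
  HomMod.fixed k M (𝒞.pr n) fun g => a.pr_mul_rep n (π g)

/-- The coboundary on cochains with values in `M`. -/
def coboundary : HomMod (a.rep.comp π) M →ₗ[k[G]] HomMod (a.rep.comp π) M :=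
  HomMod.precomp k M 𝒞.d fun g => (a.rep_mul_d (π g)).symm

variable {k M a π}

theorem mem_cochains {n : ℕ} {F : HomMod (a.rep.comp π) M} :
    F ∈ a.cochains k M π n ↔ HomMod.lin F ∘ₗ 𝒞.pr n = HomMod.lin F := Iff.rfl

theorem lin_coboundary (F : HomMod (a.rep.comp π) M) :
    HomMod.lin (a.coboundary k M π F) = HomMod.lin F ∘ₗ 𝒞.d := rfl

theorem coboundary_mem {n : ℕ} {F : HomMod (a.rep.comp π) M} (hF : F ∈ a.cochains k M π n) :
    a.coboundary k M π F ∈ a.cochains k M π (n + 1) := by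
  rw [mem_cochains] at hF ⊢
  rw [lin_coboundary, LinearMap.comp_assoc]
  conv_rhs => rw [← hF]
  exact congrArg (HomMod.lin F ∘ₗ ·) (𝒞.pr_mul_d n).symm

theorem coboundary_coboundary (F : HomMod (a.rep.comp π) M) :
    a.coboundary k M π (a.coboundary k M π F) = 0 := by
  refine HomMod.lin.injective ?_
  rw [lin_coboundary, lin_coboundary, LinearMap.comp_assoc, map_zero]
  have h : 𝒞.d (I := I) ∘ₗ 𝒞.d = 0 := 𝒞.d_mul_d
  rw [h, LinearMap.comp_zero]

theorem aug_comp_pr_succ (𝒞 : BasedCx Y) (n : ℕ) : 𝒞.aug I ∘ₗ 𝒞.pr (n + 1) = 0 :=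
  end_ext fun b => by
    rw [LinearMap.comp_apply, BasedCx.pr, diag_single]
    split_ifs with h
    · rw [𝒞.aug_single, if_neg (by omega)]; rfl
    · simp

theorem coboundary_exact {n : ℕ} {F : HomMod (a.rep.comp π) M}
    (hF : F ∈ a.cochains k M π (n + 1)) (hd : a.coboundary k M π F = 0) :
    ∃ F' ∈ a.cochains k M π n, a.coboundary k M π F' = F := by
  obtain ⟨s, hs, hpr, -⟩ := 𝒞.exists_contraction (I := I)
  rw [mem_cochains] at hF
  have hd' : HomMod.lin F ∘ₗ 𝒞.d = 0 := by rw [← lin_coboundary (k := k), hd, map_zero]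
  refine ⟨HomMod.lin.symm (HomMod.lin F ∘ₗ s), ?_, HomMod.lin.injective ?_⟩
  · rw [mem_cochains, AddEquiv.apply_symm_apply, LinearMap.comp_assoc]
    conv_rhs => rw [← hF]
    exact congrArg (HomMod.lin F ∘ₗ ·) (hpr n).symm
  · rw [lin_coboundary, AddEquiv.apply_symm_apply]
    refine LinearMap.ext fun c => ?_
    have h1 := LinearMap.congr_fun hs (𝒞.pr (n + 1) c)
    have h2 := congrArg (HomMod.lin F) h1
    have h3 : ∀ c, HomMod.lin F (𝒞.d c) = 0 := fun c => LinearMap.congr_fun hd' c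
    have h4 : 𝒞.aug I (𝒞.pr (n + 1) c) = 0 := LinearMap.congr_fun (aug_comp_pr_succ 𝒞 n) c
    have h5 : ∀ c, HomMod.lin F (𝒞.pr (n + 1) c) = HomMod.lin F c :=
      fun c => LinearMap.congr_fun hF c
    simp only [LinearMap.add_apply, Module.End.mul_apply, LinearMap.sub_apply,
      Module.End.one_apply, LinearMap.smulRight_apply, h4, zero_smul, sub_zero, map_add, h3,
      zero_add, h5] at h2
    refine Eq.trans ?_ h2
    change HomMod.lin F (s (𝒞.d c)) = _
    rw [← h5]
    have e1 := LinearMap.congr_fun (hpr n) (𝒞.d c)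
    have e2 := LinearMap.congr_fun (𝒞.pr_mul_d (I := I) n) c
    simp only [Module.End.mul_apply] at e1 e2
    rw [e1, e2]

theorem eq_aug_of_coboundary_eq_zero {F : HomMod (a.rep.comp π) M}
    (hF : F ∈ a.cochains k M π 0) (hd : a.coboundary k M π F = 0) (c : (I → Y) →₀ ℤ) :
    HomMod.lin F c = 𝒞.aug I c • HomMod.lin F (Finsupp.single (fun _ => 𝒞.base) 1) := by
  obtain ⟨s, hs, -, hpr⟩ := 𝒞.exists_contraction (I := I)
  rw [mem_cochains] at hF
  have hd' : HomMod.lin F ∘ₗ 𝒞.d = 0 := by rw [← lin_coboundary (k := k), hd, map_zero]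
  have h2 := congrArg (HomMod.lin F) (LinearMap.congr_fun hs (𝒞.pr 0 c))
  have h3 : ∀ c, HomMod.lin F (𝒞.d c) = 0 := fun c => LinearMap.congr_fun hd' c
  have h5 : ∀ c, HomMod.lin F (𝒞.pr 0 c) = HomMod.lin F c := fun c => LinearMap.congr_fun hF c
  have h6 : 𝒞.d (𝒞.pr 0 c) = 0 := LinearMap.congr_fun (𝒞.d_mul_pr_zero (I := I)) c
  have h7 : 𝒞.aug I (𝒞.pr 0 c) = 𝒞.aug I c := by
    have : 𝒞.aug I ∘ₗ 𝒞.pr 0 = 𝒞.aug I := end_ext fun b => by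
      rw [LinearMap.comp_apply, BasedCx.pr, diag_single]
      split_ifs with h
      · rfl
      · rw [𝒞.aug_single, if_neg h]; simp
    exact LinearMap.congr_fun this c
  simp only [LinearMap.add_apply, Module.End.mul_apply, LinearMap.sub_apply,
    Module.End.one_apply, LinearMap.smulRight_apply, h6, map_zero, add_zero, h3, map_sub, h5, h7,
    map_smul] at h2
  exact sub_eq_zero.1 h2.symm

theorem aug_mem_cochains (m : M) :
    HomMod.ofFunctional (k := k) (a.rep.comp π) (𝒞.aug I) (fun g => a.aug_comp_rep (π g)) m ∈
      a.cochains k M π 0 := by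
  rw [mem_cochains]
  refine end_ext fun b => ?_
  rw [LinearMap.comp_apply, BasedCx.pr, diag_single]
  split_ifs with h
  · rfl
  · rw [HomMod.lin_ofFunctional, HomMod.lin_ofFunctional, 𝒞.aug_single, if_neg h]; simp

theorem cochains_cds {f : ℕ → NNReal} (hf : IsProperComplexityFunction f)
    (hM : ∀ S : Subgroup Q, S ≠ ⊤ → SubCds k M f (S.comap π)) (n : ℕ)
    (hfin : {b : I → Y | 𝒞.tdeg b = n}.Finite)
    (hmove : ∀ b : I → Y, 𝒞.tdeg b = n → ∃ q, a.perm q b ≠ b) :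
    Cds k[G] f (a.cochains k M π n) := by
  classical
  have : Finite {b : I → Y | 𝒞.tdeg b = n} := hfin
  refine Cds.signed (τ := a.perm) (ε := a.sign) hf π hM (fun q q' b => a.sign_mul q q' b) a.rep
    (fun q b => a.rep_single q b) {b : I → Y | 𝒞.tdeg b = n} (fun q b hb => ?_) hmove _
    (fun b => ?_) _
  · exact (a.tdeg_perm q b).trans hb
  · by_cases h : 𝒞.tdeg b = n <;> simp [h]

end Twist

/-- The action on `X` with a fixed point added. -/
def botPerm {Γ X : Type} [Group Γ] (θ : Γ →* Equiv.Perm X) : Γ →* Equiv.Perm (WithBot X) where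
  toFun g := Equiv.optionCongr (θ g)
  map_one' := by rw [map_one]; exact Equiv.optionCongr_refl
  map_mul' g h := by rw [map_mul]; exact Equiv.optionCongr_trans (θ h) (θ g)

namespace Cell

theorem deg_le_two {m : ℕ} (c : Cell m) : c.deg ≤ 2 := by cases c <;> simp [deg]

theorem eq_top_of_deg {m : ℕ} {c : Cell m} (h : c.deg = 2) : c = top := by
  cases c <;> simp_all [deg]

theorem eq_top_of_shift {m : ℕ} {r : ZMod m} (hr : r ≠ 0) {c : Cell m} (h : shift r c = c) :
    c = top := by
  cases c <;> simp_all [shift]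

end Cell

section
variable {m : ℕ} [NeZero m] {X : Type} [Fintype X]

theorem tdeg_polyCx_le (b : X → Cell m) : (polyCx m).tdeg b ≤ 2 * Fintype.card X := by
  refine (Finset.sum_le_card_nsmul _ _ 2 fun x _ => (b x).deg_le_two).trans ?_
  simp [mul_comm]

theorem eq_top_of_tdeg_polyCx {b : X → Cell m} (h : (polyCx m).tdeg b = 2 * Fintype.card X) :
    b = fun _ => Cell.top := by
  funext x
  refine Cell.eq_top_of_deg ?_
  have h1 : ∑ x, (b x).deg = ∑ _x : X, 2 := by
    rw [Finset.sum_const, Finset.card_univ, smul_eq_mul, mul_comm]; exact h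
  exact (Finset.sum_eq_sum_iff_of_le fun x _ => (b x).deg_le_two).1 h1 x (Finset.mem_univ x)

theorem tdeg_polyCx_top : (polyCx m).tdeg (fun _ : X => (Cell.top : Cell m)) = 2 * Fintype.card X := by
  change ∑ _x : X, 2 = _
  simp [mul_comm]

instance : Finite (Cell m) := by
  refine Finite.of_injective (β := ZMod m ⊕ ZMod m ⊕ Unit)
    (fun c => match c with
      | .vert j => .inl j
      | .edge j => .inr (.inl j)
      | .top => .inr (.inr ())) ?_
  intro c c' h
  cases c <;> cases c' <;> simp_all

end

theorem ModCocycle.exists_perm_ne {Q X : Type} [Group Q] {m : ℕ} [NeZero m]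
    {θ : Q →* Equiv.Perm X} [Fintype X] (v : ModCocycle m θ) (htrans : ∀ x y, ∃ q, θ q x = y)
    (hrot : ∃ x q, θ q x = x ∧ ¬ (m : ℤ) ∣ v.rot q x) (b : X → Cell m)
    (hb : (polyCx m).tdeg b ≠ 2 * Fintype.card X) : ∃ q, v.twist.perm q b ≠ b := by
  by_contra! h
  have key : ∀ q x, b (θ q x) = Cell.shift (v.rot q x : ZMod m) (b x) := fun q x => by
    conv_lhs => rw [← h q]
    exact v.twist.perm_apply_perm q b x
  obtain ⟨x, q, hq, hr⟩ := hrot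
  have hx : b x = Cell.top := by
    refine Cell.eq_top_of_shift (r := (v.rot q x : ZMod m)) ?_ ?_
    · rwa [Ne, ZMod.intCast_zmod_eq_zero_iff_dvd]
    · rw [← key, hq]
  refine hb ?_
  have : b = fun _ => Cell.top := by
    funext y
    obtain ⟨g, rfl⟩ := htrans x y
    rw [key, hx]
    rfl
  rw [this, tdeg_polyCx_top]

/-- The functional on a product of bar complexes with one additional factor which is the product of
the given two-cochains. -/
def barProd {Q X : Type} [Fintype X] (U : X → Q → Q → Q → ℤ) :
    ((WithBot X → Q × List Q) →₀ ℤ) →ₗ[ℤ] ℤ :=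
  tfun fun z : WithBot X =>
    z.recBotCoe (C := fun _ => (Q × List Q →₀ ℤ) →ₗ[ℤ] ℤ) (degAug Bar.deg) fun x => barFun (U x)

namespace ModCocycle

variable {Q X : Type} [Group Q] {m : ℕ} [NeZero m] {θ : Q →* Equiv.Perm X} [Fintype X]
  [LinearOrder X] (v : ModCocycle m θ)

/-- The functional dual to the top cell of a product of polygons. -/
def topProd (m : ℕ) (X : Type) [Fintype X] : ((X → Cell m) →₀ ℤ) →ₗ[ℤ] ℤ := tfun fun _ => topFun m

theorem topProd_single (b : X → Cell m) :
    topProd m X (Finsupp.single b 1) = ∏ x, topFun m (Finsupp.single (b x) 1) := tfun_single _ _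

theorem topFun_single_top (m : ℕ) : topFun m (Finsupp.single Cell.top 1) = 1 :=
  Finsupp.single_eq_same

theorem topFun_single_of_ne {m : ℕ} {c : Cell m} (h : c ≠ Cell.top) :
    topFun m (Finsupp.single c 1) = 0 := Finsupp.single_eq_of_ne h.symm

theorem topProd_comp_rep (q : Q) : topProd m X ∘ₗ v.twist.rep q = topProd m X := by
  refine v.twist.tfun_comp_rep q _ _ (fun x c h => ?_) fun x c => ?_
  · have : c = Cell.top := by
      by_contra hc
      exact h (topFun_single_of_ne hc)
    subst this
    exact ⟨1, rfl⟩
  · change topFun m (Finsupp.single (Cell.shift _ c) 1) = _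
    cases c with
    | top => rfl
    | vert j => rw [topFun_single_of_ne, topFun_single_of_ne] <;> simp [Cell.shift]
    | edge j => rw [topFun_single_of_ne, topFun_single_of_ne] <;> simp [Cell.shift]

/-- The comparison from a product of bar complexes to a product of polygons. -/
def compare : ((WithBot X → Q × List Q) →₀ ℤ) →ₗ[ℤ] ((X → Cell m) →₀ ℤ) :=
  tmap v.fam.map ∘ₗ forgetBot (barCx Q)

theorem topProd_comp_compare : topProd m X ∘ₗ v.compare = barProd v.U := by
  rw [compare, ← LinearMap.comp_assoc, topProd, tfun_comp_tmap, tfun_comp_forgetBot]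
  have h : (fun x => topFun m ∘ₗ v.fam.map x) = fun x => barFun (v.U x) :=
    funext fun x => v.topFun_comp_toPoly x
  rw [h]
  rfl

theorem compare_comp_d : v.compare ∘ₗ (barCx Q).d = (polyCx m).d ∘ₗ v.compare := by
  rw [compare, LinearMap.comp_assoc, forgetBot_comp_d, ← LinearMap.comp_assoc,
    ← v.fam.d_comp_tmap, LinearMap.comp_assoc]

theorem pr_comp_compare (n : ℕ) : (polyCx m).pr n ∘ₗ v.compare = v.compare ∘ₗ (barCx Q).pr n := by
  rw [compare, LinearMap.comp_assoc, ← pr_comp_forgetBot, ← LinearMap.comp_assoc,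
    v.fam.pr_comp_tmap, LinearMap.comp_assoc]

theorem aug_comp_compare : (polyCx m).aug X ∘ₗ v.compare = (barCx Q).aug (WithBot X) := by
  rw [compare, ← LinearMap.comp_assoc, v.fam.aug_comp_tmap, aug_comp_forgetBot]

theorem compare_comp_rep (q : Q) :
    v.compare ∘ₗ (barTwist (botPerm θ) (MonoidHom.id Q)).rep q = v.twist.rep q ∘ₗ v.compare := by
  have h1 := rep_comp_forgetBot (barCx Q) (barTwist θ (MonoidHom.id Q))
    (barTwist (botPerm θ) (MonoidHom.id Q)) q rfl (fun _ => rfl) fun _ _ => rfl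
  have h2 := v.fam.rep_comp_tmap (barTwist θ (MonoidHom.id Q)) v.twist q
    fun x p => v.toPoly_shift q x p
  rw [compare, LinearMap.comp_assoc, ← h1, ← LinearMap.comp_assoc, ← h2, LinearMap.comp_assoc]

end ModCocycle

section
variable {k : Type} [Ring k] {G : Type} [Group G] {M : Type} [AddCommGroup M] [Module k[G] M]
  {Q X : Type} [Group Q] {m : ℕ} [NeZero m] {θ : Q →* Equiv.Perm X} [Fintype X] [LinearOrder X]

theorem ModCocycle.topProd_single_of_tdeg_ne {b : X → Cell m}
    (hb : (polyCx m).tdeg b ≠ 2 * Fintype.card X) :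
    ModCocycle.topProd m X (Finsupp.single b 1) = 0 := by
  by_contra hne
  rw [ModCocycle.topProd_single, ← ne_eq, Finset.prod_ne_zero_iff] at hne
  refine hb ?_
  have hb : b = fun _ => Cell.top := by
    funext x
    by_contra hx
    exact hne x (Finset.mem_univ x) (ModCocycle.topFun_single_of_ne hx)
  rw [hb, tdeg_polyCx_top]

/-- The top cochains on a product of polygons with coefficients in `M` are a copy of `M`. -/
def ModCocycle.topEquiv (v : ModCocycle m θ) (π : G →* Q) :
    M ≃ₗ[k[G]] v.twist.cochains k M π (2 * Fintype.card X) :=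
  LinearEquiv.ofBijective
    (LinearMap.codRestrict _
      (HomMod.ofFunctional (v.twist.rep.comp π) (ModCocycle.topProd m X)
        fun g => v.topProd_comp_rep (π g)) fun a => by
          rw [Twist.mem_cochains]
          refine end_ext fun b => ?_
          rw [LinearMap.comp_apply, BasedCx.pr, diag_single]
          split_ifs with h
          · rfl
          · rw [HomMod.lin_ofFunctional, HomMod.lin_ofFunctional]
            rw [ModCocycle.topProd_single_of_tdeg_ne h]
            simp) (by
    have h1 : ModCocycle.topProd m X (Finsupp.single (fun _ => Cell.top) 1) = 1 := by
      rw [ModCocycle.topProd_single]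
      exact Finset.prod_eq_one fun _ _ => ModCocycle.topFun_single_top m
    constructor
    · intro a a' h
      have h2 := congrArg (fun F => HomMod.lin (Subtype.val F)
        (Finsupp.single (fun _ => Cell.top) 1)) h
      change ModCocycle.topProd m X _ • a = ModCocycle.topProd m X _ • a' at h2
      rwa [h1, one_smul, one_smul] at h2
    · rintro ⟨F, hF⟩
      refine ⟨HomMod.lin F (Finsupp.single (fun _ => Cell.top) 1), Subtype.ext ?_⟩
      refine HomMod.lin.injective (end_ext fun b => ?_)
      change ModCocycle.topProd m X _ • HomMod.lin F _ = HomMod.lin F _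
      by_cases hb : (polyCx m).tdeg b = 2 * Fintype.card X
      · rw [eq_top_of_tdeg_polyCx hb, h1, one_smul]
      · rw [ModCocycle.topProd_single_of_tdeg_ne hb, zero_smul]
        rw [Twist.mem_cochains] at hF
        rw [← hF, LinearMap.comp_apply, BasedCx.pr, diag_single, if_neg hb]
        simp)

theorem ModCocycle.lin_topEquiv (v : ModCocycle m θ) (π : G →* Q) (a : M)
    (c : (X → Cell m) →₀ ℤ) :
    HomMod.lin ((v.topEquiv (k := k) π a : v.twist.cochains k M π (2 * Fintype.card X)) :
      HomMod (v.twist.rep.comp π) M) c = ModCocycle.topProd m X c • a := rfl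

theorem Cds.of_modCocycle [Finite Q] {f : ℕ → NNReal} (hf : IsProperComplexityFunction f)
    (π : G →* Q) (hM : ∀ S : Subgroup Q, S ≠ ⊤ → SubCds k M f (S.comap π))
    (v : ModCocycle m θ) (htrans : ∀ x y, ∃ q, θ q x = y)
    (hrot : ∃ x q, θ q x = x ∧ ¬ (m : ℤ) ∣ v.rot q x)
    {B : Type} [AddCommGroup B] [Module k[G] B] (hB : Cds k[G] f B) (α : M →ₗ[k[G]] B)
    (β : B →ₗ[k[G]] HomMod ((barTwist (botPerm θ) (MonoidHom.id Q)).rep.comp π) M)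
    (hβ : ∀ b, β b ∈ (barTwist (botPerm θ) (MonoidHom.id Q)).cochains k M π (2 * Fintype.card X))
    (hβd : ∀ b, (barTwist (botPerm θ) (MonoidHom.id Q)).coboundary k M π (β b) = 0)
    (hαβ : ∀ a c, HomMod.lin (β (α a)) c = barProd v.U c • a) : Cds k[G] f M := by
  obtain ⟨x₀, q₀, hq₀, hr₀⟩ := id hrot
  have hq1 : q₀ ≠ 1 := by
    rintro rfl
    exact hr₀ ((ZMod.intCast_zmod_eq_zero_iff_dvd _ _).1 (v.rot_one x₀))
  obtain ⟨n, hn⟩ : ∃ n, 2 * Fintype.card X = n + 1 :=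
    ⟨2 * Fintype.card X - 1, by have := Fintype.card_pos_iff.2 ⟨x₀⟩; omega⟩
  obtain ⟨e, he⟩ : ∃ e : M ≃ₗ[k[G]] v.twist.cochains k M π (n + 1), ∀ a c,
      HomMod.lin ((e a : v.twist.cochains k M π (n + 1)) : HomMod (v.twist.rep.comp π) M) c =
        ModCocycle.topProd m X c • a := hn ▸ ⟨v.topEquiv π, v.lin_topEquiv π⟩
  rw [hn] at hβ
  refine Cds.congr ?_ e.symm
  let Φ : HomMod (v.twist.rep.comp π) M →ₗ[k[G]]
      HomMod ((barTwist (botPerm θ) (MonoidHom.id Q)).rep.comp π) M :=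
    HomMod.precomp k M v.compare fun g => v.compare_comp_rep (π g)
  have hΦ : ∀ F, HomMod.lin (Φ F) = HomMod.lin F ∘ₗ v.compare := fun F => rfl
  refine Cds.ladder hf (v.twist.cochains k M π)
    ((barTwist (botPerm θ) (MonoidHom.id Q)).cochains k M π)
    (v.twist.coboundary k M π) ((barTwist (botPerm θ) (MonoidHom.id Q)).coboundary k M π) Φ
    (fun n x hx => Twist.coboundary_mem hx) (fun n x hx => Twist.coboundary_mem hx) ?_
    Twist.coboundary_coboundary Twist.coboundary_coboundary ?_
    (fun n x hx => Twist.coboundary_exact hx) (fun n x hx => Twist.coboundary_exact hx)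
    ?_ ?_ n ?_ ?_ ?_ hB (α ∘ₗ e.symm.toLinearMap) β hβ hβd ?_
  · intro n F hF
    rw [Twist.mem_cochains] at hF ⊢
    rw [hΦ, LinearMap.comp_assoc, ← v.pr_comp_compare, ← LinearMap.comp_assoc, hF]
  · intro F
    refine HomMod.lin.injective ?_
    rw [hΦ, Twist.lin_coboundary, Twist.lin_coboundary, hΦ, LinearMap.comp_assoc,
      LinearMap.comp_assoc, v.compare_comp_d]
  · intro F hF hd
    refine ⟨HomMod.ofFunctional (v.twist.rep.comp π) ((polyCx m).aug X)
      (fun g => v.twist.aug_comp_rep (π g))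
      (HomMod.lin F (Finsupp.single (fun _ => (barCx Q).base) 1)), Twist.aug_mem_cochains _,
      HomMod.lin.injective (LinearMap.ext fun c => ?_),
      HomMod.lin.injective (LinearMap.ext fun c => ?_)⟩
    · rw [Twist.lin_coboundary, map_zero, LinearMap.comp_apply, HomMod.lin_ofFunctional]
      have : (polyCx m).aug X ((polyCx m).d c) = 0 :=
        LinearMap.congr_fun (BasedCx.aug_comp_d (polyCx m)) c
      rw [this]
      simp
    · rw [hΦ, LinearMap.comp_apply, HomMod.lin_ofFunctional,
        Twist.eq_aug_of_coboundary_eq_zero hF hd c, ← LinearMap.comp_apply, v.aug_comp_compare]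
  · intro F hF hd h0
    refine HomMod.lin.injective (LinearMap.ext fun c => ?_)
    have h1 : HomMod.lin (Φ F) (Finsupp.single (fun _ => (barCx Q).base) 1) = 0 := by
      rw [h0, map_zero]; rfl
    rw [hΦ, LinearMap.comp_apply, Twist.eq_aug_of_coboundary_eq_zero hF hd,
      ← LinearMap.comp_apply, v.aug_comp_compare, BasedCx.aug_single, if_pos, one_smul] at h1
    · rw [Twist.eq_aug_of_coboundary_eq_zero hF hd, h1]
      simp
    · exact Finset.sum_eq_zero fun _ _ => rfl
  · intro i hi
    refine v.twist.cochains_cds hf hM i (Set.toFinite _) fun b hb => ?_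
    exact v.exists_perm_ne htrans hrot b (by omega)
  · intro i hi
    refine Twist.cochains_cds hf hM i (finite_tdeg_barCx i) fun b hb => ⟨q₀, fun h => hq1 ?_⟩
    have := barTwist_perm_fst (botPerm θ) (MonoidHom.id Q) q₀ b ⊥ rfl
    rw [h] at this
    exact mul_eq_right.1 this.symm
  · intro F hF
    refine HomMod.lin.injective (end_ext fun b => ?_)
    have h1 := Twist.coboundary_mem hF
    rw [Twist.mem_cochains] at h1
    rw [← h1, LinearMap.comp_apply, BasedCx.pr, diag_single, if_neg]
    · simp
    · have := tdeg_polyCx_le b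
      omega
  · intro F
    obtain ⟨a, rfl⟩ := e.surjective F
    refine HomMod.lin.injective (LinearMap.ext fun c => ?_)
    rw [LinearMap.comp_apply, LinearEquiv.coe_coe, e.symm_apply_apply, hαβ, hΦ,
      ← v.topProd_comp_compare, LinearMap.comp_apply, LinearMap.comp_apply, he]

end

section
variable {k : Type} [Ring k] {G : Type} [Group G] {M : Type} [AddCommGroup M] [Module k[G] M]
  {ι C : Type} (τ : G →* Equiv.Perm ι) [AddCommGroup C]

variable (k M) in
/-- Constant functions. -/
def FunMod.const : M →ₗ[k[G]] FunMod τ M :=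
  linearOfSingle
    { toFun := fun a _ => a
      map_zero' := rfl
      map_add' := fun _ _ => rfl }
    fun g b a => FunMod.ext τ fun i => (FunMod.single_smul_apply τ g b (fun _ => a) i).symm

variable (k M) in
/-- The sum of the values of a function. -/
def FunMod.total [Fintype ι] : FunMod τ M →ₗ[k[G]] M :=
  linearOfSingle
    { toFun := fun F => ∑ i, F i
      map_zero' := Finset.sum_const_zero
      map_add' := fun _ _ => Finset.sum_add_distrib }
    fun g b F => by
      change ∑ i, (MonoidAlgebra.single g b • F) i = MonoidAlgebra.single g b • ∑ i, F i
      refine (Finset.sum_congr rfl fun i _ => FunMod.single_smul_apply τ g b F i).trans ?_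
      exact (Equiv.sum_comp (τ g⁻¹) fun i => (MonoidAlgebra.single g b • F i : M)).trans
        (Finset.smul_sum (N := M)).symm

theorem FunMod.total_const [Fintype ι] (a : M) :
    FunMod.total k M τ (FunMod.const k M τ a) = Fintype.card ι • a := by
  change ∑ _i : ι, a = _
  simp

variable (k M) in
/-- The map from functions to cochains given by an equivariant family of functionals. -/
def HomMod.ofFamily [Fintype ι] (σ : G →* Module.End ℤ C) (c : ι → C →ₗ[ℤ] ℤ)
    (hc : ∀ g i, c (τ g i) ∘ₗ σ g = c i) : FunMod τ M →ₗ[k[G]] HomMod σ M :=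
  linearOfSingle
    { toFun := fun F => HomMod.lin.symm (∑ i, (c i).smulRight (F i))
      map_zero' := by
        refine HomMod.lin.injective (LinearMap.ext fun x => ?_)
        change (∑ i, (c i).smulRight (0 : M)) x = 0
        simp
      map_add' := fun F F' => by
        refine HomMod.lin.injective (LinearMap.ext fun x => ?_)
        change (∑ i, (c i).smulRight (F i + F' i)) x =
          (∑ i, (c i).smulRight (F i)) x + (∑ i, (c i).smulRight (F' i)) x
        simp [LinearMap.sum_apply, Finset.sum_add_distrib] }
    fun g b F => by
      refine HomMod.ext _ fun x => ?_
      rw [HomMod.lin_single_smul]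
      change (∑ i, (c i).smulRight ((MonoidAlgebra.single g b • F) i)) x =
        MonoidAlgebra.single g b • (∑ i, (c i).smulRight (F i)) (σ g⁻¹ x)
      rw [LinearMap.sum_apply, LinearMap.sum_apply, Finset.smul_sum,
        ← Equiv.sum_comp (τ g⁻¹) fun i =>
          MonoidAlgebra.single g b • (c i).smulRight (F i) (σ g⁻¹ x)]
      refine Finset.sum_congr rfl fun i _ => ?_
      rw [FunMod.single_smul_apply, LinearMap.smulRight_apply, LinearMap.smulRight_apply,
        ← LinearMap.comp_apply (c _) (σ g⁻¹), hc, smul_comm]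

theorem HomMod.lin_ofFamily [Fintype ι] (σ : G →* Module.End ℤ C) (c : ι → C →ₗ[ℤ] ℤ)
    (hc : ∀ g i, c (τ g i) ∘ₗ σ g = c i) (F : FunMod τ M) :
    HomMod.lin (HomMod.ofFamily k M τ σ c hc F) = ∑ i, (c i).smulRight (F i) := rfl

theorem Cds.funMod_comp {Q : Type} [Group Q] [Finite ι] {f : ℕ → NNReal}
    (hf : IsProperComplexityFunction f) (π : G →* Q)
    (hM : ∀ S : Subgroup Q, S ≠ ⊤ → SubCds k M f (S.comap π)) (τ : Q →* Equiv.Perm ι)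
    (hτ : ∀ i, ∃ q, τ q i ≠ i) : Cds k[G] f (FunMod (τ.comp π) M) := by
  refine Cds.funMod _ hf fun i => ?_
  rw [← Subgroup.comap_comap]
  refine hM _ fun h => ?_
  obtain ⟨q, hq⟩ := hτ i
  have : q ∈ (MulAction.stabilizer (Equiv.Perm ι) i).comap τ := h ▸ Subgroup.mem_top q
  exact hq this

end

section
variable {k : Type} [Ring k] {G : Type} [Group G] {M : Type} [AddCommGroup M] [Module k[G] M]
  {Q X : Type} [Group Q] [Finite Q] {m : ℕ} [NeZero m] {θ : Q →* Equiv.Perm X} [Fintype X]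
  [LinearOrder X] {f : ℕ → NNReal}

theorem Cds.bar_cochains (hf : IsProperComplexityFunction f)
    (π : G →* Q) (hM : ∀ S : Subgroup Q, S ≠ ⊤ → SubCds k M f (S.comap π)) [Nontrivial Q]
    (θ : Q →* Equiv.Perm X) (i : ℕ) :
    Cds k[G] f ((barTwist (botPerm θ) (MonoidHom.id Q)).cochains k M π i) := by
  obtain ⟨q, hq⟩ := exists_ne (1 : Q)
  refine Twist.cochains_cds hf hM i (finite_tdeg_barCx i) fun b hb => ⟨q, fun h => hq ?_⟩
  have := barTwist_perm_fst (botPerm θ) (MonoidHom.id Q) q b ⊥ rfl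
  rw [h] at this
  exact mul_eq_right.1 this.symm

theorem Cds.of_relation (hf : IsProperComplexityFunction f)
    (π : G →* Q) (hM : ∀ S : Subgroup Q, S ≠ ⊤ → SubCds k M f (S.comap π)) [Nontrivial Q]
    (v : ModCocycle m θ) (htrans : ∀ x y, ∃ q, θ q x = y)
    (hrot : ∃ x q, θ q x = x ∧ ¬ (m : ℤ) ∣ v.rot q x)
    {ι : Type} [Fintype ι] (τ : Q →* Equiv.Perm ι) (hτ : ∀ i, ∃ q, τ q i ≠ i)
    (c : ι → ((WithBot X → Q × List Q) →₀ ℤ) →ₗ[ℤ] ℤ)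
    (hc : ∀ q i, c (τ q i) ∘ₗ (barTwist (botPerm θ) (MonoidHom.id Q)).rep q = c i)
    (hcd : ∀ i, c i ∘ₗ (barCx Q).d = 0)
    (hcpr : ∀ i, c i ∘ₗ (barCx Q).pr (2 * Fintype.card X) = c i)
    (N : ((WithBot X → Q × List Q) →₀ ℤ) →ₗ[ℤ] ℤ)
    (hN : ∀ q, N ∘ₗ (barTwist (botPerm θ) (MonoidHom.id Q)).rep q = N)
    {n : ℕ} (hn : 2 * Fintype.card X = n + 1) (hNpr : N ∘ₗ (barCx Q).pr n = N)
    (hrel : barProd v.U = N ∘ₗ (barCx Q).d + ∑ i, c i) : Cds k[G] f M := by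
  let a := barTwist (botPerm θ) (MonoidHom.id Q)
  let αN : M →ₗ[k[G]] a.cochains k M π n :=
    LinearMap.codRestrict _ (HomMod.ofFunctional (a.rep.comp π) N fun g => hN (π g)) fun b => by
      rw [Twist.mem_cochains]
      refine LinearMap.ext fun x => ?_
      rw [LinearMap.comp_apply, HomMod.lin_ofFunctional, HomMod.lin_ofFunctional,
        ← LinearMap.comp_apply N, hNpr]
  let γ := HomMod.ofFamily k M (τ.comp π) (a.rep.comp π) c fun g i => hc (π g) i
  let α : M →ₗ[k[G]] a.cochains k M π n × FunMod (τ.comp π) M :=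
    LinearMap.prod αN (FunMod.const k M (τ.comp π))
  let β : a.cochains k M π n × FunMod (τ.comp π) M →ₗ[k[G]] HomMod (a.rep.comp π) M :=
    LinearMap.coprod (a.coboundary k M π ∘ₗ Submodule.subtype _) γ
  refine Cds.of_modCocycle hf π hM v htrans hrot
    (Cds.prod hf (Cds.bar_cochains hf π hM θ n) (Cds.funMod_comp hf π hM τ hτ)) α β ?_ ?_ ?_
  · rintro ⟨F, F'⟩
    refine Submodule.add_mem _ ?_ ?_
    · rw [hn]
      exact Twist.coboundary_mem F.2
    · rw [Twist.mem_cochains]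
      refine LinearMap.ext fun x => ?_
      change (∑ i, (c i).smulRight (F' i : M)) ((barCx Q).pr (2 * Fintype.card X) x) =
        (∑ i, (c i).smulRight (F' i : M)) x
      rw [LinearMap.sum_apply, LinearMap.sum_apply]
      refine Finset.sum_congr rfl fun i _ => ?_
      rw [LinearMap.smulRight_apply, LinearMap.smulRight_apply, ← LinearMap.comp_apply, hcpr]
  · rintro ⟨F, F'⟩
    have h1 : β (F, F') = a.coboundary k M π F + γ F' := rfl
    refine Eq.trans (congrArg _ h1) ?_
    rw [map_add]
    refine (congrArg₂ (· + ·) (Twist.coboundary_coboundary _) ?_).trans (add_zero _)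
    refine HomMod.lin.injective (LinearMap.ext fun x => ?_)
    rw [Twist.lin_coboundary, LinearMap.comp_apply, HomMod.lin_ofFamily, LinearMap.sum_apply,
      map_zero, LinearMap.zero_apply]
    refine Finset.sum_eq_zero fun i _ => ?_
    rw [LinearMap.smulRight_apply, ← LinearMap.comp_apply, hcd, LinearMap.zero_apply, zero_smul]
  · intro b x
    change N ((barCx Q).d x) • b + (∑ i, (c i).smulRight b) x = _
    rw [hrel, LinearMap.add_apply, LinearMap.comp_apply, LinearMap.sum_apply, LinearMap.sum_apply,
      add_smul, Finset.sum_smul]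
    rfl

end

section
variable {Q X : Type} [Fintype X]

theorem barFun_single_ne_zero {U : Q → Q → Q → ℤ} {p : Q × List Q}
    (h : barFun U (Finsupp.single p 1) ≠ 0) : Bar.deg p = 2 := by
  obtain ⟨y, l⟩ := p
  rw [barFun, Finsupp.linearCombination_single, one_smul] at h
  match l with
  | [] => exact absurd rfl h
  | [_] => exact absurd rfl h
  | [_, _] => rfl
  | _ :: _ :: _ :: _ => exact absurd rfl h

theorem barFun_single_shift [Mul Q] {U U' : Q → Q → Q → ℤ} (q : Q) 
    (h : ∀ y z w, U (q * y) (q * z) (q * w) = U' y z w) (p : Q × List Q) :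
    barFun U (Finsupp.single (Bar.shift q p) 1) = barFun U' (Finsupp.single p 1) := by
  obtain ⟨y, l⟩ := p
  rw [barFun, barFun, Finsupp.linearCombination_single, Finsupp.linearCombination_single,
    one_smul, one_smul]
  match l with
  | [] => rfl
  | [_] => rfl
  | [_, _] => exact h _ _ _
  | _ :: _ :: _ :: _ => rfl

theorem barFun_add (U U' : Q → Q → Q → ℤ) :
    barFun (fun y z w => U y z w + U' y z w) = barFun U + barFun U' := end_ext fun p => by
  obtain ⟨y, l⟩ := p
  rw [LinearMap.add_apply]
  simp only [barFun, Finsupp.linearCombination_single, one_smul]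
  match l with
  | [] => rfl
  | [_] => rfl
  | [_, _] => rfl
  | _ :: _ :: _ :: _ => rfl

theorem barProd_single (U : X → Q → Q → Q → ℤ) (b : WithBot X → Q × List Q) :
    barProd U (Finsupp.single b 1) = degAug Bar.deg (Finsupp.single (b ⊥) 1) *
      ∏ x : X, barFun (U x) (Finsupp.single (b x) 1) := by
  rw [barProd, tfun_single, prod_withBot]
  rfl

theorem barProd_comp_d [One Q] [LinearOrder X] (U : X → Q → Q → Q → ℤ)
    (h : ∀ x, barFun (U x) ∘ₗ (barCx Q).δ = 0) : barProd U ∘ₗ (barCx Q).d = 0 := by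
  refine (barCx Q).tfun_comp_d _ fun z => ?_
  induction z using WithBot.recBotCoe with
  | bot => 
    refine end_ext fun p => ?_
    change degAug Bar.deg (Bar.δ _) = 0
    rw [Bar.δ_single, Bar.degAug_bd]
  | coe x => exact h x

theorem barProd_comp_pr [One Q] [LinearOrder X] (U : X → Q → Q → Q → ℤ) :
    barProd U ∘ₗ (barCx Q).pr (2 * Fintype.card X) = barProd U := end_ext fun b => by
  rw [LinearMap.comp_apply, BasedCx.pr, diag_single]
  split_ifs with h
  · rfl
  · rw [Finsupp.single_zero, map_zero, barProd_single]
    by_contra hne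
    obtain ⟨h1, h2⟩ := mul_ne_zero_iff.1 (Ne.symm hne)
    rw [Finset.prod_ne_zero_iff] at h2
    refine h ?_
    rw [BasedCx.tdeg, sum_withBot]
    have e1 : Bar.deg (b ⊥) = 0 := by
      by_contra h0
      rw [degAug_single, if_neg h0] at h1
      exact h1 rfl
    have e2 : ∀ x : X, Bar.deg (b x) = 2 := fun x => barFun_single_ne_zero (h2 x (Finset.mem_univ x))
    change Bar.deg (b ⊥) + ∑ x : X, Bar.deg (b x) = _
    rw [e1, Finset.sum_congr rfl fun x _ => e2 x]
    simp [mul_comm]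

theorem barProd_comp_rep [LinearOrder X] [Group Q] {Γ : Type} [Group Γ] (θ : Γ →* Equiv.Perm X)
    (j : Γ →* Q) (g : Γ) (U U' : X → Q → Q → Q → ℤ)
    (h : ∀ x y z w, U (θ g x) (j g * y) (j g * z) (j g * w) = U' x y z w) :
    barProd U ∘ₗ (barTwist (botPerm θ) j).rep g = barProd U' := by
  refine (barTwist (botPerm θ) j).tfun_comp_rep g _ _ (fun z p hp => ?_) fun z p => ?_
  · induction z using WithBot.recBotCoe with
    | bot =>
      change degAug Bar.deg _ ≠ 0 at hp
      change Even (Bar.deg p)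
      rw [degAug_single] at hp
      split_ifs at hp with h0
      · rw [h0]; exact Even.zero
      · exact absurd rfl hp
    | coe x =>
      have : Bar.deg p = 2 := barFun_single_ne_zero hp
      change Even (Bar.deg p)
      rw [this]
      exact even_two
  · induction z using WithBot.recBotCoe with
    | bot =>
      change degAug Bar.deg (Finsupp.single (Bar.shift (j g) p) 1) =
        degAug Bar.deg (Finsupp.single p 1)
      rw [degAug_single, degAug_single]
      simp [Bar.deg, Bar.shift]
    | coe x => exact barFun_single_shift (j g) (h x) p

theorem barProd_add (U U' : X → Q → Q → Q → ℤ) [Nonempty X] [Fintype {p : X → Bool // (∃ x, p x = true) ∧ ∃ x, p x = false}] :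
    barProd (fun x y z w => U x y z w + U' x y z w) = barProd U + barProd U' +
      ∑ p : {p : X → Bool // (∃ x, p x = true) ∧ ∃ x, p x = false},
        barProd fun x => bif p.1 x then U x else U' x := by
  classical
  refine end_ext fun b => ?_
  rw [LinearMap.add_apply, LinearMap.add_apply, LinearMap.sum_apply]
  simp only [barProd_single, barFun_add, LinearMap.add_apply]
  rw [← Finset.mul_sum, ← mul_add, ← mul_add]
  congr 1
  let F : (X → Bool) → ℤ := fun p =>
    ∏ x : X, barFun (bif p x then U x else U' x) (Finsupp.single (b x) 1)
  have h1 : ∏ x : X, (barFun (U x) (Finsupp.single (b x) 1) +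
      barFun (U' x) (Finsupp.single (b x) 1)) = ∑ p, F p := by
    have := Finset.prod_univ_sum (fun _ : X => (Finset.univ : Finset Bool))
      fun x e => barFun (bif e then U x else U' x) (Finsupp.single (b x) 1)
    simp only [Fintype.sum_bool, cond_true, cond_false, Fintype.piFinset_univ] at this
    exact this
  rw [h1]
  have ht : (fun _ : X => true) ∈ Finset.univ.erase (fun _ : X => false) := by
    simp only [Finset.mem_erase, Finset.mem_univ, and_true]
    exact fun h => Bool.noConfusion (congrFun h (Classical.arbitrary X))
  rw [← Finset.add_sum_erase _ F (Finset.mem_univ (fun _ : X => false)),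
    ← Finset.add_sum_erase _ F ht]
  have h2 : ∑ p ∈ (Finset.univ.erase (fun _ : X => false)).erase (fun _ : X => true), F p =
      ∑ p : {p : X → Bool // (∃ x, p x = true) ∧ ∃ x, p x = false}, F p.1 := by
    refine Finset.sum_subtype _ (fun p => ?_) F
    simp only [Finset.mem_erase, Finset.mem_univ, and_true, ne_eq, funext_iff, not_forall,
      Bool.not_eq_true, Bool.not_eq_false]
    exact and_comm
  rw [h2]
  change ∏ x : X, barFun (U' x) (Finsupp.single (b x) 1) +
    (∏ x : X, barFun (U x) (Finsupp.single (b x) 1) + _) = _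
  rw [← add_assoc, add_comm (∏ x : X, barFun (U' x) (Finsupp.single (b x) 1))]

end

namespace ModCocycle

variable {Q X : Type} [Group Q] {m : ℕ} 

theorem barFun_U_comp_δ [NeZero m] {θ : Q →* Equiv.Perm X} (v : ModCocycle m θ) (x : X) :
    barFun (v.U x) ∘ₗ (barCx Q).δ = 0 := by
  have h : (polyCx m).δ ∘ₗ v.toPoly x = v.toPoly x ∘ₗ (barCx Q).δ := v.fam.δ_map x
  rw [← topFun_comp_toPoly, LinearMap.comp_assoc, ← h, ← LinearMap.comp_assoc, topFun_comp_δ,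
    LinearMap.zero_comp]

/-- The difference between a translate of a family of cocycles modulo `m` and the family itself. -/
def translateSub {ϑ : Q × Q →* Equiv.Perm X} (T : ModCocycle m (ϑ.comp (MonoidHom.inl Q Q)))
    (r : Q) : ModCocycle m (ϑ.comp (MonoidHom.inl Q Q)) where
  V x y z := T.V (ϑ (1, r) x) y z - T.V x y z
  V_mul q x y z := by
    have h : ϑ (1, r) ((ϑ.comp (MonoidHom.inl Q Q)) q x) =
        (ϑ.comp (MonoidHom.inl Q Q)) q (ϑ (1, r) x) := by
      change (ϑ (1, r) * ϑ (q, 1)) x = (ϑ (q, 1) * ϑ (1, r)) x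
      rw [← map_mul, ← map_mul]
      simp
    rw [h, T.V_mul, T.V_mul]
  cocycle x y z w := by
    have e : T.V (ϑ (1, r) x) y z - T.V x y z + (T.V (ϑ (1, r) x) z w - T.V x z w) -
        (T.V (ϑ (1, r) x) y w - T.V x y w) = T.V (ϑ (1, r) x) y z + T.V (ϑ (1, r) x) z w -
          T.V (ϑ (1, r) x) y w - (T.V x y z + T.V x z w - T.V x y w) := by ring
    exact e ▸ dvd_sub (T.cocycle (ϑ (1, r) x) y z w) (T.cocycle x y z w)

theorem U_translateSub [NeZero m] {ϑ : Q × Q →* Equiv.Perm X}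
    (T : ModCocycle m (ϑ.comp (MonoidHom.inl Q Q))) (r : Q) (x : X) (y z w : Q) :
    T.U (ϑ (1, r) x) y z w = (T.translateSub r).U x y z w + T.U x y z w := by
  refine mul_left_cancel₀ T.m_ne_zero ?_
  rw [mul_add, mul_U, mul_U, mul_U]
  change _ = T.V (ϑ (1, r) x) y z - T.V x y z + (T.V (ϑ (1, r) x) z w - T.V x z w) -
    (T.V (ϑ (1, r) x) y w - T.V x y w) + _
  ring

end ModCocycle

/-- The action on the nonconstant Boolean functions. -/
def boolPerm {Q X : Type} [Group Q] (θ : Q →* Equiv.Perm X) :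
    Q →* Equiv.Perm {p : X → Bool // (∃ x, p x = true) ∧ ∃ x, p x = false} :=
  MonoidHom.toHomPerm
    { toFun := fun q p => ⟨fun x => p.1 (θ q⁻¹ x),
        p.2.1.imp' (θ q) fun x hx => by simpa using hx,
        p.2.2.imp' (θ q) fun x hx => by simpa using hx⟩
      map_one' := by funext p; exact Subtype.ext (funext fun x => by simp; rfl)
      map_mul' := fun q q' => by
        funext p
        refine Subtype.ext (funext fun x => ?_)
        change p.1 (θ (q * q')⁻¹ x) = p.1 (θ q'⁻¹ (θ q⁻¹ x))
        simp }

theorem boolPerm_apply {Q X : Type} [Group Q] (θ : Q →* Equiv.Perm X) (q : Q)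
    (p : {p : X → Bool // (∃ x, p x = true) ∧ ∃ x, p x = false}) (x : X) :
    (boolPerm θ q p).1 (θ q x) = p.1 x := by
  change p.1 (θ q⁻¹ (θ q x)) = p.1 x
  simp

theorem barTwist_rep_inl {Q X : Type} [Group Q] [Fintype X] [LinearOrder X]
    (ϑ : Q × Q →* Equiv.Perm X) (q : Q) :
    (barTwist (botPerm (ϑ.comp (MonoidHom.inl Q Q))) (MonoidHom.id Q)).rep q =
      (barTwist (botPerm ϑ) (MonoidHom.fst Q Q)).rep (q, 1) := end_ext fun b => by
  have h : (barTwist (botPerm (ϑ.comp (MonoidHom.inl Q Q))) (MonoidHom.id Q)).perm q b =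
      (barTwist (botPerm ϑ) (MonoidHom.fst Q Q)).perm (q, 1) b := by
    funext z
    obtain ⟨x, rfl⟩ := (botPerm ϑ (q, 1)).surjective z
    exact ((barTwist (botPerm (ϑ.comp (MonoidHom.inl Q Q))) (MonoidHom.id Q)).perm_apply_perm q
      b x).trans ((barTwist (botPerm ϑ) (MonoidHom.fst Q Q)).perm_apply_perm (q, 1) b x).symm
  rw [Twist.rep_single, Twist.rep_single, h]
  rfl

theorem Cds.of_translate {k : Type} [Ring k] {G : Type} [Group G] {M : Type} [AddCommGroup M]
    [Module k[G] M] {Q X : Type} [Group Q] [Finite Q] {m : ℕ} [NeZero m] [Fintype X]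
    [LinearOrder X] {f : ℕ → NNReal} (hf : IsProperComplexityFunction f)
    (π : G →* Q) (hM : ∀ S : Subgroup Q, S ≠ ⊤ → SubCds k M f (S.comap π)) [Nontrivial Q]
    {ϑ : Q × Q →* Equiv.Perm X} (T : ModCocycle m (ϑ.comp (MonoidHom.inl Q Q))) (r : Q)
    (htrans : ∀ x y, ∃ q, ϑ (q, 1) x = y)
    (hrot : ∃ x q, ϑ (q, 1) x = x ∧ ¬ (m : ℤ) ∣ (T.translateSub r).rot q x) : Cds k[G] f M := by
  classical
  have := Fintype.ofFinite Q
  obtain ⟨x₀, -⟩ := id hrot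
  have : Nonempty X := ⟨x₀⟩
  have hX := Fintype.card_pos_iff.2 this
  obtain ⟨n, hn⟩ : ∃ n, 2 * Fintype.card X = n + 1 := ⟨2 * Fintype.card X - 1, by omega⟩
  let a := barTwist (botPerm ϑ) (MonoidHom.fst Q Q)
  have hrep := barTwist_rep_inl ϑ
  have hd : barProd T.U ∘ₗ (barCx Q).d = 0 := barProd_comp_d _ T.barFun_U_comp_δ
  have hpr := barProd_comp_pr (Q := Q) T.U
  rw [hn] at hpr
  obtain ⟨N, hNd, hNpr, hNj⟩ := a.exists_coboundary (MonoidHom.inl Q Q) (1, r)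
    (fun q => Prod.ext (Commute.one_left q) (Commute.one_right r))
    (fun b => if (b ⊥).1 = 1 then 1 else 0) (fun b => by
      rw [Finset.sum_eq_single (b ⊥).1⁻¹]
      · rw [if_pos]
        rw [barTwist_perm_fst _ _ _ _ _ rfl]
        simp
      · intro q _ hq
        rw [if_neg]
        rw [barTwist_perm_fst _ _ _ _ _ rfl]
        exact fun h => hq (eq_inv_of_mul_eq_one_left h)
      · exact fun h => absurd (Finset.mem_univ _) h) (barProd T.U) hd hpr
    (fun q => by
      refine (congrArg (barProd T.U ∘ₗ ·) (hrep q).symm).trans ?_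
      exact barProd_comp_rep _ _ _ _ _ fun x y z w => T.U_mul q x y z w)
  have hrelr : barProd T.U ∘ₗ a.rep (1, r) =
      barProd (fun x y z w => (T.translateSub r).U x y z w + T.U x y z w) :=
    barProd_comp_rep ϑ (MonoidHom.fst Q Q) (1, r) _ _ fun x y z w => by
      rw [← T.U_translateSub]
      simp
  rw [hrelr, barProd_add] at hNd
  refine Cds.of_relation hf π hM (T.translateSub r) htrans hrot
    (boolPerm (ϑ.comp (MonoidHom.inl Q Q))) ?_
    (fun p => -barProd fun x => bif p.1 x then (T.translateSub r).U x else T.U x) ?_ ?_ ?_ N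
    (fun q => (congrArg (N ∘ₗ ·) (hrep q)).trans (hNj q)) hn hNpr ?_
  · rintro ⟨p, ⟨x, hx⟩, y, hy⟩
    obtain ⟨q, hq⟩ := htrans x y
    refine ⟨q, fun h => ?_⟩
    have h1 := boolPerm_apply (ϑ.comp (MonoidHom.inl Q Q)) q ⟨p, ⟨x, hx⟩, y, hy⟩ x
    rw [h] at h1
    change p (ϑ (q, 1) x) = p x at h1
    rw [hq, hx, hy] at h1
    exact Bool.noConfusion h1
  · intro q p
    rw [LinearMap.neg_comp]
    congr 1
    refine barProd_comp_rep _ _ _ _ _ fun x y z w => ?_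
    rw [boolPerm_apply]
    cases p.1 x
    · exact T.U_mul q x y z w
    · exact (T.translateSub r).U_mul q x y z w
  · intro p
    rw [LinearMap.neg_comp, barProd_comp_d, neg_zero]
    intro x
    cases p.1 x
    · exact T.barFun_U_comp_δ x
    · exact (T.translateSub r).barFun_U_comp_δ x
  · intro p
    rw [LinearMap.neg_comp, barProd_comp_pr]
  · rw [hNd, Finset.sum_neg_distrib]
    abel

namespace ModCocycle

variable {Q X : Type} [Group Q] {m : ℕ}

/-- The family of cocycles given by lifts of differences of functions with values in `ZMod m`. -/
def ofFun [NeZero m] (θ : Q →* Equiv.Perm X) (s : X → Q → ZMod m)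
    (h : ∀ q x y z, s (θ q x) (q * z) - s (θ q x) (q * y) = s x z - s x y) : ModCocycle m θ where
  V x y z := (s x z - s x y).val
  V_mul q x y z := by rw [h]
  cocycle x y z w := by
    rw [← ZMod.intCast_zmod_eq_zero_iff_dvd]
    push_cast
    rw [ZMod.natCast_zmod_val, ZMod.natCast_zmod_val, ZMod.natCast_zmod_val]
    ring

theorem intCast_V_ofFun [NeZero m] (θ : Q →* Equiv.Perm X) (s : X → Q → ZMod m)
    (h : ∀ q x y z, s (θ q x) (q * z) - s (θ q x) (q * y) = s x z - s x y) (x : X) (y z : Q) :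
    (((ofFun θ s h).V x y z : ℤ) : ZMod m) = s x z - s x y := by
  change ((((s x z - s x y).val : ℕ) : ℤ) : ZMod m) = _
  rw [Int.cast_natCast, ZMod.natCast_zmod_val]

/-- Integral multiples of a family of cocycles modulo `m`. -/
def mulLeft {θ : Q →* Equiv.Perm X} (T : ModCocycle m θ) (n : ℤ) : ModCocycle m θ where
  V x y z := n * T.V x y z
  V_mul q x y z := by rw [T.V_mul]
  cocycle x y z w := by
    rw [← mul_add, ← mul_sub]
    exact (T.cocycle x y z w).mul_left n

theorem U_mulLeft [NeZero m] {θ : Q →* Equiv.Perm X} (T : ModCocycle m θ) (n : ℤ) (x : X)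
    (y z w : Q) : (T.mulLeft n).U x y z w = n * T.U x y z w := by
  refine mul_left_cancel₀ T.m_ne_zero ?_
  rw [mul_U, mul_left_comm, mul_U]
  change n * T.V x y z + n * T.V x z w - n * T.V x y w = _
  ring

end ModCocycle

theorem barFun_mul {Q : Type} (n : ℤ) (U : Q → Q → Q → ℤ) :
    barFun (fun y z w => n * U y z w) = n • barFun U := end_ext fun p => by
  obtain ⟨y, l⟩ := p
  rw [LinearMap.smul_apply]
  simp only [barFun, Finsupp.linearCombination_single, smul_eq_mul, one_mul]
  match l with
  | [] => exact (mul_zero n).symm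
  | [_] => exact (mul_zero n).symm
  | [_, _] => rfl
  | _ :: _ :: _ :: _ => exact (mul_zero n).symm

section
variable {k : Type} [Ring k] {G : Type} [Group G] {M : Type} [AddCommGroup M] [Module k[G] M]
  {Q : Type} [Group Q] [Finite Q] {m : ℕ} [NeZero m] {f : ℕ → NNReal}

theorem Cds.of_multiple (hf : IsProperComplexityFunction f)
    (π : G →* Q) (hM : ∀ S : Subgroup Q, S ≠ ⊤ → SubCds k M f (S.comap π)) [Nontrivial Q]
    (χ : Q → ZMod m) (hχ : ∀ q q', χ (q * q') = χ q + χ q')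
    {ι : Type} [Fintype ι] (τ : Q →* Equiv.Perm ι) (hτ : ∀ i, ∃ q, τ q i ≠ i)
    (q : Q) (hq : χ (q ^ Fintype.card ι) ≠ 0) : Cds k[G] f M := by
  have h1 : χ 1 = 0 := by simpa using hχ 1 1
  have hpow : ∀ n : ℕ, χ (q ^ n) = n * χ q := fun n => by
    induction n with
    | zero => simp [h1]
    | succ n ih => rw [pow_succ, hχ, ih]; push_cast; ring
  let T : ModCocycle m (1 : Q →* Equiv.Perm Unit) :=
    ModCocycle.ofFun 1 (fun _ => χ) fun q x y z => by rw [hχ, hχ]; ring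
  refine Cds.of_relation hf π hM (T.mulLeft (Fintype.card ι)) (fun _ _ => ⟨1, rfl⟩) ⟨(), q, rfl, ?_⟩
    τ hτ (fun _ => barProd T.U) (fun q i => ?_) (fun i => barProd_comp_d _ T.barFun_U_comp_δ)
    (fun i => barProd_comp_pr _) 0 (fun q => LinearMap.zero_comp _) (n := 1) rfl
    (LinearMap.zero_comp _) ?_
  · rw [← ZMod.intCast_zmod_eq_zero_iff_dvd]
    change (((Fintype.card ι : ℤ) * T.V _ 1 q : ℤ) : ZMod m) ≠ 0
    rw [Int.cast_mul, ModCocycle.intCast_V_ofFun, h1, sub_zero]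
    rw [hpow] at hq
    exact_mod_cast hq
  · exact barProd_comp_rep _ _ _ _ _ fun x y z w => T.U_mul q x y z w
  · refine end_ext fun b => ?_
    have h2 : (T.mulLeft (Fintype.card ι)).U = fun x y z w => (Fintype.card ι : ℤ) * T.U x y z w :=
      funext fun x => funext fun y => funext fun z => funext fun w => T.U_mulLeft _ x y z w
    rw [h2, barProd_single, LinearMap.zero_comp, zero_add, Finset.sum_const, LinearMap.smul_apply,
      barProd_single]
    simp only [barFun_mul, LinearMap.smul_apply]
    simp
    ring

theorem Cds.of_character (hf : IsProperComplexityFunction f)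
    (π : G →* Q) (hM : ∀ S : Subgroup Q, S ≠ ⊤ → SubCds k M f (S.comap π))
    (A : Subgroup Q) [hA : A.Normal] (χ : A → ZMod m) (hχ : ∀ a a', χ (a * a') = χ a + χ a')
    (r : Q) (a : A) (hr : χ ⟨r * a * r⁻¹, hA.conj_mem a a.2 r⟩ ≠ χ a) : Cds k[G] f M := by
  classical
  have hr1 : r ≠ 1 := by
    rintro rfl
    simp at hr
  have : Nontrivial Q := ⟨r, 1, hr1⟩
  have := Fintype.ofFinite (Q ⧸ A)
  let : LinearOrder (Q ⧸ A) := LinearOrder.lift' (Fintype.equivFin (Q ⧸ A)) (Equiv.injective _)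
  have hs : ∃ s : Q → ZMod m, ∀ (a : A) y, s (a * y) = χ a + s y := by
    have hout : ∀ y : Q, y * (y : Q ⧸ A).out⁻¹ ∈ A := fun y => by
      have h2 : ((y * (y : Q ⧸ A).out⁻¹ : Q) : Q ⧸ A) = 1 := by
        rw [QuotientGroup.mk_mul, QuotientGroup.mk_inv, QuotientGroup.out_eq', mul_inv_cancel]
      exact (QuotientGroup.eq_one_iff _).1 h2
    refine ⟨fun y => χ ⟨_, hout y⟩, fun a y => ?_⟩
    have : ((a * y : Q) : Q ⧸ A) = y := by
      rw [QuotientGroup.mk_mul, (QuotientGroup.eq_one_iff _).2 a.2, one_mul]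
    refine Eq.trans (congrArg χ (Subtype.ext ?_)) (hχ a ⟨_, hout y⟩)
    change a * y * ((a * y : Q) : Q ⧸ A).out⁻¹ = a * (y * (y : Q ⧸ A).out⁻¹)
    rw [this, mul_assoc]
  obtain ⟨s, hs⟩ := hs
  let ϑ : Q × Q →* Equiv.Perm (Q ⧸ A) := MonoidHom.toHomPerm
    { toFun := fun g x => (g.1 : Q ⧸ A) * x * (g.2 : Q ⧸ A)⁻¹
      map_one' := by funext x; simp; rfl
      map_mul' := fun g h => by
        funext x
        change ((g.1 * h.1 : Q) : Q ⧸ A) * x * ((g.2 * h.2 : Q) : Q ⧸ A)⁻¹ =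
          (g.1 : Q ⧸ A) * ((h.1 : Q ⧸ A) * x * (h.2 : Q ⧸ A)⁻¹) * (g.2 : Q ⧸ A)⁻¹
        rw [QuotientGroup.mk_mul, QuotientGroup.mk_mul]
        group }
  have hϑ : ∀ g r x, ϑ (g, r) x = (g : Q ⧸ A) * x * (r : Q ⧸ A)⁻¹ := fun g r x => rfl
  have hrep : ∀ g g' : Q, (g : Q ⧸ A) = g' → ∀ y z,
      s (g⁻¹ * z) - s (g⁻¹ * y) = s (g'⁻¹ * z) - s (g'⁻¹ * y) := fun g g' h y z => by
    have hm : g⁻¹ * g' ∈ A := QuotientGroup.eq.1 h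
    have e : ∀ z, g⁻¹ * z = ((⟨g⁻¹ * g', hm⟩ : A) : Q) * (g'⁻¹ * z) := fun z => by
      simp [mul_assoc]
    rw [e z, e y, hs, hs]
    ring
  let T : ModCocycle m (ϑ.comp (MonoidHom.inl Q Q)) :=
    ModCocycle.ofFun _ (fun x y => s (x.out⁻¹ * y)) fun q x y z => by
      have h2 : (((ϑ.comp (MonoidHom.inl Q Q)) q x).out : Q ⧸ A) = ((q * x.out : Q) : Q ⧸ A) := by
        rw [QuotientGroup.out_eq', QuotientGroup.mk_mul, QuotientGroup.out_eq']
        change ϑ (q, 1) x = _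
        rw [hϑ]
        simp
      rw [hrep _ _ h2]
      simp [mul_assoc]
  have hV : ∀ (g : Q) (a : A), ((T.V (g : Q ⧸ A) 1 a : ℤ) : ZMod m) =
      χ ⟨g⁻¹ * a * g⁻¹⁻¹, hA.conj_mem a a.2 g⁻¹⟩ := fun g a => by
    rw [ModCocycle.intCast_V_ofFun, hrep _ g (QuotientGroup.out_eq' _)]
    have e : g⁻¹ * a = ((⟨g⁻¹ * a * g⁻¹⁻¹, hA.conj_mem a a.2 g⁻¹⟩ : A) : Q) * (g⁻¹ * 1) := by simp
    rw [(congrArg s e).trans (hs _ _)]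
    ring
  refine Cds.of_translate hf π hM T r (fun x y => ?_) ⟨((1 : Q) : Q ⧸ A), a, ?_, ?_⟩
  · refine ⟨y.out * x.out⁻¹, ?_⟩
    rw [hϑ]
    simp
  · rw [hϑ, (QuotientGroup.eq_one_iff _).2 a.2]
    simp
  · rw [← ZMod.intCast_zmod_eq_zero_iff_dvd]
    have e1 : (ϑ.comp (MonoidHom.inl Q Q)) a ((1 : Q) : Q ⧸ A) = ((1 : Q) : Q ⧸ A) := by
      change ϑ (a, 1) _ = _
      rw [hϑ, (QuotientGroup.eq_one_iff _).2 a.2]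
      simp
    have e2 : ϑ (1, r) ((1 : Q) : Q ⧸ A) = ((r⁻¹ : Q) : Q ⧸ A) := by
      rw [hϑ]
      simp
    rw [ModCocycle.rot, e1]
    change ((T.V (ϑ (1, r) ((1 : Q) : Q ⧸ A)) 1 a - T.V ((1 : Q) : Q ⧸ A) 1 a : ℤ) : ZMod m) ≠ 0
    rw [e2, Int.cast_sub, hV, hV, sub_ne_zero]
    simpa using hr

end

/-- Characters with values in finite cyclic groups separate the points of a finite abelian group. -/
theorem exists_zmod_character_ne {A : Type} [Group A] [Finite A] (hA : ∀ a b : A, a * b = b * a)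
    {a b : A} (hab : a ≠ b) : ∃ (m : ℕ) (_ : NeZero m) (χ : A → ZMod m),
      (∀ x y, χ (x * y) = χ x + χ y) ∧ χ a ≠ χ b := by
  let : CommGroup A := { mul_comm := hA }
  obtain ⟨ι, _, n, hn, ⟨e⟩⟩ := CommGroup.equiv_prod_multiplicative_zmod_of_finite A
  obtain ⟨i, hi⟩ : ∃ i, e a i ≠ e b i := by
    by_contra! h
    exact hab (e.injective (funext h))
  refine ⟨n i, NeZero.of_gt (hn i), fun x => (e x i).toAdd, fun x y => ?_, fun h => hi h⟩
  exact congrArg Multiplicative.toAdd (congrFun (map_mul e x y) i)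

/-- A finite noncommutative `p`-group has an abelian normal subgroup which is not central. -/
theorem IsPGroup.exists_normal_not_central {p : ℕ} [Fact p.Prime] {Q : Type} [Group Q] [Finite Q]
    (hQ : IsPGroup p Q) (hc : ¬ ∀ a b : Q, a * b = b * a) :
    ∃ A : Subgroup Q, A.Normal ∧ (∀ a b : A, a * b = b * a) ∧
      ∃ (r : Q) (a : A), r * a * r⁻¹ ≠ a := by
  let Z := Subgroup.center Q
  have hZ : Nontrivial (Q ⧸ Z) := by
    refine QuotientGroup.nontrivial_iff.2 fun h => hc fun a b => ?_
    have hb : b ∈ Z := h ▸ Subgroup.mem_top b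
    exact Subgroup.mem_center_iff.1 hb a
  have := (hQ.to_quotient Z).center_nontrivial
  obtain ⟨⟨c, hcc⟩, hc1⟩ := exists_ne (1 : Subgroup.center (Q ⧸ Z))
  have hle : Subgroup.zpowers c ≤ Subgroup.center (Q ⧸ Z) := by
    rwa [Subgroup.zpowers_le]
  have hn : (Subgroup.zpowers c).Normal := ⟨fun n hn g => by
    rwa [Subgroup.mem_center_iff.1 (hle hn) g, mul_inv_cancel_right]⟩
  obtain ⟨x, rfl⟩ := QuotientGroup.mk_surjective c
  let A := (Subgroup.zpowers (x : Q ⧸ Z)).comap (QuotientGroup.mk' Z)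
  refine ⟨A, hn.comap _, ?_, ?_⟩
  · let φ : A →* Subgroup.zpowers (x : Q ⧸ Z) :=
      ((QuotientGroup.mk' Z).comp A.subtype).codRestrict _ fun a => a.2
    refine (φ.isMulCommutative_of_isCyclic_of_ker_le_center fun a ha => ?_).is_comm.comm
    have h2 : ((a : Q) : Q ⧸ Z) = 1 := congrArg Subtype.val ha
    have h3 := Subgroup.mem_center_iff.1 ((QuotientGroup.eq_one_iff _).1 h2)
    exact Subgroup.mem_center_iff.2 fun b => Subtype.ext (h3 b)
  · by_contra! h
    refine hc1 (Subtype.ext ((QuotientGroup.eq_one_iff x).2 (Subgroup.mem_center_iff.2 fun r => ?_)))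
    exact mul_inv_eq_iff_eq_mul.1 (h r ⟨x, Subgroup.mem_zpowers _⟩)

theorem isElementaryAbelian_of_pow_eq_one {p : ℕ} (hp : p.Prime) {Q : Type} [Group Q] [Finite Q]
    (hc : ∀ a b : Q, a * b = b * a) (h : ∀ q : Q, q ^ p = 1) : IsElementaryAbelian Q := by
  let : CommGroup Q := { mul_comm := hc }
  have := Fact.mk hp
  have hx : ∀ x : Additive Q, p • x = 0 := fun x => h x.toMul
  have : Module (ZMod p) (Additive Q) := AddCommGroup.zmodModule hx
  let e : Additive Q ≃ₗ[ZMod p] (Fin (Module.finrank (ZMod p) (Additive Q)) → ZMod p) :=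
    (Module.finBasis (ZMod p) (Additive Q)).equivFun
  exact ⟨p, _, hp, ⟨AddEquiv.toMultiplicativeRight e.toAddEquiv⟩⟩

theorem isPGroup_of_dvd_index {p : ℕ} [Fact p.Prime] {Q : Type} [Group Q] [Finite Q]
    (h : ∀ S : Subgroup Q, S ≠ ⊤ → p ∣ S.index) : IsPGroup p Q := by
  let P : Sylow p Q := default
  have hP : (P : Subgroup Q) = ⊤ := by
    by_contra hP
    exact P.not_dvd_index (h _ hP)
  intro q
  obtain ⟨n, hn⟩ := P.isPGroup' ⟨q, (hP ▸ Subgroup.mem_top q : q ∈ (P : Subgroup Q))⟩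
  exact ⟨n, congrArg Subtype.val hn⟩

section
variable {Q : Type} [Group Q]

/-- A group permutes the cosets of a subgroup. -/
def cosetPerm (S : Subgroup Q) : Q →* Equiv.Perm (Q ⧸ S) := MulAction.toPermHom Q (Q ⧸ S)

theorem exists_cosetPerm_ne {S : Subgroup Q} (hS : S ≠ ⊤) (i : Q ⧸ S) :
    ∃ q, cosetPerm S q i ≠ i := by
  by_contra! h
  obtain ⟨x, rfl⟩ := QuotientGroup.mk_surjective i
  refine hS (Subgroup.eq_top_iff' _ |>.2 fun q => ?_)
  have h2 : ((x * q * x⁻¹ * x : Q) : Q ⧸ S) = x := h (x * q * x⁻¹)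
  rw [inv_mul_cancel_right] at h2
  simpa using QuotientGroup.eq.1 h2.symm

end

section
variable {k : Type} [Ring k] {G : Type} [Group G] {M : Type} [AddCommGroup M] [Module k[G] M]
  {f : ℕ → NNReal}

variable (k M) in
/-- The integers whose action on `M` factors through a module of complexity at most `f`. -/
def factorIdeal (hf : IsProperComplexityFunction f) : Ideal ℤ where
  carrier := {n | ∃ (V : Type) (_ : AddCommGroup V) (_ : Module k[G] V) (i : M →ₗ[k[G]] V)
    (r : V →ₗ[k[G]] M), Cds k[G] f V ∧ ∀ a, r (i a) = n • a}
  zero_mem' := ⟨PUnit, _, inferInstance, 0, 0, .of_subsingleton, fun a => by simp⟩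
  add_mem' := by
    rintro a b ⟨V, _, _, i, r, hV, h⟩ ⟨V', _, _, i', r', hV', h'⟩
    exact ⟨V × V', _, inferInstance, i.prod i', r.coprod r', hV.prod hf hV', fun x => by
      simp [h, h', add_smul]⟩
  smul_mem' := by
    rintro n a ⟨V, _, _, i, r, hV, h⟩
    exact ⟨V, _, inferInstance, i, n • r, hV, fun x => by simp [h, mul_smul]⟩

theorem Cds.of_factorIdeal_eq_top {hf : IsProperComplexityFunction f}
    (h : factorIdeal (G := G) k M hf = ⊤) : Cds k[G] f M := by
  obtain ⟨V, _, _, i, r, hV, h⟩ := (Ideal.eq_top_iff_one _).1 h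
  exact hV.retract i r fun a => by rw [h, one_smul]

variable {Q : Type} [Group Q] [Finite Q]

theorem index_mem_factorIdeal (hf : IsProperComplexityFunction f) (π : G →* Q)
    (hM : ∀ S : Subgroup Q, S ≠ ⊤ → SubCds k M f (S.comap π)) {S : Subgroup Q} (hS : S ≠ ⊤) :
    (S.index : ℤ) ∈ factorIdeal (G := G) k M hf := by
  have := Fintype.ofFinite (Q ⧸ S)
  refine ⟨_, _, _, FunMod.const k M ((cosetPerm S).comp π), FunMod.total k M _,
    .funMod_comp hf π hM _ (exists_cosetPerm_ne hS), fun a => ?_⟩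
  rw [FunMod.total_const, Subgroup.index, Nat.card_eq_fintype_card, natCast_zsmul]

/-- A module whose restrictions to all proper subgroups of a finite quotient `Q` have complexity at
most `f` has complexity at most `f`, unless `Q` is elementary abelian. -/
theorem Cds.of_proper (hf : IsProperComplexityFunction f) (π : G →* Q)
    (hM : ∀ S : Subgroup Q, S ≠ ⊤ → SubCds k M f (S.comap π)) (hQ : ¬ IsElementaryAbelian Q) :
    Cds k[G] f M := by
  by_cases hI : factorIdeal (G := G) k M hf = ⊤
  · exact .of_factorIdeal_eq_top hI
  obtain ⟨n, hn⟩ := IsPrincipalIdealRing.principal (factorIdeal (G := G) k M hf)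
  have hn1 : n.natAbs ≠ 1 := fun h => hI <| by
    rw [hn]
    exact Ideal.span_singleton_eq_top.2 (Int.isUnit_iff_natAbs_eq.2 h)
  obtain ⟨p, hp, hpn⟩ := Nat.exists_prime_and_dvd hn1
  have := Fact.mk hp
  have hpQ : IsPGroup p Q := isPGroup_of_dvd_index fun S hS => by
    have h2 := index_mem_factorIdeal hf π hM hS
    rw [hn] at h2
    have h3 := (Int.natCast_dvd.2 hpn).trans (Ideal.mem_span_singleton.1 h2)
    exact_mod_cast h3
  by_cases hc : ∀ a b : Q, a * b = b * a
  · obtain ⟨q, hq⟩ : ∃ q : Q, q ^ p ≠ 1 := by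
      by_contra! h
      exact hQ (isElementaryAbelian_of_pow_eq_one hp hc h)
    obtain ⟨m, _, χ, hχ, hne⟩ := exists_zmod_character_ne hc hq
    have h1 : χ 1 = 0 := by simpa using hχ 1 1
    have : Nontrivial Q := ⟨q ^ p, 1, hq⟩
    obtain ⟨n, hn⟩ := IsPGroup.iff_card.1 hpQ
    obtain ⟨n, rfl⟩ : ∃ n', n = n' + 1 := Nat.exists_eq_succ_of_ne_zero fun h => by
      have := Finite.one_lt_card (α := Q)
      simp [hn, h] at this
    obtain ⟨K, hK⟩ := Sylow.exists_subgroup_card_pow_prime (G := Q) p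
      (hn ▸ pow_dvd_pow p n.le_succ)
    have hi : K.index = p := by
      have := K.card_mul_index
      rw [hK, hn, pow_succ] at this
      exact Nat.eq_of_mul_eq_mul_left (pow_pos hp.pos n) this
    have := Fintype.ofFinite (Q ⧸ K)
    refine .of_multiple hf π hM χ hχ (cosetPerm K) (exists_cosetPerm_ne fun h => ?_) q ?_
    · rw [h, Subgroup.index_top] at hi
      exact hp.one_lt.ne hi
    · rwa [← Nat.card_eq_fintype_card, ← Subgroup.index, hi, ← h1]
  · obtain ⟨A, hA, hcomm, r, a, hr⟩ := hpQ.exists_normal_not_central hc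
    obtain ⟨m, _, χ, hχ, hne⟩ := exists_zmod_character_ne hcomm
      (a := ⟨r * a * r⁻¹, hA.conj_mem a a.2 r⟩) (b := a) fun h => hr (congrArg Subtype.val h)
    exact .of_character hf π hM A χ hχ r a hne

end

theorem IsElementaryAbelian.congr {Q Q' : Type} [Group Q] [Group Q'] (h : IsElementaryAbelian Q)
    (e : Q ≃* Q') : IsElementaryAbelian Q' := by
  obtain ⟨p, r, hp, ⟨ε⟩⟩ := h
  exact ⟨p, r, hp, ⟨e.symm.trans ε⟩⟩

/-- Reduction to elementary abelian subgroups of a finite quotient. -/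
theorem Cds.of_isElementaryAbelian {k : Type} [Ring k] {f : ℕ → NNReal}
    (hf : IsProperComplexityFunction f) (n : ℕ) :
    ∀ {G : Type} [Group G] {M : Type} [AddCommGroup M] [Module k[G] M] {Q : Type} [Group Q]
      [Finite Q], Nat.card Q = n → ∀ π : G →* Q,
      (∀ S : Subgroup Q, IsElementaryAbelian S → SubCds k M f (S.comap π)) → Cds k[G] f M := by
  induction n using Nat.strong_induction_on with
  | _ n ih =>
    intro G _ M _ _ Q _ _ hn π hM
    by_cases hQ : IsElementaryAbelian Q
    · exact .of_subCds_top hf (hM ⊤ (hQ.congr Subgroup.topEquiv.symm))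
    refine .of_proper hf π (fun S hS => ?_) hQ
    refine ⟨S.comap π, inferInstance, (S.comap π).subtype, Subtype.val_injective,
      Subgroup.range_subtype _, ?_⟩
    have hlt : Nat.card S < n := by
      rw [← hn]
      exact lt_of_le_of_ne (Subgroup.card_le_card_group S) fun h => hS (Subgroup.eq_top_of_card_eq S h)
    refine ih _ hlt rfl (π.subgroupComap S) fun T hT => ?_
    have hT' : IsElementaryAbelian (T.map S.subtype) :=
      hT.congr (T.equivMapOfInjective _ Subtype.val_injective)
    have h2 := (hM _ hT').res (Subgroup.comap_mono (f := π) (Subgroup.map_subtype_le T))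
    convert h2 using 1
    ext x
    refine ⟨fun h => ⟨_, h, rfl⟩, ?_⟩
    rintro ⟨y, hy, h⟩
    obtain rfl : y = π.subgroupComap S x := Subtype.ext h
    exact hy

/-- If `H ⊴ G` has finite index and `cds_{kE}(M) ≤ f` for every subgroup `H ≤ E ≤ G`
with `E/H` elementary abelian, then `cds_{kG}(M) ≤ f`. -/
theorem cds_of_elementary_abelian_quotients
    (k : Type) [Ring k] (G : Type) [Group G]
    (H : Subgroup G) [H.Normal] [H.FiniteIndex]
    (M : ModuleCat.{0} (MonoidAlgebra k G))
    (f : ℕ → NNReal) (hf : IsProperComplexityFunction f)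
    (hyp : ∀ E : Subgroup G, H ≤ E → IsElementaryAbelian (E ⧸ H.subgroupOf E) →
      CdsLE (MonoidAlgebra k E) (resMod k E M) f) :
    CdsLE (MonoidAlgebra k G) M f := by
  refine cdsLE_iff.2 (Cds.of_isElementaryAbelian hf _ rfl (QuotientGroup.mk' H) fun S hS => ?_)
  let E := S.comap (QuotientGroup.mk' H)
  have hHE : H ≤ E := fun h hh => by
    change (h : G ⧸ H) ∈ S
    rw [(QuotientGroup.eq_one_iff h).2 hh]
    exact S.one_mem
  let φ : E →* S := (QuotientGroup.mk' H).subgroupComap S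
  have hφ : Function.Surjective φ := by
    rintro ⟨x, hx⟩
    obtain ⟨g, rfl⟩ := QuotientGroup.mk_surjective x
    exact ⟨⟨g, hx⟩, rfl⟩
  have hker : φ.ker = H.subgroupOf E := by
    ext x
    rw [MonoidHom.mem_ker, Subgroup.mem_subgroupOf, ← QuotientGroup.eq_one_iff]
    exact Subtype.ext_iff
  let e : E ⧸ H.subgroupOf E ≃* S :=
    (QuotientGroup.quotientMulEquivOfEq hker.symm).trans
      (QuotientGroup.quotientKerEquivOfSurjective φ hφ)
  have h2 := cdsLE_iff.1 (hyp E hHE (hS.congr e.symm))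
  exact ⟨E, inferInstance, E.subtype, Subtype.val_injective, Subgroup.range_subtype _, h2⟩
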